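/- (Stability estimates.) Let α, a, b, β, λ_q, δ_q, ℓ_q, τ_q, N_0 be as in the parameter setup. Let (v_ℓ, θ_ℓ, p_ℓ, R̊_ℓ, T_ℓ) be a smooth solution of the relaxed Boussinesq–Reynolds system on [0,T] satisfying ‖(v_ℓ, θ_ℓ)‖_{N+1} ≲ δ_q^{1/2} λ_q ℓ_q^{−N} and ‖(R̊_ℓ, T_ℓ)‖_{N+α} ≲ δ_{q+1} ℓ_q^{−N+5α/4} for 0 ≤ N ≤ N_0+2. Let t_i ∈ [0,T] with [t_i − τ_q, t_i + τ_q] ⊂ [0,T], and let (v_i, θ_i, p_i) be the smooth solution of the exact inviscid Boussinesq system on [t_i − τ_q, t_i + τ_q] with data (v_i, θ_i)|_{t = t_i} = (v_ℓ(·, t_i), θ_ℓ(·, t_i)). Then for a sufficiently large, for every t with |t − t_i| ≤ τ_q and every 0 ≤ N ≤ N_0 + 1: (i) ‖(v_i − v_ℓ, θ_i − θ_ℓ)(t)‖_{N+α} ≲ τ_q δ_{q+1} ℓ_q^{−N−1+5α/4}; (ii) ‖(∇p_i − ∇p_ℓ)(t)‖_{N+α} ≲ δ_{q+1} ℓ_q^{−N−1+5α/4};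 (iii) ‖(D_ℓ(v_i − v_ℓ), D_ℓ(θ_i − θ_ℓ))(t)‖_{N+α} ≲ δ_{q+1} ℓ_q^{−N−1+5α/4}, where D_ℓ = ∂_t + v_ℓ·∇; (iv) ‖(R(v_i − v_ℓ), R_vex(θ_i − θ_ℓ))(t)‖_α ≲ τ_q δ_{q+1} ℓ_q^{5α/4}. -/

import Mathlib

open MeasureTheory Set Real Filter
open scoped ENNReal NNReal BigOperators

noncomputable section

abbrev V3 := Fin 3 → ℝ

/-- Fundamental domain of the torus `T³ = ℝ³/ℤ³`. -/
def cube3 : Set V3 := Set.univ.pi fun _ => Set.Ico (0:ℝ) 1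

/-- The measure on the torus, realized as Lebesgue measure on the fundamental domain. -/
def muT : Measure V3 := volume.restrict cube3

/-- `ℤ³`-periodicity of a function on `ℝ³`. -/
def Per {α : Type*} (f : V3 → α) : Prop :=
  ∀ (x : V3) (k : Fin 3 → ℤ), f (x + (fun i => (k i : ℝ))) = f x

/-- The partial derivative `∂ᵢ g` at `x`. -/
def pd (g : V3 → ℝ) (i : Fin 3) (x : V3) : ℝ := fderiv ℝ g x (Pi.single i 1)

/-- Divergence of a vector field. -/
def divg (u : V3 → V3) (x : V3) : ℝ := ∑ i, pd (fun y => u y i) i x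

/-- Euclidean norm on `ℝ³`. -/
def nE (x : V3) : ℝ := Real.sqrt (∑ i, x i ^ 2)

/-- A Littlewood–Paley pair `(χ, φ̃)`: smooth radial cutoffs with the standard support,
value and partition-of-unity properties. -/
def LPSetup (χ φt : V3 → ℝ) : Prop :=
  ContDiff ℝ (⊤ : ℕ∞) χ ∧ ContDiff ℝ (⊤ : ℕ∞) φt ∧
  (∀ ξ η : V3, nE ξ = nE η → χ ξ = χ η) ∧ (∀ ξ η : V3, nE ξ = nE η → φt ξ = φt η) ∧
  (∀ ξ, χ ξ ∈ Icc (0:ℝ) 1) ∧ (∀ ξ, φt ξ ∈ Icc (0:ℝ) 1) ∧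
  (∀ ξ, 4/3 < nE ξ → χ ξ = 0) ∧ (∀ ξ, nE ξ ≤ 3/4 → χ ξ = 1) ∧
  (∀ ξ, nE ξ < 3/4 ∨ 8/3 < nE ξ → φt ξ = 0) ∧
  (∀ ξ, 6/7 ≤ nE ξ → nE ξ ≤ 12/7 → φt ξ = 1) ∧
  (∀ ξ, χ ξ + ∑' j : ℕ, φt (((2:ℝ) ^ (-(j:ℤ))) • ξ) = 1)

/-- The character `e^{2πi k·x}`. -/
def eK (k : Fin 3 → ℤ) (x : V3) : ℂ :=
  Complex.exp (2 * (Real.pi : ℂ) * Complex.I * (∑ i, (k i : ℂ) * (x i : ℂ)))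

/-- Fourier coefficient of a periodic function. -/
def fc (f : V3 → ℝ) (k : Fin 3 → ℤ) : ℂ := ∫ x in cube3, (f x : ℂ) * eK (-k) x

/-- The Littlewood–Paley block `Δ_j f` on the torus (`j = -1` uses `χ`, `j ≥ 0` uses `φ̃`). -/
def LPproj (χ φt : V3 → ℝ) (j : ℤ) (f : V3 → ℝ) (x : V3) : ℂ :=
  ∑' k : Fin 3 → ℤ,
    (((if j = -1 then χ (fun i => (k i : ℝ))
        else if 0 ≤ j then φt (((2:ℝ) ^ (-j)) • (fun i => (k i : ℝ)))
        else 0) : ℝ) : ℂ) * (fc f k * eK k x)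

/-- The quantity `2^{j/3} ‖Δ_j f‖_{L^r(T³)}` entering the Besov norm `B^{1/3}_{r,∞}`. -/
def besovPiece (χ φt : V3 → ℝ) (r : ℝ≥0∞) (f : V3 → ℝ) (j : ℤ) : ℝ≥0∞ :=
  ENNReal.ofReal ((2:ℝ) ^ ((j : ℝ) / 3)) * eLpNorm (LPproj χ φt j f) r muT

/-- The zero-mean inverse Laplacian `Δ⁻¹` on the torus, via Fourier multipliers
`-1/(4π²|k|²)` on the nonzero frequencies. -/
def invLap (f : V3 → ℝ) (x : V3) : ℝ :=
  (∑' k : Fin 3 → ℤ, (if k = 0 then 0 else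
      (-1 / (4 * (Real.pi : ℂ)^2 * (((∑ i, ((k i : ℝ))^2) : ℝ) : ℂ))) * (fc f k * eK k x))).re

/-- `(-Δ)⁻¹ = -Δ⁻¹` on zero-mean functions. -/
def nInv (f : V3 → ℝ) : V3 → ℝ := fun x => -(invLap f x)

/-- The inverse-divergence operator
`R u = -(-Δ)⁻¹(∇u + (∇u)ᵀ) - ½(-Δ)⁻²∇²(∇·u) + ½(-Δ)⁻¹(∇·u) Id`. -/
def RopR (u : V3 → V3) (x : V3) (i j : Fin 3) : ℝ :=
  -(nInv (fun y => pd (fun z => u z i) j y + pd (fun z => u z j) i y) x)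
  - (1/2) * nInv (nInv (fun y => pd (fun z => pd (fun w => divg u w) j z) i y)) x
  + (1/2) * (if i = j then nInv (fun y => divg u y) x else 0)

/-- The inverse-divergence operator for scalars: `R_vex f = ∇Δ⁻¹(f - ⨍f)`. -/
def Rvex (f : V3 → ℝ) (x : V3) (i : Fin 3) : ℝ :=
  pd (invLap (fun z => f z - ∫ w in cube3, f w)) i x

/-- Solution of the relaxed Boussinesq–Reynolds system on the time set `I`, with Reynolds
stress `R` (symmetric and trace-free) and temperature stress `Tv`. -/
structure RelaxedOn (I : Set ℝ) (v : ℝ → V3 → V3) (θ p : ℝ → V3 → ℝ)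
    (R : ℝ → V3 → Fin 3 → Fin 3 → ℝ) (Tv : ℝ → V3 → V3) : Prop where
  smooth : ContDiff ℝ (⊤ : ℕ∞)
      (fun q : ℝ × V3 => (v q.1 q.2, θ q.1 q.2, p q.1 q.2, R q.1 q.2, Tv q.1 q.2))
  perv : ∀ t, Per (v t)
  perθ : ∀ t, Per (θ t)
  perp : ∀ t, Per (p t)
  perR : ∀ t, Per (R t)
  perT : ∀ t, Per (Tv t)
  symmR : ∀ t (x : V3) (i j : Fin 3), R t x i j = R t x j i
  traceR : ∀ t (x : V3), ∑ i, R t x i i = 0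
  momentum : ∀ t ∈ I, ∀ (x : V3) (i : Fin 3),
      deriv (fun s => v s x i) t + (∑ j, pd (fun y => v t y j * v t y i) j x)
          + pd (p t) i x
        = (if i = 2 then θ t x else 0) + ∑ j, pd (fun y => R t y i j) j x
  transport : ∀ t ∈ I, ∀ x : V3,
      deriv (fun s => θ s x) t + (∑ j, v t x j * pd (θ t) j x)
        = ∑ j, pd (fun y => Tv t y j) j x
  divfree : ∀ t ∈ I, ∀ x : V3, divg (v t) x = 0

/-- Classical (smooth, periodic) solution of the inviscid Boussinesq system on the
time set `I`. -/
structure ClassicalOn (I : Set ℝ) (v : ℝ → V3 → V3) (θ p : ℝ → V3 → ℝ) : Prop where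
  smooth : ContDiff ℝ (⊤ : ℕ∞) (fun q : ℝ × V3 => (v q.1 q.2, θ q.1 q.2, p q.1 q.2))
  perv : ∀ t, Per (v t)
  perθ : ∀ t, Per (θ t)
  perp : ∀ t, Per (p t)
  momentum : ∀ t ∈ I, ∀ (x : V3) (i : Fin 3),
      deriv (fun s => v s x i) t + (∑ j, v t x j * pd (fun y => v t y i) j x)
          + pd (p t) i x = (if i = 2 then θ t x else 0)
  transport : ∀ t ∈ I, ∀ x : V3,
      deriv (fun s => θ s x) t + (∑ j, v t x j * pd (θ t) j x) = 0
  divfree : ∀ t ∈ I, ∀ x : V3, divg (v t) x = 0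

/-- The frequency parameter `λ_q = ⌈a^{b^q}⌉`. -/
def lamP (a b : ℝ) (q : ℕ) : ℝ := ((⌈a ^ (b ^ q)⌉ : ℤ) : ℝ)

/-- The amplitude parameter `δ_q = λ_2^{3β} λ_q^{-2β}`. -/
def delP (a b β : ℝ) (q : ℕ) : ℝ := lamP a b 2 ^ (3 * β) * lamP a b q ^ (-(2 * β))

/-- The mollification scale `ℓ_q = δ_{q+1}^{1/2} δ_q^{-1/2} λ_q^{-1-3α/2}`. -/
def ellP (a b β α : ℝ) (q : ℕ) : ℝ :=
  delP a b β (q+1) ^ ((1:ℝ)/2) / delP a b β q ^ ((1:ℝ)/2) / lamP a b q ^ (1 + 3*α/2)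

/-- The time scale `τ_q = ℓ_q^{2α} δ_q^{-1/2} λ_q^{-1}`. -/
def tauP (a b β α : ℝ) (q : ℕ) : ℝ :=
  ellP a b β α q ^ (2*α) / (delP a b β q ^ ((1:ℝ)/2) * lamP a b q)

/-- `‖g‖_{C^{N+α}} ≤ B`: all derivatives up to order `N` are bounded by `B` and the
`N`-th derivative has `α`-Hölder constant at most `B`. -/
def CNaB {F : Type*} [NormedAddCommGroup F] [NormedSpace ℝ F]
    (N : ℕ) (α B : ℝ) (g : V3 → F) : Prop :=
  (∀ k : ℕ, k ≤ N → ∀ x : V3, ‖iteratedFDeriv ℝ k g x‖ ≤ B) ∧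
  (∀ x y : V3, ‖iteratedFDeriv ℝ N g x - iteratedFDeriv ℝ N g y‖ ≤ B * ‖x - y‖ ^ α)

/-- The material derivative `D_{v_ℓ} f = ∂_t f + v_ℓ·∇f`. -/
def matD (vl : ℝ → V3 → V3) (f : ℝ → V3 → ℝ) (t : ℝ) (x : V3) : ℝ :=
  deriv (fun s => f s x) t + ∑ j, vl t x j * pd (f t) j x

lemma two_le_smooth : minSmoothness ℝ 2 ≤ ((⊤ : ℕ∞) : WithTop ℕ∞) := by
  simpa using (WithTop.coe_le_coe.2 (le_top : (2 : ℕ∞) ≤ ⊤))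

lemma pd_eq_hasFDerivAt {g : V3 → ℝ} {g' : V3 →L[ℝ] ℝ} {x : V3} (h : HasFDerivAt g g' x)
    (i : Fin 3) : pd g i x = g' (Pi.single i 1) := by
  rw [pd, h.fderiv]

lemma contDiff_pd {g : V3 → ℝ} (hg : ContDiff ℝ (⊤ : ℕ∞) g) (i : Fin 3) :
    ContDiff ℝ (⊤ : ℕ∞) (pd g i) :=
  (hg.fderiv_right (m := (⊤ : ℕ∞)) (by simp)).clm_apply contDiff_const

lemma per_pd {g : V3 → ℝ} (hg : Per g) (i : Fin 3) : Per (pd g i) := by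
  intro x k
  have : (fun y => g (y + fun i => (k i : ℝ))) = g := funext fun y => hg y k
  unfold pd
  rw [← fderiv_comp_add_right, this]

/-- The algebra of smooth `ℤ³`-periodic functions. -/
def smPerAlg : Subalgebra ℝ (V3 → ℝ) where
  carrier := {f | ContDiff ℝ (⊤ : ℕ∞) f ∧ Per f}
  mul_mem' := fun hf hg => ⟨hf.1.mul hg.1, fun x k => by simp [hf.2 x k, hg.2 x k]⟩
  add_mem' := fun hf hg => ⟨hf.1.add hg.1, fun x k => by simp [hf.2 x k, hg.2 x k]⟩
  algebraMap_mem' := fun r => ⟨contDiff_const, fun _ _ => rfl⟩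

/-- Smooth `ℤ³`-periodic functions. -/
abbrev SmPer : Type := smPerAlg

namespace SmPer

instance : CoeFun SmPer (fun _ => V3 → ℝ) := ⟨fun f => f.1⟩

lemma smooth (f : SmPer) : ContDiff ℝ (⊤ : ℕ∞) (f : V3 → ℝ) := f.2.1
lemma per (f : SmPer) : Per (f : V3 → ℝ) := f.2.2
lemma cont (f : SmPer) : Continuous (f : V3 → ℝ) := f.smooth.continuous
lemma diff (f : SmPer) : Differentiable ℝ (f : V3 → ℝ) := f.smooth.differentiable (by simp)

@[simp] lemma add_apply (f g : SmPer) (x : V3) : (f + g) x = f x + g x := rfl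
@[simp] lemma mul_apply (f g : SmPer) (x : V3) : (f * g) x = f x * g x := rfl
@[simp] lemma sub_apply (f g : SmPer) (x : V3) : (f - g) x = f x - g x := rfl
@[simp] lemma smul_apply (c : ℝ) (f : SmPer) (x : V3) : (c • f) x = c * f x := rfl
@[simp] lemma zero_apply (x : V3) : (0 : SmPer) x = 0 := rfl

lemma sum_apply {ι : Type*} (s : Finset ι) (f : ι → SmPer) (x : V3) :
    (∑ i ∈ s, f i) x = ∑ i ∈ s, f i x := by
  change smPerAlg.val (∑ i ∈ s, f i) x = _
  rw [map_sum, Finset.sum_apply]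
  rfl

lemma ext' {f g : SmPer} (h : ∀ x, f x = g x) : f = g := Subtype.ext (funext h)

/-- The partial derivative `∂ᵢ` as a derivation of the algebra of smooth periodic functions. -/
def D (i : Fin 3) : Derivation ℝ SmPer SmPer :=
  Derivation.mk'
    { toFun := fun f => ⟨pd f i, contDiff_pd f.smooth i, per_pd f.per i⟩
      map_add' := fun f g => ext' fun x => by
        exact pd_eq_hasFDerivAt ((f.diff x).hasFDerivAt.add (g.diff x).hasFDerivAt) i
      map_smul' := fun c f => ext' fun x => by
        exact pd_eq_hasFDerivAt ((f.diff x).hasFDerivAt.const_smul c) i }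
    (fun f g => ext' fun x => by
      refine (pd_eq_hasFDerivAt ((f.diff x).hasFDerivAt.mul (g.diff x).hasFDerivAt) i).trans ?_
      simp [pd])

lemma D_apply (i : Fin 3) (f : SmPer) (x : V3) : D i f x = pd f i x := rfl

lemma fderiv_apply (f : SmPer) (x w : V3) :
    fderiv ℝ (f : V3 → ℝ) x w = ∑ i, w i * D i f x := by
  have h : w = ∑ i, w i • (Pi.single i (1 : ℝ) : V3) := by
    ext j; simp [Finset.sum_apply, Pi.single_apply]
  conv_lhs => rw [h]
  simp [D_apply, pd]

lemma D_comm (i j : Fin 3) (f : SmPer) : D i (D j f) = D j (D i f) := by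
  refine ext' fun x => ?_
  have h2 : ∀ i j : Fin 3, pd (pd f j) i x =
      fderiv ℝ (fderiv ℝ (f : V3 → ℝ)) x (Pi.single i 1) (Pi.single j 1) := by
    intro i j
    have hd : DifferentiableAt ℝ (fderiv ℝ (f : V3 → ℝ)) x :=
      ((f.smooth.fderiv_right (m := (⊤ : ℕ∞)) (by simp)).differentiable (by simp)) x
    have := hd.hasFDerivAt.clm_apply (hasFDerivAt_const (Pi.single j (1 : ℝ) : V3) x)
    refine (pd_eq_hasFDerivAt this i).trans ?_
    simp
  change pd (pd f j) i x = pd (pd f i) j x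
  rw [h2, h2]
  exact (f.smooth.contDiffAt.isSymmSndFDerivAt two_le_smooth) _ _

end SmPer

lemma exists_floor_shift (x : V3) : ∃ k : Fin 3 → ℤ,
    (x + fun i => (k i : ℝ)) ∈ Icc (0 : V3) 1 := by
  refine ⟨fun i => -⌊x i⌋, ?_, ?_⟩ <;> intro i
  · have := Int.floor_le (x i); simp; linarith
  · have := Int.lt_floor_add_one (x i); simp; linarith

/-- The algebra of smooth functions of time and space which are `ℤ³`-periodic in space. -/
def stPerAlg : Subalgebra ℝ (ℝ × V3 → ℝ) where
  carrier := {f | ContDiff ℝ (⊤ : ℕ∞) f ∧ ∀ t, Per (fun x => f (t, x))}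
  mul_mem' := fun hf hg => ⟨hf.1.mul hg.1, fun t x k => by
    have := hf.2 t x k; have := hg.2 t x k; simp_all⟩
  add_mem' := fun hf hg => ⟨hf.1.add hg.1, fun t x k => by
    have := hf.2 t x k; have := hg.2 t x k; simp_all⟩
  algebraMap_mem' := fun r => ⟨contDiff_const, fun _ _ _ => rfl⟩

/-- Smooth functions of time and space, periodic in space. -/
abbrev STPer : Type := stPerAlg

namespace STPer

instance : CoeFun STPer (fun _ => ℝ × V3 → ℝ) := ⟨fun f => f.1⟩

lemma smooth (f : STPer) : ContDiff ℝ (⊤ : ℕ∞) (f : ℝ × V3 → ℝ) := f.2.1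
lemma cont (f : STPer) : Continuous (f : ℝ × V3 → ℝ) := f.smooth.continuous
lemma diff (f : STPer) : Differentiable ℝ (f : ℝ × V3 → ℝ) := f.smooth.differentiable (by simp)
lemma ext' {f g : STPer} (h : ∀ x, f x = g x) : f = g := Subtype.ext (funext h)

/-- The time slice of a space-time function. -/
def sl (t : ℝ) : STPer →ₐ[ℝ] SmPer where
  toFun f := ⟨fun x => f (t, x), f.smooth.comp (contDiff_const.prodMk contDiff_id), f.2.2 t⟩
  map_one' := rfl
  map_mul' _ _ := rfl
  map_zero' := rfl
  map_add' _ _ := rfl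
  commutes' _ := rfl

lemma sl_apply (t : ℝ) (f : STPer) (x : V3) : sl t f x = f (t, x) := rfl

lemma hasFDerivAt_slice (f : STPer) (t : ℝ) (x : V3) :
    HasFDerivAt (fun y => f (t, y))
      ((fderiv ℝ (f : ℝ × V3 → ℝ) (t, x)).comp (ContinuousLinearMap.inr ℝ ℝ V3)) x := by
  have h1 : HasFDerivAt (fun y : V3 => (t, y)) (ContinuousLinearMap.inr ℝ ℝ V3) x :=
    hasFDerivAt_prodMk_right t x
  exact (f.diff (t, x)).hasFDerivAt.comp x h1

lemma hasDerivAt_time (f : STPer) (t : ℝ) (x : V3) :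
    HasDerivAt (fun s => f (s, x)) (fderiv ℝ (f : ℝ × V3 → ℝ) (t, x) (1, 0)) t := by
  have h1 : HasDerivAt (fun s : ℝ => (s, x)) ((1 : ℝ), (0 : V3)) t :=
    (hasDerivAt_id t).prodMk (hasDerivAt_const t x)
  exact (f.diff (t, x)).hasFDerivAt.comp_hasDerivAt t h1

lemma contDiff_dir (f : STPer) (w : ℝ × V3) :
    ContDiff ℝ (⊤ : ℕ∞) (fun q => fderiv ℝ (f : ℝ × V3 → ℝ) q w) :=
  (f.smooth.fderiv_right (m := (⊤ : ℕ∞)) (by simp)).clm_apply contDiff_const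

/-- The spatial partial derivative of a space-time function. -/
def dx (i : Fin 3) (f : STPer) : STPer :=
  ⟨fun q => pd (fun y => f (q.1, y)) i q.2, by
    refine ⟨?_, fun t => per_pd (f.2.2 t) i⟩
    convert contDiff_dir f (0, Pi.single i 1) using 1
    funext q
    exact pd_eq_hasFDerivAt (hasFDerivAt_slice f q.1 q.2) i⟩

/-- The time derivative of a space-time function. -/
def dt (f : STPer) : STPer :=
  ⟨fun q => deriv (fun s => f (s, q.2)) q.1, by
    refine ⟨?_, fun t x k => ?_⟩
    · convert contDiff_dir f (1, 0) using 1
      funext q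
      exact (hasDerivAt_time f q.1 q.2).deriv
    · have : (fun s => f (s, x + fun i => (k i : ℝ))) = fun s => f (s, x) :=
        funext fun s => f.2.2 s x k
      simp only [this]⟩

lemma sl_dx (t : ℝ) (i : Fin 3) (f : STPer) : sl t (dx i f) = SmPer.D i (sl t f) := rfl

lemma dx_eq (i : Fin 3) (f : STPer) (q : ℝ × V3) :
    dx i f q = fderiv ℝ (f : ℝ × V3 → ℝ) q (0, Pi.single i 1) :=
  pd_eq_hasFDerivAt (hasFDerivAt_slice f q.1 q.2) i

lemma dt_eq (f : STPer) (q : ℝ × V3) :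
    dt f q = fderiv ℝ (f : ℝ × V3 → ℝ) q (1, 0) := (hasDerivAt_time f q.1 q.2).deriv

lemma hasDerivAt_dt (f : STPer) (t : ℝ) (x : V3) :
    HasDerivAt (fun s => f (s, x)) (dt f (t, x)) t := by
  rw [dt_eq]; exact hasDerivAt_time f t x

lemma fderiv_apply (f : STPer) (q w : ℝ × V3) :
    fderiv ℝ (f : ℝ × V3 → ℝ) q w = w.1 * dt f q + ∑ i, w.2 i * dx i f q := by
  have h : w = w.1 • ((1 : ℝ), (0 : V3)) + ∑ i, w.2 i • ((0 : ℝ), (Pi.single i (1 : ℝ) : V3)) := by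
    refine Prod.ext ?_ ?_
    · simp [Prod.fst_sum]
    · ext j; simp [Prod.snd_sum, Finset.sum_apply, Pi.single_apply]
  conv_lhs => rw [h]
  simp only [map_add, map_sum, map_smul, smul_eq_mul, dx_eq, dt_eq]

lemma dt_dx_comm (i : Fin 3) (f : STPer) : dt (dx i f) = dx i (dt f) := by
  refine ext' fun q => ?_
  have hd : DifferentiableAt ℝ (fderiv ℝ (f : ℝ × V3 → ℝ)) q :=
    ((f.smooth.fderiv_right (m := (⊤ : ℕ∞)) (by simp)).differentiable (by simp)) q
  have key : ∀ w w' : ℝ × V3, fderiv ℝ (fun q => fderiv ℝ (f : ℝ × V3 → ℝ) q w) q w' =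
      fderiv ℝ (fderiv ℝ (f : ℝ × V3 → ℝ)) q w' w := by
    intro w w'
    have := hd.hasFDerivAt.clm_apply (hasFDerivAt_const w q)
    rw [this.fderiv]; simp
  rw [dt_eq, dx_eq]
  have e1 : ((dx i f : STPer) : ℝ × V3 → ℝ) =
    fun q => fderiv ℝ (f : ℝ × V3 → ℝ) q (0, Pi.single i 1) := funext fun q => dx_eq i f q
  have e2 : ((dt f : STPer) : ℝ × V3 → ℝ) =
    fun q => fderiv ℝ (f : ℝ × V3 → ℝ) q (1, 0) := funext fun q => dt_eq f q
  rw [e1, e2, key, key]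
  exact (f.smooth.contDiffAt.isSymmSndFDerivAt two_le_smooth) _ _

lemma bounded (f : STPer) (c d : ℝ) : ∃ M, 0 ≤ M ∧ ∀ t ∈ Icc c d, ∀ x, |f (t, x)| ≤ M := by
  obtain ⟨M, hM⟩ := (isCompact_Icc.prod isCompact_Icc :
    IsCompact (Icc c d ×ˢ Icc (0 : V3) 1)).exists_bound_of_continuousOn f.cont.continuousOn
  refine ⟨max M 0, le_max_right _ _, fun t ht x => ?_⟩
  obtain ⟨k, hk⟩ := exists_floor_shift x
  have h1 := f.2.2 t x k
  have h2 := hM (t, _) ⟨ht, hk⟩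
  rw [← show f (t, x + fun i => (k i : ℝ)) = f (t, x) from h1]
  exact h2.trans (le_max_left _ _)

/-- A smooth periodic function, regarded as constant in time. -/
def ofSm (f : SmPer) : STPer :=
  ⟨fun q => f q.2, f.smooth.comp contDiff_snd, fun _ => f.per⟩

end STPer

namespace SmPer

lemma bounded (f : SmPer) : ∃ M, 0 ≤ M ∧ ∀ x, |f x| ≤ M := by
  obtain ⟨M, h0, h⟩ := (STPer.ofSm f).bounded 0 0
  exact ⟨M, h0, fun x => h 0 (by simp) x⟩

end SmPer

/-- `f` is `α`-Hölder continuous with constant `B`. -/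
def Hol (α B : ℝ) (f : V3 → ℝ) : Prop := ∀ x y : V3, |f x - f y| ≤ B * ‖x - y‖ ^ α

/-- The weighted Hölder bound `ℓ ^ k * ‖∇ᵏ f‖_{C^α} ≤ B` for `k ≤ m`. -/
def HB (l α : ℝ) : ℕ → ℝ → SmPer → Prop
  | 0, B, f => (∀ x, |f x| ≤ B) ∧ Hol α B f
  | m + 1, B, f => ((∀ x, |f x| ≤ B) ∧ Hol α B f) ∧ ∀ i, HB l α m B (l • SmPer.D i f)

namespace HB

variable {l α : ℝ} {m : ℕ} {B B' : ℝ} {f g : SmPer}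

lemma base (h : HB l α m B f) : HB l α 0 B f := by
  cases m with
  | zero => exact h
  | succ m => exact h.1

lemma sup (h : HB l α m B f) (x : V3) : |f x| ≤ B := h.base.1 x

lemma hol (h : HB l α m B f) : Hol α B f := h.base.2

lemma nonneg (h : HB l α m B f) : 0 ≤ B := (abs_nonneg _).trans (h.sup 0)

lemma mono (h : HB l α m B f) (hB : B ≤ B') : HB l α m B' f := by
  induction m generalizing f with
  | zero =>
    exact ⟨fun x => (h.1 x).trans hB, fun x y => (h.2 x y).trans (by gcongr)⟩
  | succ m ih =>
    exact ⟨⟨fun x => (h.1.1 x).trans hB, fun x y => (h.1.2 x y).trans (by gcongr)⟩,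
      fun i => ih (h.2 i)⟩

lemma of_succ (h : HB l α (m + 1) B f) : HB l α m B f := by
  induction m generalizing f with
  | zero => exact h.1
  | succ m ih => exact ⟨h.1, fun i => ih (h.2 i)⟩

lemma add (hf : HB l α m B f) (hg : HB l α m B' g) : HB l α m (B + B') (f + g) := by
  have h0 : ∀ {f g : SmPer}, HB l α 0 B f → HB l α 0 B' g → HB l α 0 (B + B') (f + g) := by
    intro f g hf hg
    refine ⟨fun x => (abs_add_le _ _).trans (add_le_add (hf.1 x) (hg.1 x)), fun x y => ?_⟩
    have e : (f + g) x - (f + g) y = (f x - f y) + (g x - g y) := by simp; ring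
    rw [e, add_mul]
    exact (abs_add_le _ _).trans (add_le_add (hf.2 x y) (hg.2 x y))
  induction m generalizing f g with
  | zero => exact h0 hf hg
  | succ m ih =>
    refine ⟨h0 hf.base hg.base, fun i => ?_⟩
    rw [map_add, smul_add]
    exact ih (hf.2 i) (hg.2 i)

lemma smul (c : ℝ) (hf : HB l α m B f) : HB l α m (|c| * B) (c • f) := by
  have h0 : ∀ {f : SmPer}, HB l α 0 B f → HB l α 0 (|c| * B) (c • f) := by
    intro f hf
    refine ⟨fun x => ?_, fun x y => ?_⟩
    · rw [SmPer.smul_apply, abs_mul]; gcongr; exact hf.1 x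
    · rw [SmPer.smul_apply, SmPer.smul_apply, ← mul_sub, abs_mul, mul_assoc]
      gcongr; exact hf.2 x y
  induction m generalizing f with
  | zero => exact h0 hf
  | succ m ih =>
    refine ⟨h0 hf.base, fun i => ?_⟩
    rw [Derivation.map_smul, smul_comm]
    exact ih (hf.2 i)

lemma neg (hf : HB l α m B f) : HB l α m B (-f) := by
  have := hf.smul (-1)
  simpa using this

lemma sub (hf : HB l α m B f) (hg : HB l α m B' g) : HB l α m (B + B') (f - g) := by
  rw [sub_eq_add_neg]; exact hf.add hg.neg

lemma zero (hB : 0 ≤ B) : HB l α m B 0 := by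
  have h0 : HB l α 0 B 0 := ⟨fun x => by simpa using hB, fun x y => by simp; positivity⟩
  induction m with
  | zero => exact h0
  | succ m ih => exact ⟨h0, fun i => by simpa using ih⟩

lemma sum3 {F : Fin 3 → SmPer} (h : ∀ i, HB l α m B (F i)) : HB l α m (3 * B) (∑ i, F i) := by
  rw [Fin.sum_univ_three]
  exact (((h 0).add (h 1)).add (h 2)).mono (by linarith)

lemma ite_zero (p : Prop) [Decidable p] (h : HB l α m B f) :
    HB l α m B (if p then f else 0) := by
  split_ifs
  · exact h
  · exact zero h.nonneg

lemma mul (hf : HB l α m B f) (hg : HB l α m B' g) :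
    HB l α m (2 ^ (m + 1) * (B * B')) (f * g) := by
  have h0 : ∀ {f g : SmPer}, HB l α 0 B f → HB l α 0 B' g →
      HB l α 0 (2 * (B * B')) (f * g) := by
    intro f g hf hg
    have hB := hf.nonneg
    have hB' := hg.nonneg
    refine ⟨fun x => ?_, fun x y => ?_⟩
    · rw [SmPer.mul_apply, abs_mul]
      have := mul_le_mul (hf.1 x) (hg.1 x) (abs_nonneg _) hB
      nlinarith [mul_nonneg hB hB']
    · have e : (f * g) x - (f * g) y = f x * (g x - g y) + (f x - f y) * g y := by simp; ring
      rw [e]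
      have h1 := mul_le_mul (hf.1 x) (hg.2 x y) (abs_nonneg _) hB
      have h2 := mul_le_mul (hf.2 x y) (hg.1 y) (abs_nonneg _) (by positivity)
      refine (abs_add_le _ _).trans ?_
      rw [abs_mul, abs_mul]
      linarith
  induction m generalizing f g with
  | zero => simpa using h0 hf hg
  | succ m ih =>
    have hBB : 0 ≤ B * B' := mul_nonneg hf.nonneg hg.nonneg
    have hp : (1 : ℝ) ≤ 2 ^ (m + 1) := one_le_pow₀ (by norm_num)
    refine ⟨(h0 hf.base hg.base).mono ?_, fun i => ?_⟩
    · rw [pow_succ]; nlinarith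
    · have e : l • SmPer.D i (f * g) = f * (l • SmPer.D i g) + (l • SmPer.D i f) * g := by
        rw [Derivation.leibniz]
        simp only [smul_add, smul_eq_mul, mul_smul_comm, smul_mul_assoc]
        rw [mul_comm g]
      rw [e]
      refine ((ih hf.of_succ (hg.2 i)).add (ih (hf.2 i) hg.of_succ)).mono ?_
      rw [pow_succ 2 (m + 1)]; linarith

lemma deriv (hl : 0 < l) (h : HB l α (m + 1) B f) (i : Fin 3) :
    HB l α m (B / l) (SmPer.D i f) := by
  have := (h.2 i).smul l⁻¹
  rw [smul_smul, inv_mul_cancel₀ hl.ne', one_smul, abs_of_pos (inv_pos.2 hl)] at this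
  exact this.mono (by rw [div_eq_inv_mul])

end HB

lemma SmPer.lipschitz_of_D_le {f : SmPer} {b : ℝ} (h : ∀ i x, |SmPer.D i f x| ≤ b) (x y : V3) :
    |f x - f y| ≤ 3 * b * ‖x - y‖ := by
  have hb : 0 ≤ b := (abs_nonneg _).trans (h 0 0)
  have := Convex.norm_image_sub_le_of_norm_fderiv_le (𝕜 := ℝ) (f := (f : V3 → ℝ)) (C := 3 * b)
    (s := Set.univ) (x := y) (y := x) (fun z _ => f.diff z) (fun z _ => ?_) convex_univ trivial trivial
  · simpa using this
  · refine ContinuousLinearMap.opNorm_le_bound _ (by positivity) fun w => ?_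
    rw [SmPer.fderiv_apply]
    calc ‖∑ i, w i * SmPer.D i f z‖ ≤ ∑ i : Fin 3, ‖w‖ * b := by
          refine norm_sum_le_of_le _ fun i _ => ?_
          rw [norm_mul]
          exact mul_le_mul (norm_le_pi_norm w i) (h i z) (norm_nonneg _) (norm_nonneg _)
      _ = 3 * b * ‖w‖ := by simp; ring

lemma SmPer.hol_of_bounds {f : SmPer} {a l α : ℝ} (hl : 0 < l) (hα0 : 0 ≤ α) (hα1 : α ≤ 1)
    (h0 : ∀ x, |f x| ≤ a) (h1 : ∀ i x, |SmPer.D i f x| ≤ a / l) :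
    Hol α (3 * a * l ^ (-α)) f := by
  intro x y
  have ha : 0 ≤ a := (abs_nonneg _).trans (h0 0)
  have hr : 0 ≤ ‖x - y‖ / l := by positivity
  have e : 3 * a * l ^ (-α) * ‖x - y‖ ^ α = 3 * a * (‖x - y‖ / l) ^ α := by
    rw [div_rpow (norm_nonneg _) hl.le, rpow_neg hl.le]; ring
  rw [e]
  rcases le_total (‖x - y‖ / l) 1 with h | h
  · calc |f x - f y| ≤ 3 * (a / l) * ‖x - y‖ := SmPer.lipschitz_of_D_le h1 x y
      _ = 3 * a * (‖x - y‖ / l) := by ring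
      _ ≤ _ := by
        gcongr
        calc ‖x - y‖ / l = (‖x - y‖ / l) ^ (1 : ℝ) := (rpow_one _).symm
          _ ≤ _ := rpow_le_rpow_of_exponent_ge' hr h hα0 hα1
  · have h3 := one_le_rpow h hα0
    calc |f x - f y| ≤ |f x| + |f y| := abs_sub _ _
      _ ≤ a + a := add_le_add (h0 x) (h0 y)
      _ ≤ 3 * a * 1 := by linarith
      _ ≤ _ := by gcongr

lemma SmPer.sup_le_of_hol {f : SmPer} {α B : ℝ} (hα : 0 ≤ α) (hB : 0 ≤ B) (h : Hol α B f) {x₀ : V3}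
    (h0 : f x₀ = 0) (x : V3) : |f x| ≤ B := by
  obtain ⟨k, hk⟩ := exists_floor_shift (x - x₀)
  have h1 := h (x + fun i => (k i : ℝ)) x₀
  rw [h0, sub_zero, f.per x k] at h1
  refine h1.trans (mul_le_of_le_one_right hB (rpow_le_one (norm_nonneg _) ?_ hα))
  rw [show (x + fun i => (k i : ℝ)) - x₀ = x - x₀ + fun i => (k i : ℝ) by abel]
  refine (pi_norm_le_iff_of_nonneg zero_le_one).2 fun i => ?_
  rw [Real.norm_eq_abs, abs_le]
  exact ⟨by linarith [hk.1 i, show (0 : V3) i = 0 from rfl], hk.2 i⟩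

lemma SmPer.exists_D_eq_zero (f : SmPer) : ∃ x, ∀ i, SmPer.D i f x = 0 := by
  obtain ⟨x, -, hx⟩ := (isCompact_Icc : IsCompact (Icc (0 : V3) 1)).exists_isMaxOn
    ⟨0, by simp⟩ f.cont.continuousOn
  have hmax : IsLocalMax (f : V3 → ℝ) x := Filter.Eventually.of_forall fun y => by
    obtain ⟨k, hk⟩ := exists_floor_shift y
    rw [← f.per y k]
    exact hx hk
  refine ⟨x, fun i => ?_⟩
  rw [SmPer.D_apply, pd, hmax.fderiv_eq_zero]
  rfl

lemma HB.of_hol_D {l α B : ℝ} {f : SmPer} {i : Fin 3} (hα : 0 ≤ α) (hB : 0 ≤ B)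
    (h : Hol α B (SmPer.D i f)) : HB l α 0 B (SmPer.D i f) := by
  obtain ⟨x, hx⟩ := f.exists_D_eq_zero
  exact ⟨SmPer.sup_le_of_hol hα hB h (hx i), h⟩

/-- The Laplacian on smooth periodic functions. -/
def SmPer.lap (f : SmPer) : SmPer := ∑ i, SmPer.D i (SmPer.D i f)

lemma SmPer.lap_D (f : SmPer) (i : Fin 3) : SmPer.lap (SmPer.D i f) = SmPer.D i (SmPer.lap f) := by
  simp only [lap, map_sum]
  refine Finset.sum_congr rfl fun j _ => ?_
  rw [SmPer.D_comm j i f, SmPer.D_comm j i]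

/-- The double divergence `∑ ∂ᵢ∂ⱼ Fᵢⱼ`. -/
def SmPer.ddiv (F : Fin 3 → Fin 3 → SmPer) : SmPer := ∑ i, ∑ j, SmPer.D i (SmPer.D j (F i j))

lemma SmPer.ddiv_D (F : Fin 3 → Fin 3 → SmPer) (k : Fin 3) :
    SmPer.ddiv (fun i j => SmPer.D k (F i j)) = SmPer.D k (SmPer.ddiv F) := by
  simp only [ddiv, map_sum]
  refine Finset.sum_congr rfl fun i _ => Finset.sum_congr rfl fun j _ => ?_
  rw [SmPer.D_comm j k, SmPer.D_comm i k]

lemma SmPer.ddiv_smul (F : Fin 3 → Fin 3 → SmPer) (c : ℝ) :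
    SmPer.ddiv (fun i j => c • F i j) = c • SmPer.ddiv F := by
  simp only [ddiv, Derivation.map_smul, Finset.smul_sum]

lemma SmPer.lap_smul (f : SmPer) (c : ℝ) : SmPer.lap (c • f) = c • SmPer.lap f := by
  simp only [lap, Derivation.map_smul, Finset.smul_sum]

/-- The Schauder estimate `[u]_α ≤ C [F]_α` for solutions of `Δ u = ∑ ∂ᵢ∂ⱼ Fᵢⱼ`. -/
def SchauderConst (α C : ℝ) : Prop := ∀ (u : SmPer) (F : Fin 3 → Fin 3 → SmPer) (B : ℝ),
  SmPer.lap u = SmPer.ddiv F → (∀ i j, Hol α B (F i j)) → Hol α (C * B) u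

lemma SchauderConst.hb {l α C B : ℝ} {m : ℕ} (hC : SchauderConst α C) (hC0 : 0 ≤ C) (hα : 0 ≤ α)
    {u : SmPer} {F : Fin 3 → Fin 3 → SmPer} (hu : ∃ x, u x = 0)
    (h : SmPer.lap u = SmPer.ddiv F) (hF : ∀ i j, HB l α m B (F i j)) : HB l α m (C * B) u := by
  have hB : 0 ≤ B := (hF 0 0).nonneg
  have h0 : HB l α 0 (C * B) u := by
    obtain ⟨x, hx⟩ := hu
    have := hC u F B h fun i j => (hF i j).hol
    exact ⟨SmPer.sup_le_of_hol hα (by positivity) this hx, this⟩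
  induction m generalizing u F with
  | zero => exact h0
  | succ m ih =>
    have key : ∀ k, HB l α 0 (C * B) (l • SmPer.D k u) ∧ SmPer.lap (l • SmPer.D k u) =
        SmPer.ddiv (fun i j => l • SmPer.D k (F i j)) ∧ ∃ x, (l • SmPer.D k u) x = 0 := by
      intro k
      have e : SmPer.lap (l • SmPer.D k u) = SmPer.ddiv (fun i j => l • SmPer.D k (F i j)) := by
        rw [SmPer.lap_smul, SmPer.lap_D, h, SmPer.ddiv_smul, SmPer.ddiv_D]
      have hz : ∃ x, (l • SmPer.D k u) x = 0 := by
        obtain ⟨x, hx⟩ := u.exists_D_eq_zero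
        exact ⟨x, by rw [SmPer.smul_apply, hx k, mul_zero]⟩
      obtain ⟨x, hx⟩ := hz
      have := hC _ _ B e fun i j => ((hF i j).2 k).hol
      exact ⟨⟨SmPer.sup_le_of_hol hα (by positivity) this hx, this⟩, e, x, hx⟩
    exact ⟨h0, fun k => ih (key k).2.2 (key k).2.1 (fun i j => (hF i j).2 k) (key k).1⟩

/-- A smooth test function supported in the closed unit ball. -/
def IsTest (φ : V3 → ℝ) : Prop := ContDiff ℝ (⊤ : ℕ∞) φ ∧ ∀ z, 1 < ‖z‖ → φ z = 0

namespace IsTest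

variable {φ : V3 → ℝ}

lemma cont (h : IsTest φ) : Continuous φ := h.1.continuous

lemma diff (h : IsTest φ) : Differentiable ℝ φ := h.1.differentiable (by simp)

lemma compact (h : IsTest φ) : HasCompactSupport φ :=
  HasCompactSupport.intro (isCompact_closedBall (0 : V3) 1) fun z hz => h.2 z (by simpa using hz)

lemma integrable (h : IsTest φ) : Integrable φ := h.cont.integrable_of_hasCompactSupport h.compact

lemma integrable_mul (h : IsTest φ) {f : V3 → ℝ} (hf : Continuous f) :
    Integrable fun z => φ z * f z :=
  (h.cont.mul hf).integrable_of_hasCompactSupport h.compact.mul_right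

lemma pd (h : IsTest φ) (i : Fin 3) : IsTest (pd φ i) := by
  refine ⟨contDiff_pd h.1 i, fun z hz => ?_⟩
  have : φ =ᶠ[nhds z] fun _ => 0 := by
    filter_upwards [(isOpen_lt continuous_const continuous_norm).mem_nhds hz] with y hy
    exact h.2 y hy
  rw [_root_.pd, this.fderiv_eq]
  simp

end IsTest

/-- The average of `f` against the kernel `φ` at scale `s` around `x`. -/
def avg (φ : V3 → ℝ) (f : V3 → ℝ) (s : ℝ) (x : V3) : ℝ := ∫ z, φ z * f (x + s • z)

lemma hasDerivAt_avg_line {φ : V3 → ℝ} (hφ : Continuous φ) (hc : HasCompactSupport φ) (f : SmPer)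
    (c e : V3) (s r σ : ℝ) :
    HasDerivAt (fun σ => ∫ z, φ z * f (c + s • z + σ • (e + r • z)))
      (∫ z, φ z * ∑ i, (e + r • z) i * SmPer.D i f (c + s • z + σ • (e + r • z))) σ := by
  obtain ⟨M, hM0, hM⟩ : ∃ M, 0 ≤ M ∧ ∀ i x, |SmPer.D i f x| ≤ M := by
    choose M h0 h using fun i => (SmPer.D i f).bounded
    exact ⟨∑ i, M i, Finset.sum_nonneg fun i _ => h0 i, fun i x =>
      (h i x).trans (Finset.single_le_sum (fun i _ => h0 i) (Finset.mem_univ i))⟩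
  have hcont : ∀ {g : V3 → ℝ} (_ : Continuous g) (σ : ℝ),
      Continuous fun z => φ z * g (c + s • z + σ • (e + r • z)) := fun hg σ =>
    hφ.mul (hg.comp (by fun_prop))
  have hcont' : ∀ σ : ℝ, Continuous fun z : V3 =>
      φ z * ∑ i, (e + r • z) i * SmPer.D i f (c + s • z + σ • (e + r • z)) := fun σ =>
    hφ.mul (continuous_finsetSum _ fun i _ =>
      (show Continuous fun z : V3 => (e + r • z) i by fun_prop).mul
        ((SmPer.D i f).cont.comp (show Continuous fun z : V3 =>
          c + s • z + σ • (e + r • z) by fun_prop)))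
  refine (hasDerivAt_integral_of_dominated_loc_of_deriv_le (s := Set.univ)
    (F' := fun σ z => φ z * ∑ i, (e + r • z) i * SmPer.D i f (c + s • z + σ • (e + r • z)))
    (bound := fun z => |φ z| * (3 * (‖e + r • z‖ * M))) Filter.univ_mem
    (Filter.Eventually.of_forall fun σ => (hcont f.cont σ).aestronglyMeasurable)
    ((hcont f.cont σ).integrable_of_hasCompactSupport hc.mul_right)
    (hcont' σ).aestronglyMeasurable ?_ ?_ ?_).2
  · refine Filter.Eventually.of_forall fun z σ _ => ?_
    rw [norm_mul, Real.norm_eq_abs]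
    gcongr
    calc ‖∑ i, (e + r • z) i * SmPer.D i f (c + s • z + σ • (e + r • z))‖
        ≤ ∑ i : Fin 3, ‖e + r • z‖ * M := norm_sum_le_of_le _ fun i _ => by
          rw [norm_mul]
          exact mul_le_mul (norm_le_pi_norm _ i) (hM i _) (norm_nonneg _) (norm_nonneg _)
      _ = _ := by simp
  · refine Continuous.integrable_of_hasCompactSupport (by fun_prop) ?_
    exact (hc.norm).mul_right
  · refine Filter.Eventually.of_forall fun z σ _ => HasDerivAt.const_mul _ ?_
    rw [← SmPer.fderiv_apply]
    have h1 : HasDerivAt (fun σ : ℝ => c + s • z + σ • (e + r • z)) (e + r • z) σ := by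
      simpa using ((hasDerivAt_id σ).smul_const (e + r • z)).const_add (c + s • z)
    exact (f.diff _).hasFDerivAt.comp_hasDerivAt σ h1

lemma avg_pd {φ : V3 → ℝ} (hφ : IsTest φ) (f : SmPer) (i : Fin 3) (s : ℝ) (x : V3) :
    avg (pd φ i) f s x = -(s * avg φ (SmPer.D i f) s x) := by
  have hd : ∀ z : V3, HasFDerivAt (fun z => f (x + s • z))
      ((fderiv ℝ (f : V3 → ℝ) (x + s • z)).comp (s • ContinuousLinearMap.id ℝ V3)) z := fun z =>
    (f.diff _).hasFDerivAt.comp z (((hasFDerivAt_id z).const_smul s).const_add x)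
  have hfd : ∀ z : V3, fderiv ℝ (fun z => f (x + s • z)) z (Pi.single i 1) =
      s * SmPer.D i f (x + s • z) := fun z => by
    rw [(hd z).fderiv]
    simp [SmPer.D_apply, pd]
  have hc1 : Continuous fun z : V3 => f (x + s • z) := f.cont.comp (by fun_prop)
  have hc2 : Continuous fun z : V3 => s * SmPer.D i f (x + s • z) :=
    continuous_const.mul ((SmPer.D i f).cont.comp (by fun_prop))
  have := integral_mul_fderiv_eq_neg_fderiv_mul_of_integrable (μ := (volume : Measure V3))
    (f := φ) (g := fun z => f (x + s • z)) (v := Pi.single i 1)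
    ((hφ.pd i).integrable_mul hc1) (by simp only [hfd]; exact hφ.integrable_mul hc2)
    (hφ.integrable_mul hc1) (fun z _ => hφ.diff z) (fun z _ => (hd z).differentiableAt)
  simp only [hfd] at this
  unfold avg
  rw [← integral_const_mul, ← integral_neg]
  have h2 : ∫ z, pd φ i z * f (x + s • z) = ∫ z, fderiv ℝ φ z (Pi.single i 1) * f (x + s • z) := rfl
  rw [h2, ← neg_eq_iff_eq_neg.2 this, ← integral_neg]
  congr 1; funext z; ring

lemma integral_pd {φ : V3 → ℝ} (hφ : IsTest φ) (i : Fin 3) : ∫ z, pd φ i z = 0 := by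
  have := avg_pd hφ 1 i 0 0
  simpa [avg] using this

lemma avg_le {φ : V3 → ℝ} (hφ : IsTest φ) {f : V3 → ℝ} {M : ℝ} (h : ∀ x, |f x| ≤ M) (s : ℝ)
    (x : V3) : |avg φ f s x| ≤ (∫ z, |φ z|) * M := by
  rw [avg, ← integral_mul_const]
  refine norm_integral_le_of_norm_le (f := fun z => φ z * f (x + s • z))
    (hφ.integrable.abs.mul_const M) (Filter.Eventually.of_forall fun z => ?_)
  rw [norm_mul, Real.norm_eq_abs, Real.norm_eq_abs]
  gcongr
  exact h _

lemma avg_pd_le_of_hol {φ : V3 → ℝ} (hφ : IsTest φ) {f : SmPer} {α B : ℝ} (hα : 0 ≤ α)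
    (hB : 0 ≤ B) (h : Hol α B f) (i : Fin 3) {s : ℝ} (hs : 0 ≤ s) (x : V3) :
    |avg (pd φ i) f s x| ≤ (∫ z, |pd φ i z|) * (B * s ^ α) := by
  have hc1 : Continuous fun z : V3 => f (x + s • z) := f.cont.comp (by fun_prop)
  have e : avg (pd φ i) f s x = ∫ z, pd φ i z * (f (x + s • z) - f x) := by
    simp only [mul_sub]
    rw [integral_sub ((hφ.pd i).integrable_mul hc1) ((hφ.pd i).integrable.mul_const _),
      integral_mul_const, integral_pd hφ, zero_mul, sub_zero, avg]
  rw [e, ← integral_mul_const]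
  refine norm_integral_le_of_norm_le (f := fun z => pd φ i z * (f (x + s • z) - f x))
    ((hφ.pd i).integrable.abs.mul_const _) (Filter.Eventually.of_forall fun z => ?_)
  rw [norm_mul, Real.norm_eq_abs, Real.norm_eq_abs]
  rcases lt_or_ge 1 ‖z‖ with hz | hz
  · rw [(hφ.pd i).2 z hz]; simp
  · gcongr
    refine (h _ _).trans ?_
    gcongr
    rw [add_sub_cancel_left, norm_smul, Real.norm_of_nonneg hs]
    exact mul_le_of_le_one_right hs hz

lemma avg_zero (φ : V3 → ℝ) (f : V3 → ℝ) (x : V3) : avg φ f 0 x = (∫ z, φ z) * f x := by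
  simp [avg, integral_mul_const]

lemma exists_kernel : ∃ φ ρ : V3 → ℝ, IsTest φ ∧ IsTest ρ ∧ (∀ i z, ρ z * z i = -pd φ i z) ∧
    0 < ∫ z, ρ z := by
  have hg : ContDiff ℝ (⊤ : ℕ∞) expNegInvGlue := expNegInvGlue.contDiff
  have hg' : ContDiff ℝ (⊤ : ℕ∞) (deriv expNegInvGlue) :=
    (contDiff_infty_iff_deriv.1 hg).2
  have hgd : Differentiable ℝ expNegInvGlue := hg.differentiable (by simp)
  let Q : V3 → ℝ := fun z => 1 - ∑ i, z i ^ 2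
  have hQ : ContDiff ℝ (⊤ : ℕ∞) Q := by fun_prop
  have hQneg : ∀ z : V3, 1 < ‖z‖ → Q z < 0 := by
    intro z hz
    have : ∃ i, 1 < |z i| := by
      by_contra! h
      exact absurd ((pi_norm_le_iff_of_nonneg zero_le_one).2 h) (not_le.2 hz)
    obtain ⟨i, hi⟩ := this
    have h1 : 1 < z i ^ 2 := by rw [← sq_abs]; nlinarith
    have h2 := Finset.single_le_sum (f := fun i => z i ^ 2) (fun i _ => sq_nonneg (z i))
      (Finset.mem_univ i)
    simp only [Q]
    linarith
  have hdneg : ∀ r : ℝ, r < 0 → deriv expNegInvGlue r = 0 := by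
    intro r hr
    have : expNegInvGlue =ᶠ[nhds r] fun _ => 0 := by
      filter_upwards [Iio_mem_nhds hr] with y hy
      exact expNegInvGlue.zero_of_nonpos (le_of_lt hy)
    rw [this.deriv_eq]; simp
  refine ⟨fun z => expNegInvGlue (Q z), fun z => 2 * deriv expNegInvGlue (Q z), ?_, ?_, ?_, ?_⟩
  · exact ⟨hg.comp hQ, fun z hz => expNegInvGlue.zero_of_nonpos (hQneg z hz).le⟩
  · exact ⟨contDiff_const.mul (hg'.comp hQ), fun z hz => by simp [hdneg _ (hQneg z hz)]⟩
  · intro i z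
    have hQd : HasFDerivAt Q (-(∑ j, (2 * z j) • ContinuousLinearMap.proj (R := ℝ)
        (φ := fun _ : Fin 3 => ℝ) j)) z := by
      refine HasFDerivAt.const_sub ?_ 1
      refine HasFDerivAt.fun_sum fun j _ => ?_
      have := (hasFDerivAt_apply (𝕜 := ℝ) (F' := fun _ : Fin 3 => ℝ) j z).pow 2
      simpa using this
    have := (hgd (Q z)).hasDerivAt.comp_hasFDerivAt z hQd
    rw [pd_eq_hasFDerivAt (g := fun z => expNegInvGlue (Q z)) this i]
    simp [Pi.single_apply]
    ring
  · obtain ⟨c, hc, hc'⟩ := exists_deriv_eq_slope expNegInvGlue zero_lt_one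
      hgd.continuous.continuousOn hgd.differentiableOn
    have h1 : deriv expNegInvGlue c ≠ 0 := by
      rw [hc', expNegInvGlue.zero]
      simp
    refine Continuous.integral_pos_of_hasCompactSupport_nonneg_nonzero
      (x := Pi.single 0 (Real.sqrt (1 - c))) ?_ ?_ ?_ ?_
    · exact continuous_const.mul (hg'.continuous.comp hQ.continuous)
    · exact HasCompactSupport.intro (isCompact_closedBall (0 : V3) 1) fun z hz => by
        rw [hdneg _ (hQneg z (by simpa using hz)), mul_zero]
    · intro z
      exact mul_nonneg zero_le_two (expNegInvGlue.monotone.deriv_nonneg)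
    · have : Q (Pi.single 0 (Real.sqrt (1 - c))) = c := by
        simp only [Q, Fin.sum_univ_three]
        simp [Real.sq_sqrt (by linarith [hc.2] : (0 : ℝ) ≤ 1 - c)]
      rw [this]
      exact mul_ne_zero two_ne_zero h1

lemma abs_sub_le_of_abs_deriv_le {f f' g g' : ℝ → ℝ} {a b : ℝ} (hab : a ≤ b)
    (hf : ContinuousOn f (Icc a b)) (hg : ContinuousOn g (Icc a b))
    (hf' : ∀ s ∈ Ioo a b, HasDerivAt f (f' s) s) (hg' : ∀ s ∈ Ioo a b, HasDerivAt g (g' s) s)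
    (h : ∀ s ∈ Ioo a b, |f' s| ≤ g' s) : |f b - f a| ≤ g b - g a := by
  have key : ∀ (F F' : ℝ → ℝ), ContinuousOn F (Icc a b) → (∀ s ∈ Ioo a b, HasDerivAt F (F' s) s) →
      (∀ s ∈ Ioo a b, F' s ≤ 0) → F b ≤ F a := by
    intro F F' hF hF' hn
    refine antitoneOn_of_deriv_nonpos (convex_Icc a b) hF ?_ ?_ (left_mem_Icc.2 hab)
      (right_mem_Icc.2 hab) hab
    · rw [interior_Icc]
      exact fun s hs => (hF' s hs).differentiableAt.differentiableWithinAt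
    · rw [interior_Icc]
      exact fun s hs => by rw [(hF' s hs).deriv]; exact hn s hs
  have h1 := key (fun s => f s - g s) _ (hf.sub hg) (fun s hs => (hf' s hs).sub (hg' s hs))
    fun s hs => by linarith [(abs_le.1 (h s hs)).2]
  have h2 := key (fun s => -f s - g s) _ (hf.neg.sub hg)
    (fun s hs => (hf' s hs).neg.sub (hg' s hs)) fun s hs => by linarith [(abs_le.1 (h s hs)).1]
  rw [abs_le]
  constructor <;> linarith

lemma avg_sum {φ : V3 → ℝ} (hφ : IsTest φ) (f : Fin 3 → SmPer) (s : ℝ) (x : V3) :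
    avg φ (∑ i, f i : SmPer) s x = ∑ i, avg φ (f i) s x := by
  unfold avg
  rw [← integral_finsetSum]
  · congr 1; funext z
    rw [SmPer.sum_apply, Finset.mul_sum]
  · exact fun i _ => hφ.integrable_mul ((f i).cont.comp (by fun_prop))

lemma hasDerivAt_avg {φ ρ : V3 → ℝ} (hφ : IsTest φ) (hρ : IsTest ρ)
    (h : ∀ i z, ρ z * z i = -pd φ i z) {u : SmPer} {F : Fin 3 → Fin 3 → SmPer}
    (hu : SmPer.lap u = SmPer.ddiv F) (s : ℝ) (x : V3) :
    HasDerivAt (fun s => avg ρ u s x)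
      (s * ∑ i, ∑ j, avg φ (SmPer.D i (SmPer.D j (F i j))) s x) s := by
  have h1 := hasDerivAt_avg_line hρ.cont hρ.compact u x 0 0 1 s
  simp only [zero_smul, add_zero, zero_add, one_smul] at h1
  refine h1.congr_deriv (Eq.symm ?_)
  have e1 : ∀ z, ρ z * ∑ i, z i * SmPer.D i u (x + s • z) =
      ∑ i, -(pd φ i z * SmPer.D i u (x + s • z)) := fun z => by
    rw [Finset.mul_sum]
    exact Finset.sum_congr rfl fun i _ => by rw [← mul_assoc, h]; ring
  simp only [e1]
  have hint : ∀ i, Integrable fun z => -(pd φ i z * SmPer.D i u (x + s • z)) := fun i =>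
    ((hφ.pd i).integrable_mul ((SmPer.D i u).cont.comp (by fun_prop))).neg
  rw [integral_finsetSum _ fun i _ => hint i]
  have e2 : ∀ i, ∫ z, -(pd φ i z * SmPer.D i u (x + s • z)) =
      s * avg φ (SmPer.D i (SmPer.D i u)) s x := fun i => by
    rw [integral_neg, ← neg_eq_iff_eq_neg.2 (avg_pd hφ (SmPer.D i u) i s x)]
    rfl
  simp only [e2]
  rw [← Finset.mul_sum, ← avg_sum hφ]
  change _ = s * avg φ (SmPer.lap u) s x
  rw [hu, SmPer.ddiv, avg_sum hφ]
  exact congrArg _ (Finset.sum_congr rfl fun i _ => (avg_sum hφ _ s x).symm)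

theorem exists_schauderConst {α : ℝ} (hα0 : 0 < α) (hα1 : α < 1) :
    ∃ C, 0 ≤ C ∧ SchauderConst α C := by
  obtain ⟨φ, ρ, hφ, hρ, hφρ, hc⟩ := exists_kernel
  set c₀ := ∫ z, ρ z with hc₀
  let K2 : ℝ := ∑ i, ∑ j, ∫ z, |pd (pd φ i) j z|
  let K3 : Fin 3 → ℝ := fun k => ∑ i, ∑ j, ∫ z, |pd (pd (pd φ i) j) k z|
  have hK2 : 0 ≤ K2 := Finset.sum_nonneg fun i _ => Finset.sum_nonneg fun j _ =>
    integral_nonneg fun z => abs_nonneg _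
  have hK3 : ∀ k, 0 ≤ K3 k := fun k => Finset.sum_nonneg fun i _ => Finset.sum_nonneg fun j _ =>
    integral_nonneg fun z => abs_nonneg _
  have h1α : 0 < 1 - α := by linarith
  refine ⟨(2 * K2 / α + (∑ k, K3 k) / (1 - α)) / c₀, by positivity, ?_⟩
  intro u F B hu hF x y
  rcases eq_or_ne x y with rfl | hxy
  · simp [hα0.ne']
  have hd : 0 < ‖x - y‖ := norm_pos_iff.2 (sub_ne_zero.2 hxy)
  have hB : 0 ≤ B := by
    have := (abs_nonneg _).trans (hF 0 0 x y)
    exact nonneg_of_mul_nonneg_left this (by positivity)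
  have step1 : ∀ s, 0 < s → ∀ x, |avg ρ u s x - c₀ * u x| ≤ K2 * B / α * s ^ α := by
    intro s hs x
    have hder := fun s => hasDerivAt_avg hφ hρ hφρ hu s x
    have := abs_sub_le_of_abs_deriv_le (f := fun s => avg ρ u s x)
      (g := fun s => K2 * B / α * s ^ α) (g' := fun s => K2 * B / α * (α * s ^ (α - 1))) hs.le
      (fun s _ => (hder s).continuousAt.continuousWithinAt)
      ((continuous_const.mul (continuous_id.rpow_const fun _ => Or.inr hα0.le)).continuousOn)
      (fun s _ => hder s)
      (fun s hs => (Real.hasDerivAt_rpow_const (Or.inl hs.1.ne')).const_mul _) ?_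
    · simp only [avg_zero, zero_rpow hα0.ne', mul_zero, sub_zero] at this
      exact this
    · intro s hs
      have hs0 : 0 < s := hs.1
      have e : K2 * B / α * (α * s ^ (α - 1)) =
          ∑ i, ∑ j, (∫ z, |pd (pd φ i) j z|) * (B * s ^ α) / s := by
        rw [rpow_sub_one hs0.ne']
        simp only [← Finset.sum_div, ← Finset.sum_mul]
        field_simp
        simp only [K2]
        ring
      rw [e, Finset.mul_sum]
      refine (Finset.abs_sum_le_sum_abs _ _).trans (Finset.sum_le_sum fun i _ => ?_)
      rw [Finset.mul_sum]
      refine (Finset.abs_sum_le_sum_abs _ _).trans (Finset.sum_le_sum fun j _ => ?_)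
      have e1 := avg_pd hφ (SmPer.D j (F i j)) i s x
      have e2 := avg_pd (hφ.pd i) (F i j) j s x
      have e3 : s * avg φ (SmPer.D i (SmPer.D j (F i j))) s x =
          avg (pd (pd φ i) j) (F i j) s x / s := by
        rw [e2, ← neg_eq_iff_eq_neg.2 e1]; field_simp
      rw [e3, abs_div, abs_of_pos hs0]
      gcongr
      exact avg_pd_le_of_hol (hφ.pd i) hα0.le hB (hF i j) j hs0.le x
  have step2 : ∀ s, 0 < s → ∀ k x,
      |avg ρ (SmPer.D k u) s x| ≤ K3 k * B / (1 - α) * s ^ (α - 1) := by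
    intro s hs k x
    have huk : SmPer.lap (SmPer.D k u) = SmPer.ddiv fun i j => SmPer.D k (F i j) := by
      rw [SmPer.lap_D, hu, SmPer.ddiv_D]
    have hder := fun s => hasDerivAt_avg hφ hρ hφρ huk s x
    obtain ⟨M, hM0, hM⟩ := u.bounded
    have hlarge : ∀ S, s ≤ S →
        |avg ρ (SmPer.D k u) S x| ≤ (∫ z, |pd ρ k z|) * M / S := by
      intro S hS
      have hS0 : 0 < S := hs.trans_le hS
      have e1 := avg_pd hρ u k S x
      have e2 : avg ρ (SmPer.D k u) S x = -(avg (pd ρ k) u S x / S) := by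
        rw [e1]; field_simp
      rw [e2, abs_neg, abs_div, abs_of_pos hS0]
      gcongr
      exact avg_le (hρ.pd k) hM S x
    have hdiff : ∀ S, s ≤ S → |avg ρ (SmPer.D k u) S x - avg ρ (SmPer.D k u) s x| ≤
        K3 k * B / (1 - α) * s ^ (α - 1) := by
      intro S hS
      have := abs_sub_le_of_abs_deriv_le (f := fun s => avg ρ (SmPer.D k u) s x)
        (g := fun s => -(K3 k * B / (1 - α)) * s ^ (α - 1))
        (g' := fun s => -(K3 k * B / (1 - α)) * ((α - 1) * s ^ (α - 1 - 1))) hS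
        (fun s _ => (hder s).continuousAt.continuousWithinAt)
        (fun σ hσ => ((Real.hasDerivAt_rpow_const
          (Or.inl (hs.trans_le hσ.1).ne')).const_mul _).continuousAt.continuousWithinAt)
        (fun s _ => hder s)
        (fun σ hσ => (Real.hasDerivAt_rpow_const (Or.inl (hs.trans hσ.1).ne')).const_mul _) ?_
      · refine this.trans ?_
        have hS0 : 0 < S := hs.trans_le hS
        have : 0 ≤ K3 k * B / (1 - α) * S ^ (α - 1) :=
          mul_nonneg (div_nonneg (mul_nonneg (hK3 k) hB) h1α.le) (by positivity)
        linarith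
      · intro σ hσ
        have hs0 : 0 < σ := hs.trans hσ.1
        have e : -(K3 k * B / (1 - α)) * ((α - 1) * σ ^ (α - 1 - 1)) =
            ∑ i, ∑ j, (∫ z, |pd (pd (pd φ i) j) k z|) * (B * σ ^ α) / σ ^ 2 := by
          rw [rpow_sub_one hs0.ne', rpow_sub_one hs0.ne']
          simp only [← Finset.sum_div, ← Finset.sum_mul]
          simp only [K3]
          field_simp
          ring
        rw [e, Finset.mul_sum]
        refine (Finset.abs_sum_le_sum_abs _ _).trans (Finset.sum_le_sum fun i _ => ?_)
        rw [Finset.mul_sum]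
        refine (Finset.abs_sum_le_sum_abs _ _).trans (Finset.sum_le_sum fun j _ => ?_)
        have e1 := avg_pd hφ (SmPer.D j (SmPer.D k (F i j))) i σ x
        have e2 := avg_pd (hφ.pd i) (SmPer.D k (F i j)) j σ x
        have e3 := avg_pd ((hφ.pd i).pd j) (F i j) k σ x
        have e4 : σ * avg φ (SmPer.D i (SmPer.D j (SmPer.D k (F i j)))) σ x =
            -(avg (pd (pd (pd φ i) j) k) (F i j) σ x / σ ^ 2) := by
          rw [e3, e2, e1]; field_simp
        rw [e4, abs_neg, abs_div, abs_of_pos (pow_pos hs0 2)]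
        gcongr
        exact avg_pd_le_of_hol ((hφ.pd i).pd j) hα0.le hB (hF i j) k hs0.le x
    refine le_of_forall_pos_le_add fun ε hε => ?_
    set N := (∫ z, |pd ρ k z|) * M
    have h1 := hdiff (max s (N / ε)) (le_max_left _ _)
    have h2 := hlarge (max s (N / ε)) (le_max_left _ _)
    have h3 : N / max s (N / ε) ≤ ε := by
      rw [div_le_iff₀ (hs.trans_le (le_max_left _ _)), mul_comm, ← div_le_iff₀ hε]
      exact le_max_right _ _
    have h4 := abs_sub_abs_le_abs_sub (avg ρ (SmPer.D k u) s x)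
      (avg ρ (SmPer.D k u) (max s (N / ε)) x)
    rw [abs_sub_comm] at h4
    linarith
  have step3 : ∀ s, 0 < s → |avg ρ u s x - avg ρ u s y| ≤
      ((∑ k, K3 k) * B / (1 - α) * s ^ (α - 1)) * ‖x - y‖ := by
    intro s hs
    have hder := fun σ => hasDerivAt_avg_line hρ.cont hρ.compact u y (x - y) s 0 σ
    have := norm_image_sub_le_of_norm_deriv_le_segment_01'
      (C := ((∑ k, K3 k) * B / (1 - α) * s ^ (α - 1)) * ‖x - y‖)
      (fun σ _ => (hder σ).hasDerivWithinAt) ?_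
    · simp only [zero_smul, add_zero, one_smul] at this
      refine le_trans (le_of_eq ?_) this
      rw [Real.norm_eq_abs, avg, avg]
      have : ∀ z : V3, y + s • z + (x - y) = x + s • z := fun z => by abel
      simp only [this]
    · intro σ _
      have e : ∫ z, ρ z * ∑ i, (x - y + (0 : ℝ) • z) i *
            SmPer.D i u (y + s • z + σ • (x - y + (0 : ℝ) • z)) =
          ∑ i, (x - y) i * avg ρ (SmPer.D i u) s (y + σ • (x - y)) := by
        simp only [avg, ← integral_const_mul]
        rw [← integral_finsetSum]
        · congr 1; funext z
          rw [Finset.mul_sum]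
          refine Finset.sum_congr rfl fun i _ => ?_
          rw [zero_smul, add_zero, add_right_comm]
          ring
        · exact fun i _ => (hρ.integrable_mul ((SmPer.D i u).cont.comp
            (by fun_prop))).const_mul _
      rw [e]
      refine (norm_sum_le_of_le (f := fun i => (x - y) i * avg ρ (SmPer.D i u) s (y + σ • (x - y)))
        _ (n := fun i => ‖x - y‖ * (K3 i * B / (1 - α) * s ^ (α - 1))) fun i _ => ?_).trans ?_
      · rw [norm_mul]
        exact mul_le_mul (norm_le_pi_norm _ i) (step2 s hs i _) (norm_nonneg _) (norm_nonneg _)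
      · rw [← Finset.mul_sum, ← Finset.sum_mul, ← Finset.sum_div, ← Finset.sum_mul, mul_comm]
  set d := ‖x - y‖
  have a1 := step1 d hd x
  have a2 := step1 d hd y
  have a3 := step3 d hd
  have e : (∑ k, K3 k) * B / (1 - α) * d ^ (α - 1) * d = (∑ k, K3 k) * B / (1 - α) * d ^ α := by
    rw [rpow_sub_one hd.ne']; field_simp
  rw [e] at a3
  have a4 : |c₀ * u x - c₀ * u y| ≤ K2 * B / α * d ^ α + K2 * B / α * d ^ α +
      (∑ k, K3 k) * B / (1 - α) * d ^ α := by
    rw [abs_le] at *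
    constructor <;> linarith [a1.1, a1.2, a2.1, a2.2, a3.1, a3.2]
  rw [← mul_sub, abs_mul, abs_of_pos hc] at a4
  have e5 : (2 * K2 / α + (∑ k, K3 k) / (1 - α)) / c₀ * B * d ^ α =
      (K2 * B / α * d ^ α + K2 * B / α * d ^ α + (∑ k, K3 k) * B / (1 - α) * d ^ α) / c₀ := by ring
  rw [e5, le_div_iff₀ hc]
  linarith

/-- The material derivative along the velocity field `v`. -/
def STPer.MD (v : Fin 3 → STPer) (X : STPer) : STPer := STPer.dt X + ∑ j, v j * STPer.dx j X

lemma STPer.sl_MD (v : Fin 3 → STPer) (X : STPer) (t : ℝ) : STPer.sl t (STPer.MD v X) =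
    STPer.sl t (STPer.dt X) + ∑ j, STPer.sl t (v j) * SmPer.D j (STPer.sl t X) := by
  simp only [STPer.MD, map_add, map_sum, map_mul, STPer.sl_dx]

lemma segment_mem_uIcc {s t σ : ℝ} (hσ : σ ∈ Icc (0 : ℝ) 1) : t + σ * (s - t) ∈ uIcc s t := by
  have := hσ.1
  have := hσ.2
  rw [mem_uIcc]
  rcases le_total s t with h | h
  · left; constructor <;> nlinarith
  · right; constructor <;> nlinarith

lemma exists_characteristic (v : Fin 3 → STPer) {s t b : ℝ} (hb : 0 ≤ b)
    (h : ∀ r ∈ uIcc s t, ∀ i j x, |SmPer.D i (STPer.sl r (v j)) x| ≤ b) (x : V3) :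
    ∃ Z : ℝ → V3, Z 0 = x ∧ ∀ σ ∈ Icc (0 : ℝ) 1, HasDerivWithinAt Z
      (fun j => (s - t) * v j (t + σ * (s - t), Z σ)) (Icc 0 1) σ := by
  obtain ⟨M, hM0, hM⟩ : ∃ M, 0 ≤ M ∧ ∀ j, ∀ r ∈ uIcc s t, ∀ x, |v j (r, x)| ≤ M := by
    choose M h0 h using fun j => (v j).bounded (s ⊓ t) (s ⊔ t)
    exact ⟨∑ i, M i, Finset.sum_nonneg fun i _ => h0 i, fun i r hr x =>
      (h i r hr x).trans (Finset.single_le_sum (fun i _ => h0 i) (Finset.mem_univ i))⟩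
  let V : ℝ → V3 → V3 := fun σ z j => (s - t) * v j (t + σ * (s - t), z)
  have hPL : IsPicardLindelof V (tmin := 0) (tmax := 1) ⟨0, by simp⟩ x
      (NNReal.mk (|s - t| * M) (by positivity)) 0 (NNReal.mk (|s - t| * M) (by positivity))
      (NNReal.mk (|s - t| * (3 * b)) (by positivity)) := by
    refine ⟨fun σ hσ => ?_, fun z _ => ?_, fun σ hσ z _ => ?_, ?_⟩
    · refine LipschitzOnWith.of_dist_le_mul fun y _ z _ => ?_
      rw [dist_eq_norm, dist_eq_norm, NNReal.coe_mk]
      refine (pi_norm_le_iff_of_nonneg (by positivity)).2 fun j => ?_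
      have := SmPer.lipschitz_of_D_le (fun i x => h _ (segment_mem_uIcc hσ) i j x) y z
      simp only [V, Pi.sub_apply, ← mul_sub, norm_mul, Real.norm_eq_abs]
      rw [mul_assoc]
      exact mul_le_mul_of_nonneg_left this (abs_nonneg _)
    · refine Continuous.continuousOn (continuous_pi fun j => ?_)
      exact continuous_const.mul ((v j).cont.comp (by fun_prop))
    · rw [NNReal.coe_mk]
      refine (pi_norm_le_iff_of_nonneg (by positivity)).2 fun j => ?_
      simp only [V, norm_mul, Real.norm_eq_abs]
      exact mul_le_mul_of_nonneg_left (hM j _ (segment_mem_uIcc hσ) z) (abs_nonneg _)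
    · simp
  exact hPL.exists_eq_forall_mem_Icc_hasDerivWithinAt₀

lemma characteristic_dist {v : Fin 3 → STPer} {s t b : ℝ} (hb : 0 ≤ b)
    (h : ∀ r ∈ uIcc s t, ∀ i j x, |SmPer.D i (STPer.sl r (v j)) x| ≤ b)
    (hbt : |s - t| * (3 * b) ≤ 1) {Y Z : ℝ → V3}
    (hY : ∀ σ ∈ Icc (0 : ℝ) 1, HasDerivWithinAt Y
      (fun j => (s - t) * v j (t + σ * (s - t), Y σ)) (Icc 0 1) σ)
    (hZ : ∀ σ ∈ Icc (0 : ℝ) 1, HasDerivWithinAt Z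
      (fun j => (s - t) * v j (t + σ * (s - t), Z σ)) (Icc 0 1) σ) {σ : ℝ}
    (hσ : σ ∈ Icc (0 : ℝ) 1) : ‖Y σ - Z σ‖ ≤ 3 * ‖Y 0 - Z 0‖ := by
  let V : ℝ → V3 → V3 := fun σ z j => (s - t) * v j (t + σ * (s - t), z)
  have hLip : ∀ σ ∈ Ico (0 : ℝ) 1,
      LipschitzOnWith (NNReal.mk (|s - t| * (3 * b)) (by positivity)) (V σ) Set.univ := fun σ hσ => by
    refine LipschitzOnWith.of_dist_le_mul fun y _ z _ => ?_
    rw [dist_eq_norm, dist_eq_norm, NNReal.coe_mk]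
    refine (pi_norm_le_iff_of_nonneg (by positivity)).2 fun j => ?_
    have := SmPer.lipschitz_of_D_le
      (fun i x => h _ (segment_mem_uIcc (Ico_subset_Icc_self hσ)) i j x) y z
    simp only [V, Pi.sub_apply, ← mul_sub, norm_mul, Real.norm_eq_abs]
    rw [mul_assoc]
    exact mul_le_mul_of_nonneg_left this (abs_nonneg _)
  have hder : ∀ {Y : ℝ → V3}, (∀ σ ∈ Icc (0 : ℝ) 1, HasDerivWithinAt Y
      (fun j => (s - t) * v j (t + σ * (s - t), Y σ)) (Icc 0 1) σ) → ∀ σ ∈ Ico (0 : ℝ) 1,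
      HasDerivWithinAt Y (V σ (Y σ)) (Ici σ) σ := fun hY σ hσ =>
    (hY σ (Ico_subset_Icc_self hσ)).mono_of_mem_nhdsWithin (Icc_mem_nhdsGE_of_mem hσ)
  have := dist_le_of_trajectories_ODE_of_mem hLip
    (fun σ hσ => (hY σ hσ).continuousWithinAt) (hder hY) (fun _ _ => trivial)
    (fun σ hσ => (hZ σ hσ).continuousWithinAt) (hder hZ) (fun _ _ => trivial) le_rfl σ hσ
  rw [dist_eq_norm, dist_eq_norm, NNReal.coe_mk, sub_zero] at this
  refine this.trans ?_
  rw [mul_comm]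
  gcongr
  calc Real.exp (|s - t| * (3 * b) * σ) ≤ Real.exp 1 := by
        gcongr
        exact mul_le_one₀ hbt hσ.1 hσ.2
    _ ≤ 3 := by linarith [Real.exp_one_lt_d9]

lemma hasDerivWithinAt_along {v : Fin 3 → STPer} (X : STPer) {s t : ℝ} {Z : ℝ → V3} {σ : ℝ}
    (hZ : HasDerivWithinAt Z (fun j => (s - t) * v j (t + σ * (s - t), Z σ)) (Icc 0 1) σ) :
    HasDerivWithinAt (fun σ => X (t + σ * (s - t), Z σ))
      ((s - t) * STPer.MD v X (t + σ * (s - t), Z σ)) (Icc 0 1) σ := by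
  have h1 : HasDerivWithinAt (fun σ : ℝ => t + σ * (s - t)) (s - t) (Icc 0 1) σ := by
    simpa using (((hasDerivAt_id σ).mul_const (s - t)).const_add t).hasDerivWithinAt
  have h2 := (X.diff (t + σ * (s - t), Z σ)).hasFDerivAt.comp_hasDerivWithinAt σ (h1.prodMk hZ)
  refine h2.congr_deriv ?_
  rw [STPer.fderiv_apply]
  change _ = (s - t) * STPer.sl (t + σ * (s - t)) (STPer.MD v X) (Z σ)
  rw [STPer.sl_MD, SmPer.add_apply, SmPer.sum_apply, mul_add, Finset.mul_sum]
  congr 1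
  exact Finset.sum_congr rfl fun j _ => by rw [SmPer.mul_apply, ← mul_assoc]; rfl

theorem transport_hol {v : Fin 3 → STPer} {X : STPer} {s t b α B H : ℝ} (hb : 0 ≤ b)
    (h : ∀ r ∈ uIcc s t, ∀ i j x, |SmPer.D i (STPer.sl r (v j)) x| ≤ b)
    (hbt : |s - t| * (3 * b) ≤ 1) (hα0 : 0 ≤ α) (hα1 : α ≤ 1) (hB : 0 ≤ B) (hH : 0 ≤ H)
    (hX : Hol α B (STPer.sl s X)) (hM : ∀ r ∈ uIcc s t, Hol α H (STPer.sl r (STPer.MD v X))) :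
    Hol α (3 * (B + |s - t| * H)) (STPer.sl t X) := by
  intro x y
  obtain ⟨Y, hY0, hY⟩ := exists_characteristic v hb h x
  obtain ⟨Z, hZ0, hZ⟩ := exists_characteristic v hb h y
  have hd : ∀ σ ∈ Icc (0 : ℝ) 1, ‖Y σ - Z σ‖ ^ α ≤ 3 * ‖x - y‖ ^ α := by
    intro σ hσ
    have := characteristic_dist hb h hbt hY hZ hσ
    rw [hY0, hZ0] at this
    calc ‖Y σ - Z σ‖ ^ α ≤ (3 * ‖x - y‖) ^ α := by gcongr
      _ = 3 ^ α * ‖x - y‖ ^ α := mul_rpow (by norm_num) (norm_nonneg _)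
      _ ≤ 3 ^ (1 : ℝ) * ‖x - y‖ ^ α := by
        gcongr
        norm_num
      _ = _ := by rw [rpow_one]
  have := norm_image_sub_le_of_norm_deriv_le_segment_01' (C := |s - t| * (H * (3 * ‖x - y‖ ^ α)))
    (fun σ hσ => (hasDerivWithinAt_along X (hY σ hσ)).sub (hasDerivWithinAt_along X (hZ σ hσ))) ?_
  · simp only [zero_mul, add_zero, one_mul, add_sub_cancel, hY0, hZ0, Pi.sub_apply,
      Real.norm_eq_abs] at this
    have h1 := (hX (Y 1) (Z 1)).trans (mul_le_mul_of_nonneg_left (hd 1 (by simp)) hB)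
    simp only [STPer.sl_apply] at h1 ⊢
    rw [abs_le] at *
    constructor <;> linarith [h1.1, h1.2, this.1, this.2]
  · intro σ hσ
    have hσ' := Ico_subset_Icc_self hσ
    rw [← mul_sub, norm_mul, Real.norm_eq_abs, Real.norm_eq_abs]
    gcongr
    exact (hM _ (segment_mem_uIcc hσ') _ _).trans (mul_le_mul_of_nonneg_left (hd σ hσ') hH)

theorem transport_sup {v : Fin 3 → STPer} {X : STPer} {s t b B H : ℝ} (hb : 0 ≤ b)
    (h : ∀ r ∈ uIcc s t, ∀ i j x, |SmPer.D i (STPer.sl r (v j)) x| ≤ b)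
    (hX : ∀ x, |STPer.sl s X x| ≤ B) (hM : ∀ r ∈ uIcc s t, ∀ x, |STPer.sl r (STPer.MD v X) x| ≤ H)
    (x : V3) : |STPer.sl t X x| ≤ B + |s - t| * H := by
  obtain ⟨Y, hY0, hY⟩ := exists_characteristic v hb h x
  have := norm_image_sub_le_of_norm_deriv_le_segment_01' (C := |s - t| * H)
    (fun σ hσ => hasDerivWithinAt_along X (hY σ hσ)) ?_
  · simp only [zero_mul, add_zero, one_mul, add_sub_cancel, hY0, Real.norm_eq_abs] at this
    have h1 := hX (Y 1)
    simp only [STPer.sl_apply] at h1 ⊢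
    rw [abs_le] at *
    constructor <;> linarith [h1.1, h1.2, this.1, this.2]
  · intro σ hσ
    rw [norm_mul, Real.norm_eq_abs, Real.norm_eq_abs]
    gcongr
    exact hM _ (segment_mem_uIcc (Ico_subset_Icc_self hσ)) _

lemma STPer.sl_smul_dx (l t : ℝ) (i : Fin 3) (X : STPer) :
    STPer.sl t (l • STPer.dx i X) = l • SmPer.D i (STPer.sl t X) := by
  rw [map_smul, STPer.sl_dx]

lemma STPer.sl_dt_dx (t : ℝ) (i : Fin 3) (X : STPer) :
    STPer.sl t (STPer.dt (STPer.dx i X)) = SmPer.D i (STPer.sl t (STPer.dt X)) := by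
  rw [STPer.dt_dx_comm, STPer.sl_dx]

lemma STPer.dt_smul (l : ℝ) (X : STPer) : STPer.dt (l • X) = l • STPer.dt X :=
  STPer.ext' fun q => ((STPer.hasDerivAt_dt X q.1 q.2).const_mul l).deriv

lemma STPer.sl_MD_smul_dx (v : Fin 3 → STPer) (l : ℝ) (c : Fin 3) (X : STPer) (t : ℝ) :
    STPer.sl t (STPer.MD v (l • STPer.dx c X)) = l • SmPer.D c (STPer.sl t (STPer.MD v X)) -
      ∑ j, SmPer.D c (STPer.sl t (v j)) * (l • SmPer.D j (STPer.sl t X)) := by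
  simp only [STPer.sl_MD, STPer.dt_smul, map_smul, STPer.sl_dt_dx, map_add, map_sum,
    Derivation.map_smul, Derivation.leibniz, smul_add, Finset.smul_sum,
    Finset.sum_add_distrib, smul_eq_mul, STPer.sl_dx]
  simp only [mul_smul_comm, SmPer.D_comm _ c]
  rw [← add_assoc, eq_comm, sub_eq_iff_eq_add]
  congr 1
  exact Finset.sum_congr rfl fun j _ => by rw [mul_comm]

theorem transport_hb {v : Fin 3 → STPer} {l s t α A : ℝ} (hα0 : 0 ≤ α) (hα1 : α ≤ 1)
    (hA : |s - t| * (3 * A) ≤ 1) {m : ℕ}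
    (hv : ∀ r ∈ uIcc s t, ∀ i j, HB l α m A (SmPer.D i (STPer.sl r (v j)))) {X : STPer}
    {B H K : ℝ} (hB : HB l α m B (STPer.sl s X))
    (hH : ∀ r ∈ uIcc s t, HB l α m H (STPer.sl r (STPer.MD v X)))
    (hK : ∀ r ∈ uIcc s t, HB l α m K (STPer.sl r X)) :
    HB l α m (3 * (B + |s - t| * (H + m * (3 * 2 ^ (m + 1) * (A * K))))) (STPer.sl t X) := by
  have hA0 : 0 ≤ A := (hv s left_mem_uIcc 0 0).nonneg
  have h0 : ∀ {X : STPer} {B H : ℝ}, HB l α 0 B (STPer.sl s X) →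
      (∀ r ∈ uIcc s t, HB l α 0 H (STPer.sl r (STPer.MD v X))) →
      HB l α 0 (3 * (B + |s - t| * H)) (STPer.sl t X) := by
    intro X B H hB hH
    have hb : ∀ r ∈ uIcc s t, ∀ i j x, |SmPer.D i (STPer.sl r (v j)) x| ≤ A :=
      fun r hr i j x => (hv r hr i j).sup x
    have hH0 : 0 ≤ H := (hH s left_mem_uIcc).nonneg
    refine ⟨fun x => ?_, ?_⟩
    · refine (transport_sup hA0 hb hB.1 (fun r hr => (hH r hr).1) x).trans ?_
      have : 0 ≤ B + |s - t| * H := add_nonneg hB.nonneg (by positivity)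
      linarith
    · exact transport_hol hA0 hb hA hα0 hα1 hB.nonneg hH0 hB.2 fun r hr => (hH r hr).2
  induction m generalizing X B H with
  | zero => simpa using h0 hB hH
  | succ m ih =>
    have hK0 : 0 ≤ K := (hK s left_mem_uIcc).nonneg
    refine ⟨(h0 hB.base fun r hr => (hH r hr).base).mono ?_, fun c => ?_⟩
    · gcongr
      have : 0 ≤ ((m + 1 : ℕ) : ℝ) * (3 * 2 ^ (m + 1 + 1) * (A * K)) := by positivity
      linarith
    · rw [← STPer.sl_smul_dx]
      refine (ih (fun r hr i j => (hv r hr i j).of_succ) (X := l • STPer.dx c X) (B := B)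
        (H := H + 3 * (2 ^ (m + 1) * (A * K))) ?_ ?_ ?_).mono ?_
      · rw [STPer.sl_smul_dx]; exact hB.2 c
      · intro r hr
        rw [STPer.sl_MD_smul_dx]
        exact ((hH r hr).2 c).sub (HB.sum3 fun j => (hv r hr c j).of_succ.mul ((hK r hr).2 j))
      · intro r hr
        rw [STPer.sl_smul_dx]; exact (hK r hr).2 c
      · have h1 : (2 : ℝ) ^ (m + 1 + 1) = 2 * 2 ^ (m + 1) := by ring
        have h2 : 0 ≤ (2 : ℝ) ^ (m + 1) * (A * K) := by positivity
        have h3 : 0 ≤ (m : ℝ) * ((2 : ℝ) ^ (m + 1) * (A * K)) := by positivity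
        have h4 : H + 3 * (2 ^ (m + 1) * (A * K)) + m * (3 * 2 ^ (m + 1) * (A * K)) ≤
            H + ((m + 1 : ℕ) : ℝ) * (3 * 2 ^ (m + 1 + 1) * (A * K)) := by
          rw [h1]
          push_cast
          nlinarith
        exact mul_le_mul_of_nonneg_left (add_le_add le_rfl
          (mul_le_mul_of_nonneg_left h4 (abs_nonneg _))) (by norm_num)

lemma STPer.exists_lipschitz_time (X : STPer) (c d : ℝ) : ∃ L, 0 ≤ L ∧ ∀ s ∈ Icc c d,
    ∀ t ∈ Icc c d, ∀ x, |X (s, x) - X (t, x)| ≤ L * |s - t| := by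
  obtain ⟨M, hM0, hM⟩ := (STPer.dt X).bounded c d
  refine ⟨M, hM0, fun s hs t ht x => ?_⟩
  have := (convex_Icc c d).norm_image_sub_le_of_norm_hasDerivWithin_le
    (fun r _ => (STPer.hasDerivAt_dt X r x).hasDerivWithinAt)
    (fun r hr => hM r hr x) ht hs
  exact this

lemma HB.exists_lipschitz_time {l α : ℝ} (hα0 : 0 ≤ α) (hα1 : α ≤ 1) (m : ℕ) (X : STPer)
    (c d : ℝ) : ∃ L, 0 ≤ L ∧ ∀ s ∈ Icc c d, ∀ t ∈ Icc c d,
    HB l α m (L * |s - t|) (STPer.sl s X - STPer.sl t X) := by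
  have h0 : ∀ X : STPer, ∃ L, 0 ≤ L ∧ ∀ s ∈ Icc c d, ∀ t ∈ Icc c d,
      HB l α 0 (L * |s - t|) (STPer.sl s X - STPer.sl t X) := by
    intro X
    obtain ⟨L, hL0, hL⟩ := X.exists_lipschitz_time c d
    choose M hM0 hM using fun i => (STPer.dx i X).exists_lipschitz_time c d
    have hS : 0 ≤ ∑ i, M i := Finset.sum_nonneg fun i _ => hM0 i
    refine ⟨3 * (L + ∑ i, M i), by positivity, fun s hs t ht => ⟨fun x => ?_, ?_⟩⟩
    · refine (hL s hs t ht x).trans ?_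
      gcongr
      linarith
    · have := SmPer.hol_of_bounds (f := STPer.sl s X - STPer.sl t X)
        (a := (L + ∑ i, M i) * |s - t|) (l := 1) one_pos hα0 hα1 (fun x => ?_) (fun i x => ?_)
      · rw [one_rpow, mul_one, ← mul_assoc] at this
        exact this
      · refine (hL s hs t ht x).trans ?_
        gcongr
        linarith
      · rw [map_sub, div_one]
        refine (hM i s hs t ht x).trans ?_
        gcongr
        have := Finset.single_le_sum (fun i _ => hM0 i) (Finset.mem_univ i)
        linarith
  induction m generalizing X with
  | zero => exact h0 X
  | succ m ih =>
    obtain ⟨L, hL0, hL⟩ := h0 X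
    choose M hM0 hM using fun i => ih (l • STPer.dx i X)
    have hS : 0 ≤ ∑ i, M i := Finset.sum_nonneg fun i _ => hM0 i
    refine ⟨L + ∑ i, M i, by positivity, fun s hs t ht => ⟨(hL s hs t ht).mono ?_, fun i => ?_⟩⟩
    · gcongr
      linarith
    · have := hM i s hs t ht
      rw [STPer.sl_smul_dx, STPer.sl_smul_dx, ← smul_sub, ← map_sub] at this
      refine this.mono ?_
      gcongr
      have := Finset.single_le_sum (fun i _ => hM0 i) (Finset.mem_univ i)
      linarith

/-- Continuity argument: if a bound by `K` up to time `t` improves to `K / 2` at time `t`, then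
the bound by `K` holds throughout. -/
theorem bootstrap {ι : Type*} [Fintype ι] {l α : ℝ} (hα0 : 0 ≤ α) (hα1 : α ≤ 1) (m : ℕ)
    (X : ι → STPer) {s T K : ℝ} (hK : 0 < K)
    (h : ∀ t ∈ uIcc s T, (∀ r ∈ uIcc s t, ∀ i, HB l α m K (STPer.sl r (X i))) →
      ∀ i, HB l α m (K / 2) (STPer.sl t (X i)))
    (h0 : ∀ i, HB l α m (K / 2) (STPer.sl s (X i))) :
    ∀ t ∈ uIcc s T, ∀ i, HB l α m K (STPer.sl t (X i)) := by
  choose M hM0 hM using fun i => HB.exists_lipschitz_time (l := l) hα0 hα1 m (X i) (s ⊓ T) (s ⊔ T)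
  have hS : 0 ≤ ∑ i, M i := Finset.sum_nonneg fun i _ => hM0 i
  obtain ⟨ε, hε, hεS⟩ : ∃ ε, 0 < ε ∧ (∑ i, M i) * ε ≤ K / 2 := by
    refine ⟨K / 2 / (∑ i, M i + 1), by positivity, ?_⟩
    rw [mul_div_assoc', div_le_iff₀ (by positivity)]
    nlinarith
  have key : ∀ k : ℕ, ∀ r ∈ uIcc s T, |r - s| ≤ k * ε → ∀ i, HB l α m K (STPer.sl r (X i)) := by
    intro k
    induction k with
    | zero =>
      intro r _ hrs i
      have : r = s := by
        have : |r - s| ≤ 0 := by simpa using hrs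
        exact sub_eq_zero.1 (abs_nonpos_iff.1 this)
      rw [this]
      exact (h0 i).mono (by linarith)
    | succ k ih =>
      intro r hr hrs i
      push_cast at hrs
      have hkε : 0 ≤ k * ε := by positivity
      obtain ⟨r₀, h1, h2, h3⟩ : ∃ r₀ ∈ uIcc s r, |r₀ - s| ≤ k * ε ∧ |r - r₀| ≤ ε := by
        rcases le_total s r with hsr | hsr
        · rw [abs_of_nonneg (by linarith)] at hrs
          refine ⟨max (r - ε) s, ?_, ?_, ?_⟩
          · rw [uIcc_of_le hsr]
            exact ⟨le_max_right _ _, max_le (by linarith) hsr⟩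
          · rw [abs_of_nonneg (by linarith [le_max_right (r - ε) s])]
            rcases max_choice (r - ε) s with h | h <;> rw [h] <;> linarith
          · rw [abs_of_nonneg (by linarith [max_le (by linarith : r - ε ≤ r) hsr])]
            linarith [le_max_left (r - ε) s]
        · rw [abs_of_nonpos (by linarith)] at hrs
          refine ⟨min (r + ε) s, ?_, ?_, ?_⟩
          · rw [uIcc_of_ge hsr]
            exact ⟨le_min (by linarith) hsr, min_le_right _ _⟩
          · rw [abs_of_nonpos (by linarith [min_le_right (r + ε) s])]
            rcases min_choice (r + ε) s with h | h <;> rw [h] <;> linarith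
          · rw [abs_of_nonpos (by linarith [le_min (by linarith : r ≤ r + ε) hsr])]
            linarith [min_le_left (r + ε) s]
      have hsub : uIcc s r ⊆ uIcc s T := uIcc_subset_uIcc_left hr
      have hr₀ : r₀ ∈ uIcc s T := hsub h1
      have h4 := h r₀ hr₀ (fun r' hr' => ih r' (uIcc_subset_uIcc_left hr₀ hr') (by
        have := abs_sub_left_of_mem_uIcc hr'
        linarith)) i
      have h5 := (hM i r hr r₀ hr₀).add h4
      rw [sub_add_cancel] at h5
      refine h5.mono ?_
      have h6 := Finset.single_le_sum (fun i _ => hM0 i) (Finset.mem_univ i)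
      have h7 : M i * |r - r₀| ≤ (∑ i, M i) * ε := by gcongr
      linarith
  intro t ht i
  obtain ⟨k, hk⟩ := exists_nat_ge (|t - s| / ε)
  exact key k t ht ((div_le_iff₀ hε).1 hk) i

lemma cube3_ae_eq : cube3 =ᵐ[volume] Icc (0 : V3) 1 := Measure.univ_pi_Ico_ae_eq_Icc

lemma integrableOn_cube3 {E : Type*} [NormedAddCommGroup E] {g : V3 → E} (hg : Continuous g) :
    IntegrableOn g cube3 :=
  (hg.continuousOn.integrableOn_compact isCompact_Icc).congr_set_ae cube3_ae_eq

lemma integral_fderiv_per {g : V3 → ℂ} (hg : ContDiff ℝ 1 g) (hp : Per g) (i : Fin 3) :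
    ∫ x in cube3, fderiv ℝ g x (Pi.single i 1) = 0 := by
  rw [setIntegral_congr_set cube3_ae_eq]
  have hd : Differentiable ℝ g := hg.differentiable (by simp)
  have hc : Continuous fun x => fderiv ℝ g x (Pi.single i 1) :=
    (hg.continuous_fderiv (by simp)).clm_apply continuous_const
  have h := integral_divergence_of_hasFDerivAt_off_countable' (0 : V3) 1 zero_le_one
    (fun j x => if j = i then g x else 0) (fun j x => if j = i then fderiv ℝ g x else 0) ∅
    countable_empty ?_ ?_ ?_
  · have h1 : ∀ x, ∑ j : Fin 3, (if j = i then fderiv ℝ g x else 0) (Pi.single j 1) =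
        fderiv ℝ g x (Pi.single i 1) := by
      intro x
      rw [Finset.sum_eq_single i]
      · simp
      · intro j _ hj
        simp [hj]
      · simp
    simp only [h1] at h
    rw [h]
    refine Finset.sum_eq_zero fun j _ => ?_
    rw [sub_eq_zero]
    congr 1
    funext x
    split_ifs with hj
    · have h2 : (j.insertNth ((1 : V3) j) x : V3) =
          j.insertNth ((0 : V3) j) x + fun l => (((Pi.single j 1 : Fin 3 → ℤ) l : ℤ) : ℝ) := by
        ext l
        refine Fin.succAboveCases j ?_ (fun l => ?_) l
        · simp
        · simp [Fin.succAbove_ne]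
      rw [h2, hp]
    · rfl
  · intro j
    split_ifs
    · exact hg.continuous.continuousOn
    · exact continuousOn_const
  · intro x _ j
    split_ifs
    · exact (hd x).hasFDerivAt
    · exact hasFDerivAt_const _ _
  · have h1 : ∀ x, ∑ j : Fin 3, (if j = i then fderiv ℝ g x else 0) (Pi.single j 1) =
        fderiv ℝ g x (Pi.single i 1) := by
      intro x
      rw [Finset.sum_eq_single i]
      · simp
      · intro j _ hj
        simp [hj]
      · simp
    simp only [h1]
    exact hc.continuousOn.integrableOn_compact isCompact_Icc

lemma contDiff_eK (k : Fin 3 → ℤ) : ContDiff ℝ (⊤ : ℕ∞) (eK k) := by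
  unfold eK
  refine ContDiff.cexp (contDiff_const.mul (ContDiff.sum fun i _ => contDiff_const.mul ?_))
  exact Complex.ofRealCLM.contDiff.comp (contDiff_apply ℝ ℝ i)

lemma eK_per (k : Fin 3 → ℤ) : Per (eK k) := by
  intro x n
  unfold eK
  rw [Complex.exp_eq_exp_iff_exists_int]
  refine ⟨∑ i, k i * n i, ?_⟩
  simp only [Pi.add_apply, Complex.ofReal_add, mul_add, Finset.sum_add_distrib]
  push_cast
  ring

lemma norm_eK (k : Fin 3 → ℤ) (x : V3) : ‖eK k x‖ = 1 := by
  have : eK k x = Complex.exp (((2 * π * ∑ i, (k i : ℝ) * x i : ℝ) : ℂ) * Complex.I) := by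
    unfold eK
    push_cast
    ring_nf
  rw [this, Complex.norm_exp_ofReal_mul_I]

lemma eK_zero (x : V3) : eK 0 x = 1 := by simp [eK]

lemma eK_add (k : Fin 3 → ℤ) (x y : V3) : eK k (x + y) = eK k x * eK k y := by
  unfold eK
  rw [← Complex.exp_add, ← mul_add, ← Finset.sum_add_distrib]
  simp [mul_add]

lemma eK_neg (k : Fin 3 → ℤ) (x : V3) : eK k (-x) = eK (-k) x := by
  simp [eK]

lemma fderiv_eK (k : Fin 3 → ℤ) (x : V3) (i : Fin 3) :
    fderiv ℝ (eK k) x (Pi.single i 1) = 2 * π * Complex.I * k i * eK k x := by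
  have h : HasFDerivAt (fun x : V3 => 2 * (π : ℂ) * Complex.I * ∑ i, (k i : ℂ) * (x i : ℂ))
      ((2 * (π : ℂ) * Complex.I) • ∑ i, (k i : ℂ) • Complex.ofRealCLM.comp
        (ContinuousLinearMap.proj (R := ℝ) (φ := fun _ : Fin 3 => ℝ) i)) x := by
    refine HasFDerivAt.const_mul (HasFDerivAt.fun_sum fun j _ => HasFDerivAt.const_mul ?_ _) _
    exact Complex.ofRealCLM.hasFDerivAt.comp x (hasFDerivAt_apply j x)
  have h2 : HasFDerivAt (eK k) _ x := h.cexp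
  rw [h2.fderiv]
  have h3 : ∑ j, (k j : ℂ) * (((Pi.single i 1 : V3) j : ℝ) : ℂ) = k i := by
    rw [Finset.sum_eq_single i (fun j _ hj => by simp [hj]) (by simp)]
    simp
  simp only [smul_apply, sum_apply, ContinuousLinearMap.comp_apply,
    ContinuousLinearMap.proj_apply, Complex.ofRealCLM_apply, smul_eq_mul, h3, eK]
  ring

namespace SmPer

lemma contDiff_ofReal (f : SmPer) : ContDiff ℝ (⊤ : ℕ∞) fun x => (f x : ℂ) :=
  Complex.ofRealCLM.contDiff.comp f.smooth

lemma fc_D (f : SmPer) (i : Fin 3) (k : Fin 3 → ℤ) :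
    fc (D i f) k = 2 * π * Complex.I * k i * fc f k := by
  have hs : ContDiff ℝ (⊤ : ℕ∞) fun x => (f x : ℂ) * eK (-k) x :=
    f.contDiff_ofReal.mul (contDiff_eK _)
  have h := integral_fderiv_per (hs.of_le (by exact_mod_cast le_top)) (fun x n => by
    change (f (x + _) : ℂ) * eK (-k) (x + _) = f x * eK (-k) x
    rw [f.per, eK_per]) i
  have h1 : ∀ x, fderiv ℝ (fun x => (f x : ℂ) * eK (-k) x) x (Pi.single i 1) =
      (D i f x : ℂ) * eK (-k) x - 2 * π * Complex.I * k i * ((f x : ℂ) * eK (-k) x) := by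
    intro x
    have hf : HasFDerivAt (fun x => (f x : ℂ)) (Complex.ofRealCLM.comp (fderiv ℝ f x)) x :=
      Complex.ofRealCLM.hasFDerivAt.comp x (f.diff x).hasFDerivAt
    have he := (((contDiff_eK (-k)).differentiable (by simp)) x).hasFDerivAt
    rw [(hf.fun_mul he).fderiv]
    simp only [_root_.add_apply, _root_.smul_apply, fderiv_eK,
      D_apply, pd, ContinuousLinearMap.comp_apply, smul_eq_mul, Complex.ofRealCLM_apply,
      Pi.neg_apply, Int.cast_neg]
    ring
  simp only [h1] at h
  rw [integral_sub (integrableOn_cube3 ((D i f).contDiff_ofReal.mul (contDiff_eK _)).continuous)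
    ((integrableOn_cube3 hs.continuous).const_mul _), integral_const_mul, sub_eq_zero] at h
  exact h

end SmPer

/-- The projection `ℝ³ → T³`. -/
def toTorus (x : V3) : UnitAddTorus (Fin 3) := fun i => (x i : UnitAddCircle)

lemma isOpenQuotientMap_toTorus : IsOpenQuotientMap toTorus :=
  IsOpenQuotientMap.piMap fun _ => QuotientAddGroup.isOpenQuotientMap_mk

lemma exists_shift_of_toTorus_eq {x y : V3} (h : toTorus x = toTorus y) :
    ∃ k : Fin 3 → ℤ, y = x + fun i => (k i : ℝ) := by
  have : ∀ i, ∃ n : ℤ, y i = x i + n := fun i => by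
    have hi : ((x i : UnitAddCircle)) = (y i : UnitAddCircle) := congrFun h i
    rw [eq_comm, QuotientAddGroup.eq_iff_sub_mem, AddSubgroup.mem_zmultiples_iff] at hi
    obtain ⟨n, hn⟩ := hi
    refine ⟨n, ?_⟩
    rw [zsmul_eq_mul, mul_one] at hn
    linarith
  choose k hk using this
  exact ⟨k, funext hk⟩

lemma exists_torus_lift {g : V3 → ℂ} (hg : Continuous g) (hp : Per g) :
    ∃ F : C(UnitAddTorus (Fin 3), ℂ), ∀ x, F (toTorus x) = g x := by
  have hq := isOpenQuotientMap_toTorus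
  have hq' : Topology.IsQuotientMap (⟨toTorus, hq.continuous⟩ : C(V3, UnitAddTorus (Fin 3))) :=
    hq.isQuotientMap
  have hf : Function.FactorsThrough (⟨g, hg⟩ : C(V3, ℂ))
      (⟨toTorus, hq.continuous⟩ : C(V3, UnitAddTorus (Fin 3))) := by
    intro x y hxy
    obtain ⟨k, rfl⟩ := exists_shift_of_toTorus_eq hxy
    exact (hp x k).symm
  refine ⟨hq'.lift ⟨g, hg⟩ hf, fun x => ?_⟩
  exact DFunLike.congr_fun (hq'.lift_comp ⟨g, hg⟩ hf) x

lemma cube3_ae_eq_Ioc : cube3 =ᵐ[volume] {x : V3 | ∀ i, x i ∈ Ioc ((0 : V3) i) ((0 : V3) i + 1)} := by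
  have h : {x : V3 | ∀ i, x i ∈ Ioc ((0 : V3) i) ((0 : V3) i + 1)} =
      Set.univ.pi fun i => Ioc ((0 : V3) i) ((1 : V3) i) := by
    ext x; simp [Set.mem_pi]
  rw [h]
  exact cube3_ae_eq.trans Measure.univ_pi_Ioc_ae_eq_Icc.symm

/-- The Haar probability measure on the torus. -/
abbrev haarT : Measure (UnitAddTorus (Fin 3)) := Measure.pi fun _ => AddCircle.haarAddCircle

lemma integral_cube3_toTorus (F : UnitAddTorus (Fin 3) → ℂ) :
    ∫ x in cube3, F (toTorus x) = ∫ z, F z ∂haarT := by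
  rw [setIntegral_congr_set cube3_ae_eq_Ioc]
  exact (UnitAddTorus.integral_preimage F 0).symm

lemma integral_cube3_sub {g : V3 → ℂ} (hg : Continuous g) (hp : Per g) (x : V3) :
    ∫ y in cube3, g (x - y) = ∫ y in cube3, g y := by
  obtain ⟨F, hF⟩ := exists_torus_lift hg hp
  simp only [← hF]
  have h : ∀ y, toTorus (x - y) = toTorus x - toTorus y := fun y => rfl
  simp only [h]
  rw [integral_cube3_toTorus fun z => F (toTorus x - z), integral_cube3_toTorus F]
  have : (AddCircle.haarAddCircle (T := 1)).IsNegInvariant :=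
    Measure.IsAddHaarMeasure.isNegInvariant_of_regular _
  exact integral_sub_left_eq_self (fun z => F z) haarT (toTorus x)

lemma mFourier_toTorus (k : Fin 3 → ℤ) (x : V3) :
    UnitAddTorus.mFourier k (toTorus x) = eK k x := by
  change ∏ i, fourier (k i) (x i : UnitAddCircle) = _
  simp only [fourier_coe_apply, eK]
  rw [← Complex.exp_sum]
  congr 1
  rw [Finset.mul_sum]
  refine Finset.sum_congr rfl fun i _ => ?_
  push_cast
  ring

lemma hasSum_fc (f : SmPer) (h : Summable (fc f)) (x : V3) :
    HasSum (fun k => fc f k * eK k x) (f x) := by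
  obtain ⟨F, hF⟩ := exists_torus_lift f.contDiff_ofReal.continuous
    (fun x k => by rw [f.per])
  have h1 : UnitAddTorus.mFourierCoeff F = fc f := by
    funext k
    rw [UnitAddTorus.mFourierCoeff_eq_integral F k 0, ← setIntegral_congr_set cube3_ae_eq_Ioc, fc]
    refine setIntegral_congr_fun (by exact MeasurableSet.univ_pi fun _ => measurableSet_Ico)
      fun y _ => ?_
    change UnitAddTorus.mFourier (-k) (toTorus y) • F (toTorus y) = _
    rw [mFourier_toTorus, hF, smul_eq_mul, mul_comm]
  have h2 := UnitAddTorus.hasSum_mFourier_series_apply_of_summable (f := F) (by rwa [h1])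
    (toTorus x)
  rw [h1, hF] at h2
  simpa only [mFourier_toTorus, smul_eq_mul] using h2

/-- The multiplier of the inverse Laplacian. -/
def mInv (k : Fin 3 → ℤ) : ℂ :=
  if k = 0 then 0 else -1 / (4 * (π : ℂ) ^ 2 * (((∑ i, ((k i : ℝ)) ^ 2) : ℝ) : ℂ))

lemma norm_sq_le_sum_sq (k : Fin 3 → ℤ) :
    ‖(fun i => (k i : ℝ) : V3)‖ ^ 2 ≤ ∑ i, (k i : ℝ) ^ 2 := by
  obtain ⟨i, hi⟩ : ∃ i, ‖(fun i => (k i : ℝ) : V3)‖ = ‖(k i : ℝ)‖ := by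
    obtain ⟨i, -, hi⟩ := Finset.exists_mem_eq_sup' Finset.univ_nonempty fun i => ‖(k i : ℝ)‖₊
    refine ⟨i, ?_⟩
    rw [Pi.norm_def, ← Finset.sup'_eq_sup Finset.univ_nonempty, hi]
    rfl
  rw [hi, Real.norm_eq_abs, sq_abs]
  exact Finset.single_le_sum (fun i _ => sq_nonneg (k i : ℝ)) (Finset.mem_univ i)

lemma summable_mInv_sq : Summable fun k => ‖mInv k‖ ^ 2 := by
  have hs : Summable fun k : Fin 3 → ℤ => ‖(fun i => (k i : ℝ) : V3)‖⁻¹ ^ 4 := by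
    obtain ⟨L, hd, hL, hm⟩ : ∃ L : Submodule ℤ V3, DiscreteTopology L ∧
        Module.finrank ℤ L < 4 ∧ ∀ k : Fin 3 → ℤ, (fun i => (k i : ℝ) : V3) ∈ L := by
      refine ⟨Submodule.span ℤ (Set.range (Pi.basisFun ℝ (Fin 3))), inferInstance, ?_,
        fun k => ?_⟩
      · rw [ZLattice.rank ℝ]
        simp
      · have h : (fun i => (k i : ℝ) : V3) = ∑ i, k i • Pi.basisFun ℝ (Fin 3) i := by
          ext j
          simp [Finset.sum_apply, Pi.single_apply]
        rw [h]
        exact Submodule.sum_mem _ fun i _ =>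
          Submodule.smul_mem _ _ (Submodule.subset_span (Set.mem_range_self i))
    have he : Function.Injective fun k : Fin 3 → ℤ => (⟨_, hm k⟩ : L) :=
      fun k k' h => funext fun i => by
        have h1 : (k i : ℝ) = k' i := congrFun (congrArg Subtype.val h) i
        exact_mod_cast h1
    have h1 := ZLattice.summable_norm_pow_inv L 4 hL
    have h2 := h1.comp_injective he
    refine h2.congr fun k => ?_
    rw [Function.comp_apply, Submodule.coe_norm]
  refine hs.of_nonneg_of_le (fun _ => by positivity) fun k => ?_
  unfold mInv
  split_ifs with hk
  · rw [norm_zero, zero_pow two_ne_zero]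
    positivity
  · have hpos : 0 < ‖(fun i => (k i : ℝ) : V3)‖ := by
      rw [norm_pos_iff]
      intro h
      exact hk (funext fun i => Int.cast_eq_zero.1 (congrFun h i : (k i : ℝ) = 0))
    have h1 := norm_sq_le_sum_sq k
    have h3 : (1 : ℝ) ≤ 4 * π ^ 2 := by nlinarith [Real.pi_gt_three]
    have h2 : ‖-1 / (4 * (π : ℂ) ^ 2 * (((∑ i, ((k i : ℝ)) ^ 2) : ℝ) : ℂ))‖ =
        1 / (4 * π ^ 2 * ∑ i, ((k i : ℝ)) ^ 2) := by
      rw [norm_div, norm_neg, norm_one]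
      congr 1
      have : (4 * (π : ℂ) ^ 2 * (((∑ i, ((k i : ℝ)) ^ 2) : ℝ) : ℂ)) =
        ((4 * π ^ 2 * ∑ i, ((k i : ℝ)) ^ 2 : ℝ) : ℂ) := by push_cast; rfl
      rw [this, Complex.norm_real, Real.norm_of_nonneg (by positivity)]
    rw [h2, show ‖(fun i => (k i : ℝ) : V3)‖⁻¹ ^ 4 = (1 / ‖(fun i => (k i : ℝ) : V3)‖ ^ 2) ^ 2 by
      field_simp]
    gcongr
    nlinarith [sq_nonneg ‖(fun i => (k i : ℝ) : V3)‖]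

lemma mInv_ne_zero {k : Fin 3 → ℤ} (hk : k ≠ 0) :
    mInv k * -(4 * (π : ℂ) ^ 2 * (((∑ i, ((k i : ℝ)) ^ 2) : ℝ) : ℂ)) = 1 := by
  have h : (∑ i, ((k i : ℝ)) ^ 2) ≠ 0 := by
    intro h
    refine hk (funext fun i => ?_)
    have := (Finset.sum_eq_zero_iff_of_nonneg fun i _ => sq_nonneg (k i : ℝ)).1 h i
      (Finset.mem_univ i)
    exact_mod_cast pow_eq_zero_iff two_ne_zero |>.1 this
  have h2 : (((∑ i, ((k i : ℝ)) ^ 2) : ℝ) : ℂ) ≠ 0 := by exact_mod_cast h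
  have h3 : (π : ℂ) ≠ 0 := by exact_mod_cast Real.pi_ne_zero
  rw [mInv, if_neg hk]
  field_simp

namespace SmPer

lemma integrableOn_fc (f : SmPer) (k : Fin 3 → ℤ) :
    IntegrableOn (fun x => (f x : ℂ) * eK (-k) x) cube3 :=
  integrableOn_cube3 (f.contDiff_ofReal.mul (contDiff_eK _)).continuous

lemma fc_add (f g : SmPer) (k : Fin 3 → ℤ) : fc (f + g : SmPer) k = fc f k + fc g k := by
  unfold fc
  rw [← integral_add (f.integrableOn_fc k) (g.integrableOn_fc k)]
  refine integral_congr_ae (Eventually.of_forall fun x => ?_)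
  simp only [add_apply]
  push_cast
  ring

lemma fc_lap (f : SmPer) (k : Fin 3 → ℤ) :
    fc (lap f) k = -(4 * (π : ℂ) ^ 2 * (((∑ i, ((k i : ℝ)) ^ 2) : ℝ) : ℂ)) * fc f k := by
  have hI : Complex.I ^ 2 = -1 := Complex.I_sq
  simp only [lap, Fin.sum_univ_three, fc_add, fc_D]
  push_cast
  linear_combination (4 * (π : ℂ) ^ 2 * ((k 0 : ℂ) ^ 2 + (k 1 : ℂ) ^ 2 + (k 2 : ℂ) ^ 2) * fc f k) * hI

lemma mInv_mul_fc_lap (f : SmPer) {k : Fin 3 → ℤ} (hk : k ≠ 0) :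
    mInv k * fc (lap f) k = fc f k := by
  rw [fc_lap, ← mul_assoc, mInv_ne_zero hk, one_mul]

lemma exists_norm_fc_le (f : SmPer) : ∃ M, 0 ≤ M ∧ ∀ k, ‖fc f k‖ ≤ M := by
  obtain ⟨M, hM0, hM⟩ := f.bounded
  refine ⟨M, hM0, fun k => ?_⟩
  have h := norm_setIntegral_le_of_norm_le_const (μ := volume) (s := cube3)
    (f := fun x => (f x : ℂ) * eK (-k) x) (C := M) ?_ fun x _ => ?_
  · have hv : (volume : Measure V3).real cube3 = 1 := by
      rw [Measure.real, cube3, Real.volume_pi_Ico]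
      simp
    rwa [hv, mul_one] at h
  · rw [cube3, Real.volume_pi_Ico]
    simp
  · rw [norm_mul, norm_eK, mul_one, Complex.norm_real]
    exact hM x

lemma summable_fc (f : SmPer) : Summable (fc f) := by
  obtain ⟨M, hM0, hM⟩ := (lap (lap f)).exists_norm_fc_le
  refine Summable.of_norm_bounded_eventually (summable_mInv_sq.mul_right M) ?_
  filter_upwards [(Set.finite_singleton (0 : Fin 3 → ℤ)).compl_mem_cofinite] with k hk
  rw [← mInv_mul_fc_lap f hk, ← mInv_mul_fc_lap (lap f) hk, ← mul_assoc, ← pow_two, norm_mul,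
    norm_pow]
  gcongr
  exact hM k

lemma fc_zero (f : SmPer) : fc f 0 = ((∫ y in cube3, f y : ℝ) : ℂ) := by
  simp only [fc, neg_zero, eK_zero, mul_one]
  exact integral_ofReal

lemma hasSum_fc_ne_zero (f : SmPer) (x : V3) :
    HasSum (fun k => if k = 0 then 0 else fc f k * eK k x)
      ((f x - ∫ y in cube3, f y : ℝ) : ℂ) := by
  have h := (hasSum_fc f f.summable_fc x).sub (hasSum_ite_eq (0 : Fin 3 → ℤ) (fc f 0))
  rw [fc_zero] at h
  push_cast
  refine h.congr_fun fun k => ?_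
  split_ifs with hk
  · rw [hk, eK_zero, fc_zero]; simp
  · simp

/-- The inverse Laplacian inverts the Laplacian up to the mean. -/
theorem invLap_lap (f : SmPer) (x : V3) : invLap (lap f) x = f x - ∫ y in cube3, f y := by
  have h : ∀ k : Fin 3 → ℤ, (if k = 0 then 0 else
      (-1 / (4 * (Real.pi : ℂ)^2 * (((∑ i, ((k i : ℝ))^2) : ℝ) : ℂ))) * (fc (lap f) k * eK k x)) =
      if k = 0 then 0 else fc f k * eK k x := by
    intro k
    split_ifs with hk
    · rfl
    · rw [← mInv_mul_fc_lap f hk, mInv, if_neg hk]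
      ring
  simp only [invLap, h]
  rw [(f.hasSum_fc_ne_zero x).tsum_eq, Complex.ofReal_re]

end SmPer

/-- The Green function of the squared Laplacian. -/
def greenC (y : V3) : ℂ := ∑' k, mInv k ^ 2 * eK k y

lemma norm_greenC_term (k : Fin 3 → ℤ) (y : V3) : ‖mInv k ^ 2 * eK k y‖ = ‖mInv k‖ ^ 2 := by
  rw [norm_mul, norm_eK, mul_one, norm_pow]

lemma continuous_greenC : Continuous greenC :=
  continuous_tsum (fun k => continuous_const.mul (contDiff_eK k).continuous) summable_mInv_sq
    fun k y => (norm_greenC_term k y).le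

lemma integral_greenC (f : SmPer) (x : V3) :
    ∫ y in cube3, greenC y * (SmPer.lap (SmPer.lap f) (x - y) : ℂ) =
      ((f x - ∫ y in cube3, f y : ℝ) : ℂ) := by
  set h := SmPer.lap (SmPer.lap f) with hh
  have hc : Continuous fun y => (h (x - y) : ℂ) :=
    h.contDiff_ofReal.continuous.comp (continuous_const.sub continuous_id)
  obtain ⟨M, hM0, hM⟩ := h.bounded
  have hv : (volume : Measure V3).real cube3 = 1 := by
    rw [Measure.real, cube3, Real.volume_pi_Ico]
    simp
  have h1 := hasSum_integral_of_summable_integral_norm (μ := volume.restrict cube3)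
    (F := fun k y => mInv k ^ 2 * eK k y * (h (x - y) : ℂ))
    (fun k => integrableOn_cube3 ((continuous_const.mul (contDiff_eK k).continuous).mul hc)) ?_
  · have h2 : ∀ k, ∫ y in cube3, mInv k ^ 2 * eK k y * (h (x - y) : ℂ) =
        if k = 0 then 0 else fc f k * eK k x := by
      intro k
      have h3 : ∀ y, mInv k ^ 2 * eK k y * (h (x - y) : ℂ) =
          mInv k ^ 2 * eK k x * ((h (x - y) : ℂ) * eK (-k) (x - y)) := by
        intro y
        have : eK k y = eK k x * eK (-k) (x - y) := by
          rw [← eK_neg, ← eK_add]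
          congr 1
          abel
        rw [this]
        ring
      simp only [h3]
      rw [integral_const_mul, integral_cube3_sub (g := fun y => (h y : ℂ) * eK (-k) y)
        (h.contDiff_ofReal.mul (contDiff_eK _)).continuous
        (fun y n => by
          change (h (y + _) : ℂ) * eK (-k) (y + _) = _
          rw [h.per, eK_per])]
      change mInv k ^ 2 * eK k x * fc h k = _
      split_ifs with hk
      · simp [mInv, hk]
      · rw [← SmPer.mInv_mul_fc_lap f hk, ← SmPer.mInv_mul_fc_lap (SmPer.lap f) hk, hh]
        ring
    simp only [h2] at h1
    rw [(f.hasSum_fc_ne_zero x).unique h1]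
    refine integral_congr_ae (Eventually.of_forall fun y => ?_)
    exact tsum_mul_right.symm
  · refine (summable_mInv_sq.mul_right M).of_nonneg_of_le
      (fun k => integral_nonneg fun y => norm_nonneg _) fun k => ?_
    have := norm_setIntegral_le_of_norm_le_const (μ := volume) (s := cube3)
      (f := fun y => ‖mInv k ^ 2 * eK k y * (h (x - y) : ℂ)‖) (C := ‖mInv k‖ ^ 2 * M) ?_ fun y _ => ?_
    · rw [hv, mul_one] at this
      exact (le_abs_self _).trans this
    · rw [cube3, Real.volume_pi_Ico]
      simp
    · rw [norm_norm, norm_mul, norm_greenC_term, Complex.norm_real]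
      gcongr
      exact hM _

lemma norm_neg_le_of_mem_cube3 {y : V3} (hy : y ∈ cube3) : ‖-y‖ ≤ 1 := by
  rw [norm_neg, pi_norm_le_iff_of_nonneg zero_le_one]
  intro i
  have := hy i (Set.mem_univ i)
  rw [Real.norm_eq_abs, abs_of_nonneg this.1]
  exact this.2.le

lemma measurableSet_cube3 : MeasurableSet cube3 :=
  MeasurableSet.univ_pi fun _ => measurableSet_Ico

lemma contDiff_integral_cube3 {K : V3 → ℝ} (hK : Continuous K) {h : ℝ × V3 → ℝ}
    (hh : ContDiff ℝ (⊤ : ℕ∞) h) :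
    ContDiff ℝ (⊤ : ℕ∞) fun q : ℝ × V3 => ∫ y in cube3, K y * h (q.1, q.2 - y) := by
  let χ : ContDiffBump (0 : V3) := ⟨2, 3, by norm_num, by norm_num⟩
  have h1 := contDiffOn_convolution_right_with_param (μ := (volume : Measure V3))
    (f := cube3.indicator K) (n := ⊤) (ContinuousLinearMap.mul ℝ ℝ)
    (g := fun (p : ℝ × V3) y => χ y * h (p.1, p.2 + y)) (s := Set.univ)
    (k := Metric.closedBall 0 3) isOpen_univ (isCompact_closedBall _ _)
    (fun p y _ hy => by
      rw [χ.zero_of_le_dist, zero_mul]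
      rw [Metric.mem_closedBall, not_le] at hy
      exact hy.le)
    ((integrable_indicator_iff measurableSet_cube3).2
      (integrableOn_cube3 hK)).locallyIntegrable
    (ContDiff.contDiffOn (by
      refine ContDiff.mul (χ.contDiff.comp contDiff_snd) (hh.comp ?_)
      exact (contDiff_fst.comp contDiff_fst).prodMk
        ((contDiff_snd.comp contDiff_fst).add contDiff_snd)))
  rw [Set.univ_prod_univ, contDiffOn_univ] at h1
  have h2 : ContDiff ℝ (⊤ : ℕ∞) fun q : ℝ × V3 => (q, (0 : V3)) := contDiff_id.prodMk contDiff_const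
  convert h1.comp h2 using 1
  funext q
  change _ = ∫ y, cube3.indicator K y * (χ (0 - y) * h (q.1, q.2 + (0 - y)))
  rw [← integral_indicator measurableSet_cube3]
  refine integral_congr_ae (Eventually.of_forall fun y => ?_)
  by_cases hy : y ∈ cube3
  · have : χ (0 - y) = 1 := by
      rw [zero_sub]
      refine χ.one_of_mem_closedBall ?_
      rw [mem_closedBall_zero_iff]
      exact (norm_neg_le_of_mem_cube3 hy).trans (by norm_num)
    simp only [Set.indicator_of_mem hy, this, one_mul]
    rw [zero_sub, ← sub_eq_add_neg]
  · simp only [Set.indicator_of_notMem hy, zero_mul]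

namespace STPer

/-- Convolution in space with the kernel `K`. -/
def conv {K : V3 → ℝ} (hK : Continuous K) (h : STPer) : STPer :=
  ⟨fun q => ∫ y in cube3, K y * h (q.1, q.2 - y), contDiff_integral_cube3 hK h.smooth,
    fun t x k => by
      refine integral_congr_ae (Eventually.of_forall fun y => ?_)
      have := h.2.2 t (x - y) k
      simp only at this
      simp only [add_sub_right_comm, this]⟩

lemma conv_apply {K : V3 → ℝ} (hK : Continuous K) (h : STPer) (t : ℝ) (x : V3) :
    conv hK h (t, x) = ∫ y in cube3, K y * h (t, x - y) := rfl

lemma dx_conv {K : V3 → ℝ} (hK : Continuous K) (h : STPer) (i : Fin 3) :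
    dx i (conv hK h) = conv hK (dx i h) := by
  refine ext' fun ⟨t, x⟩ => ?_
  have hl : ∀ (g : STPer) (x : V3),
      HasDerivAt (fun s : ℝ => g (t, x + s • (Pi.single i 1 : V3))) (dx i g (t, x)) 0 := by
    intro g x
    have h1 : HasDerivAt (fun s : ℝ => x + s • (Pi.single i 1 : V3)) (Pi.single i 1) 0 := by
      simpa using ((hasDerivAt_id (0 : ℝ)).smul_const (Pi.single i 1 : V3)).const_add x
    have h2 : HasFDerivAt (fun y => g (t, y)) (fderiv ℝ (fun y => g (t, y)) x)
        (x + (0 : ℝ) • (Pi.single i 1 : V3)) := by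
      rw [zero_smul, add_zero]
      exact ((hasFDerivAt_slice g t x).differentiableAt).hasFDerivAt
    exact h2.comp_hasDerivAt (0 : ℝ) h1
  have hl' : ∀ (x : V3) (s : ℝ),
      HasDerivAt (fun s : ℝ => h (t, x + s • (Pi.single i 1 : V3)))
        (dx i h (t, x + s • (Pi.single i 1 : V3))) s := by
    intro x s
    have h1 := hl h (x + s • (Pi.single i 1 : V3))
    have h2 : HasDerivAt (fun r : ℝ => r - s) 1 s := (hasDerivAt_id s).sub_const s
    have h3 := HasDerivAt.comp s (h₂ := fun s' : ℝ =>
      h (t, x + s • (Pi.single i 1 : V3) + s' • (Pi.single i 1 : V3))) (h := fun r => r - s)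
      (by rw [sub_self]; exact h1) h2
    rw [mul_one] at h3
    refine h3.congr_of_eventuallyEq (Eventually.of_forall fun r => ?_)
    simp only [Function.comp, add_assoc, ← add_smul, add_sub_cancel]
  obtain ⟨M, hM0, hM⟩ := (dx i h).bounded t t
  have hc : ∀ (g : STPer) (x : V3), Continuous fun y => K y * g (t, x - y) := fun g x =>
    hK.mul (g.cont.comp (continuous_const.prodMk (continuous_const.sub continuous_id)))
  have key := (hasDerivAt_integral_of_dominated_loc_of_deriv_le (μ := volume.restrict cube3)
    (F := fun (s : ℝ) y => K y * h (t, x + s • (Pi.single i 1 : V3) - y))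
    (F' := fun (s : ℝ) y => K y * dx i h (t, x + s • (Pi.single i 1 : V3) - y))
    (bound := fun y => |K y| * M) (x₀ := 0) (s := Set.univ) Filter.univ_mem
    (Eventually.of_forall fun s => (hc h _).aestronglyMeasurable)
    (integrableOn_cube3 (hc h _)) (hc _ _).aestronglyMeasurable
    (Eventually.of_forall fun y s _ => ?_)
    (integrableOn_cube3 (hK.abs.mul continuous_const))
    (Eventually.of_forall fun y s _ => ?_)).2
  · simp only [zero_smul, add_zero] at key
    exact (hl (conv hK h) x).unique key
  · rw [norm_mul, Real.norm_eq_abs]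
    gcongr
    exact hM t ⟨le_rfl, le_rfl⟩ _
  · have := (hl' (x - y) s).const_mul (K y)
    simpa only [add_sub_right_comm] using this

lemma sl_conv_lap {K : V3 → ℝ} (hK : Continuous K) (h : STPer) (t : ℝ) :
    SmPer.lap (sl t (conv hK h)) = sl t (conv hK (∑ i, dx i (dx i h))) := by
  have hadd : ∀ f g : STPer, conv hK (f + g) = conv hK f + conv hK g := by
    intro f g
    refine ext' fun ⟨t, x⟩ => ?_
    have hc : ∀ (g : STPer), Continuous fun y => K y * g (t, x - y) := fun g =>
      hK.mul (g.cont.comp (continuous_const.prodMk (continuous_const.sub continuous_id)))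
    change ∫ y in cube3, K y * (f (t, x - y) + g (t, x - y)) =
      (∫ y in cube3, K y * f (t, x - y)) + ∫ y in cube3, K y * g (t, x - y)
    simp only [mul_add]
    exact integral_add (integrableOn_cube3 (hc f)) (integrableOn_cube3 (hc g))
  simp only [SmPer.lap, Fin.sum_univ_three, hadd, ← dx_conv, map_add, sl_dx]

/-- The mean-zero Poisson equation can be solved smoothly in time. -/
theorem exists_potential (f : STPer) : ∃ a : STPer, ∀ t x,
    SmPer.lap (sl t a) x = f (t, x) - ∫ y in cube3, f (t, y) := by
  have hK : Continuous fun y => (greenC y).re := Complex.continuous_re.comp continuous_greenC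
  refine ⟨conv hK (∑ i, dx i (dx i f)), fun t x => ?_⟩
  rw [sl_conv_lap, sl_apply, conv_apply]
  have h1 : ∀ (g : STPer), sl t (∑ i, dx i (dx i g)) = SmPer.lap (sl t g) := fun g => by
    simp only [map_sum, sl_dx, SmPer.lap]
  have h2 := congrArg Complex.re (integral_greenC (sl t f) x)
  rw [Complex.ofReal_re, ← h1 f] at h2
  rw [← h1] at h2
  change _ = f (t, x) - ∫ y in cube3, f (t, y) at h2
  rw [← h2]
  have hi : Integrable (fun y => greenC y *
      ((sl t (∑ i, dx i (dx i (∑ i, dx i (dx i f)))) (x - y) : ℝ) : ℂ))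
      (volume.restrict cube3) :=
    integrableOn_cube3 (continuous_greenC.mul ((SmPer.contDiff_ofReal _).continuous.comp
      (continuous_const.sub continuous_id)))
  have h3 := integral_re hi
  refine Eq.trans ?_ h3
  refine integral_congr_ae (Eventually.of_forall fun y => ?_)
  change (greenC y).re * _ = (greenC y * _).re
  rw [Complex.re_mul_ofReal]
  rfl

end STPer

lemma STPer.sl_dt_eq_zero {c d : ℝ} (hcd : c < d) {X : STPer}
    (h : ∀ t ∈ Icc c d, STPer.sl t X = 0) {t : ℝ} (ht : t ∈ Icc c d) :
    STPer.sl t (STPer.dt X) = 0 := by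
  refine SmPer.ext' fun x => ?_
  have h1 := (STPer.hasDerivAt_dt X t x).hasDerivWithinAt (s := Icc c d)
  have hz : ∀ s ∈ Icc c d, X (s, x) = 0 := fun s hs => by
    rw [← STPer.sl_apply, h s hs, SmPer.zero_apply]
  have h2 : HasDerivWithinAt (fun s => X (s, x)) 0 (Icc c d) t :=
    (hasDerivWithinAt_const t (Icc c d) (0 : ℝ)).congr hz (hz t ht)
  exact (uniqueDiffOn_Icc hcd t ht).eq_deriv _ h1 h2

lemma STPer.dt_add (X Y : STPer) : STPer.dt (X + Y) = STPer.dt X + STPer.dt Y :=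
  STPer.ext' fun q =>
    ((STPer.hasDerivAt_dt X q.1 q.2).add (STPer.hasDerivAt_dt Y q.1 q.2)).deriv

lemma STPer.dt_sub (X Y : STPer) : STPer.dt (X - Y) = STPer.dt X - STPer.dt Y :=
  STPer.ext' fun q =>
    ((STPer.hasDerivAt_dt X q.1 q.2).sub (STPer.hasDerivAt_dt Y q.1 q.2)).deriv

lemma STPer.dt_sum3 (X : Fin 3 → STPer) : STPer.dt (∑ i, X i) = ∑ i, STPer.dt (X i) := by
  simp only [Fin.sum_univ_three, STPer.dt_add]

lemma STPer.sl_MD_dx (v : Fin 3 → STPer) (c : Fin 3) (X : STPer) (t : ℝ) :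
    STPer.sl t (STPer.MD v (STPer.dx c X)) = SmPer.D c (STPer.sl t (STPer.MD v X)) -
      ∑ j, SmPer.D c (STPer.sl t (v j)) * SmPer.D j (STPer.sl t X) := by
  simpa using STPer.sl_MD_smul_dx v 1 c X t

lemma SmPer.ddiv_single (c b : Fin 3) (G : SmPer) :
    SmPer.ddiv (fun i j => if i = c then if j = b then G else 0 else 0) =
      SmPer.D c (SmPer.D b G) := by
  simp only [ddiv, apply_ite, map_zero]
  simp

lemma SmPer.ddiv_row (c : Fin 3) (f : Fin 3 → SmPer) :
    SmPer.ddiv (fun i j => if i = c then f j else 0) = SmPer.D c (∑ k, SmPer.D k (f k)) := by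
  rw [map_sum, ddiv, Finset.sum_eq_single c (fun i _ hi => by simp [hi]) (by simp)]
  simp

lemma SmPer.div_convection (f g : Fin 3 → SmPer) (hg : ∑ k, SmPer.D k (g k) = 0) :
    ∑ k, SmPer.D k (∑ a, f a * SmPer.D a (g k)) =
      ∑ k, ∑ a, SmPer.D k (f a) * SmPer.D a (g k) := by
  have h : ∀ k a, SmPer.D k (f a * SmPer.D a (g k)) =
      f a * SmPer.D a (SmPer.D k (g k)) + SmPer.D k (f a) * SmPer.D a (g k) := by
    intro k a
    rw [Derivation.leibniz, smul_eq_mul, smul_eq_mul, SmPer.D_comm k a,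
      mul_comm (SmPer.D a (g k))]
  simp only [map_sum, h, Finset.sum_add_distrib]
  rw [Finset.sum_comm]
  simp only [← Finset.mul_sum, ← map_sum, hg, map_zero, mul_zero, Finset.sum_const_zero, zero_add]

/-- Smooth periodic solutions of the relaxed Boussinesq system on the time set `I`. -/
structure BoussinesqOn (I : Set ℝ) (v : Fin 3 → STPer) (θ p : STPer)
    (R : Fin 3 → Fin 3 → STPer) (T : Fin 3 → STPer) : Prop where
  momentum : ∀ t ∈ I, ∀ i, STPer.sl t (STPer.MD v (v i)) =
    (if i = 2 then STPer.sl t θ else 0) - SmPer.D i (STPer.sl t p) +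
      ∑ j, SmPer.D j (STPer.sl t (R i j))
  transport : ∀ t ∈ I, STPer.sl t (STPer.MD v θ) = ∑ j, SmPer.D j (STPer.sl t (T j))
  divfree : ∀ t ∈ I, ∑ i, SmPer.D i (STPer.sl t (v i)) = 0

namespace BoussinesqOn

variable {c d : ℝ} {v : Fin 3 → STPer} {θ p : STPer} {R : Fin 3 → Fin 3 → STPer}
  {T : Fin 3 → STPer}

lemma div_dt (h : BoussinesqOn (Icc c d) v θ p R T) (hcd : c < d) {t : ℝ} (ht : t ∈ Icc c d) :
    ∑ i, SmPer.D i (STPer.sl t (STPer.dt (v i))) = 0 := by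
  have := STPer.sl_dt_eq_zero hcd (X := ∑ i, STPer.dx i (v i)) (fun t ht => by
    simp only [map_sum, STPer.sl_dx]
    exact h.divfree t ht) ht
  simpa only [STPer.dt_sum3, map_sum, STPer.sl_dt_dx] using this

lemma lap_pressure (h : BoussinesqOn (Icc c d) v θ p R T) (hcd : c < d) {t : ℝ}
    (ht : t ∈ Icc c d) :
    SmPer.lap (STPer.sl t p) = ∑ k, SmPer.D k ((if k = 2 then STPer.sl t θ else 0) +
      ∑ j, SmPer.D j (STPer.sl t (R k j))) -
      ∑ k, ∑ a, SmPer.D k (STPer.sl t (v a)) * SmPer.D a (STPer.sl t (v k)) := by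
  rw [← SmPer.div_convection _ (fun k => STPer.sl t (v k)) (h.divfree t ht)]
  refine Eq.trans ?_ ((congrArg (_ - ·) (h.div_dt hcd ht)).trans (sub_zero _))
  rw [SmPer.lap, ← Finset.sum_sub_distrib, ← Finset.sum_sub_distrib]
  refine Finset.sum_congr rfl fun k _ => ?_
  rw [← map_sub, ← map_sub]
  have := h.momentum t ht k
  rw [STPer.sl_MD] at this
  congr 1
  linear_combination this

end BoussinesqOn

/-- Propagation of the gradient bounds for the exact system over short times. -/
theorem exists_gradient_bound {α C : ℝ} (hα0 : 0 ≤ α) (hα1 : α ≤ 1) (hC0 : 0 ≤ C)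
    (hC : SchauderConst α C) (m : ℕ) : ∃ M : ℝ, 0 < M ∧ ∀ {l c d s A : ℝ}
      {v : Fin 3 → STPer} {θ p : STPer}, c < d → BoussinesqOn (Icc c d) v θ p 0 0 → 1 ≤ A →
      s ∈ Icc c d → (∀ t ∈ Icc c d, |t - s| * A * M ≤ 1) →
      (∀ i j, HB l α m A (SmPer.D i (STPer.sl s (v j)))) →
      (∀ i, HB l α m A (SmPer.D i (STPer.sl s θ))) →
      ∀ t ∈ Icc c d, (∀ i j, HB l α m (12 * A) (SmPer.D i (STPer.sl t (v j)))) ∧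
        ∀ i, HB l α m (12 * A) (SmPer.D i (STPer.sl t θ)) := by
  have hP : (1 : ℝ) ≤ 2 ^ (m + 1) := one_le_pow₀ (by norm_num)
  set P : ℝ := 2 ^ (m + 1) with hPdef
  set M₁ : ℝ := 1 + C * (1 + 9 * P) + 3 * P + m * (3 * P) with hM₁
  have hM₁1 : 1 ≤ M₁ := by
    have : 0 ≤ C * (1 + 9 * P) + 3 * P + m * (3 * P) := by positivity
    linarith
  refine ⟨144 * M₁, by positivity, ?_⟩
  intro l c d s A v θ p hcd h hA hs hsmall hv hθ t ht
  let X : Fin 3 × Option (Fin 3) → STPer := fun ι => STPer.dx ι.1 (ι.2.elim θ v)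
  have key := bootstrap (l := l) hα0 hα1 m X (s := s) (T := t) (K := 12 * A) (by positivity)
    (fun t' ht' hK => ?_) (fun ι => ?_) t right_mem_uIcc
  · exact ⟨fun i j => key (i, some j), fun i => key (i, none)⟩
  · have hsub : uIcc s t' ⊆ Icc c d := (uIcc_subset_uIcc_left ht').trans
      (uIcc_subset_Icc hs ht)
    have hvK : ∀ r ∈ uIcc s t', ∀ i j, HB l α m (12 * A) (SmPer.D i (STPer.sl r (v j))) :=
      fun r hr i j => hK r hr (i, some j)
    have hθK : ∀ r ∈ uIcc s t', ∀ i, HB l α m (12 * A) (SmPer.D i (STPer.sl r θ)) :=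
      fun r hr i => hK r hr (i, none)
    set K := 12 * A with hKdef
    have hK1 : 1 ≤ K := by linarith
    have hKK : K ≤ K * K := by nlinarith
    have hst : |s - t'| * K * (12 * M₁) ≤ 1 := by
      have := hsmall t' (hsub right_mem_uIcc)
      rw [abs_sub_comm] at this
      calc _ = |s - t'| * A * (144 * M₁) := by rw [hKdef]; ring
        _ ≤ 1 := this
    have hst0 := abs_nonneg (s - t')
    have hpres : ∀ r ∈ uIcc s t', ∀ i j,
        HB l α m (C * ((1 + 9 * P) * (K * K))) (SmPer.D i (SmPer.D j (STPer.sl r p))) := by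
      intro r hr i j
      set G : SmPer := SmPer.D 2 (STPer.sl r θ) -
        ∑ k, ∑ a, SmPer.D k (STPer.sl r (v a)) * SmPer.D a (STPer.sl r (v k)) with hG
      have hlap : SmPer.lap (STPer.sl r p) = G := by
        rw [h.lap_pressure hcd (hsub hr), hG]
        congr 1
        rw [Finset.sum_eq_single 2 (fun k _ hk => by simp [hk]) (by simp)]
        simp
      have hGB : HB l α m ((1 + 9 * P) * (K * K)) G := by
        refine ((hθK r hr 2).sub (HB.sum3 fun k => HB.sum3 fun a =>
          (hvK r hr k a).mul (hvK r hr a k))).mono ?_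
        rw [← hPdef]
        linarith
      obtain ⟨x, hx⟩ := (SmPer.D j (STPer.sl r p)).exists_D_eq_zero
      refine hC.hb hC0 hα0 ⟨x, hx i⟩
        (F := fun a b => if a = i then if b = j then G else 0 else 0) ?_
        (fun a b => HB.ite_zero _ (HB.ite_zero _ hGB))
      rw [SmPer.ddiv_single, SmPer.lap_D, SmPer.lap_D, hlap]
    have fin : ∀ (Y : STPer), (∀ i, HB l α m A (SmPer.D i (STPer.sl s Y))) →
        (∀ r ∈ uIcc s t', ∀ i, HB l α m K (SmPer.D i (STPer.sl r Y))) →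
        (∀ r ∈ uIcc s t', ∀ i, HB l α m ((1 + C * (1 + 9 * P)) * (K * K))
          (SmPer.D i (STPer.sl r (STPer.MD v Y)))) →
        ∀ i, HB l α m (K / 2) (STPer.sl t' (STPer.dx i Y)) := by
      intro Y h0 hYK hYM i
      refine (transport_hb hα0 hα1 (A := K) ?_ hvK (B := A)
        (H := (1 + C * (1 + 9 * P)) * (K * K) + 3 * (P * (K * K))) (K := K) (h0 i) ?_
        fun r hr => hYK r hr i).mono ?_
      · have := mul_le_mul_of_nonneg_left hM₁1 (by positivity : 0 ≤ |s - t'| * K * 12)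
        nlinarith
      · intro r hr
        rw [STPer.sl_MD_dx]
        exact (hYM r hr i).sub (HB.sum3 fun j => (hvK r hr i j).mul (hYK r hr j))
      · calc 3 * (A + |s - t'| * ((1 + C * (1 + 9 * P)) * (K * K) + 3 * (P * (K * K)) +
              m * (3 * P * (K * K)))) = K / 4 + (|s - t'| * K * (12 * M₁)) * K / 4 := by
              rw [hM₁, hKdef]; ring
          _ ≤ K / 4 + 1 * K / 4 := by gcongr
          _ = K / 2 := by ring
    rintro ⟨i, _ | j⟩
    · refine fin θ hθ hθK (fun r hr i => ?_) i
      rw [h.transport r (hsub hr)]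
      simp only [Pi.zero_apply, map_zero, Finset.sum_const_zero]
      exact HB.zero (by positivity)
    · refine fin (v j) (fun i => hv i j) (fun r hr i => hvK r hr i j) (fun r hr i => ?_) i
      rw [h.momentum r (hsub hr)]
      simp only [Pi.zero_apply, map_zero, Finset.sum_const_zero, add_zero, map_sub, apply_ite]
      refine ((HB.ite_zero _ (hθK r hr i)).sub (hpres r hr i j)).mono ?_
      nlinarith
  · rcases ι with ⟨i, _ | j⟩
    · exact (hθ i).mono (by linarith)
    · exact (hv i j).mono (by linarith)

namespace BoussinesqOn

variable {c d : ℝ} {v u : Fin 3 → STPer} {θ ϑ p q : STPer} {R : Fin 3 → Fin 3 → STPer}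
  {T : Fin 3 → STPer}

lemma sl_MD_sub (X Y : STPer) (t : ℝ) : STPer.sl t (STPer.MD u (X - Y)) =
    STPer.sl t (STPer.MD v X) - STPer.sl t (STPer.MD u Y) -
      ∑ j, STPer.sl t (v j - u j) * SmPer.D j (STPer.sl t X) := by
  simp only [STPer.sl_MD, STPer.dt_sub, map_sub, mul_sub, sub_mul, Finset.sum_sub_distrib]
  ring

lemma momentum_sub (h : BoussinesqOn (Icc c d) v θ p 0 0) (hr : BoussinesqOn (Icc c d) u ϑ q R T)
    {t : ℝ} (ht : t ∈ Icc c d) (i : Fin 3) : STPer.sl t (STPer.MD u (v i - u i)) =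
    (if i = 2 then STPer.sl t (θ - ϑ) else 0) - SmPer.D i (STPer.sl t (p - q)) -
      ∑ j, SmPer.D j (STPer.sl t (R i j)) -
      ∑ j, STPer.sl t (v j - u j) * SmPer.D j (STPer.sl t (v i)) := by
  rw [sl_MD_sub (v := v), h.momentum t ht, hr.momentum t ht]
  simp only [Pi.zero_apply, map_zero, Finset.sum_const_zero, add_zero]
  split_ifs <;> simp only [map_sub] <;> ring

lemma transport_sub (h : BoussinesqOn (Icc c d) v θ p 0 0)
    (hr : BoussinesqOn (Icc c d) u ϑ q R T) {t : ℝ} (ht : t ∈ Icc c d) :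
    STPer.sl t (STPer.MD u (θ - ϑ)) = -∑ j, SmPer.D j (STPer.sl t (T j)) -
      ∑ j, STPer.sl t (v j - u j) * SmPer.D j (STPer.sl t θ) := by
  rw [sl_MD_sub (v := v), h.transport t ht, hr.transport t ht]
  simp only [Pi.zero_apply, map_zero, Finset.sum_const_zero, zero_sub]

lemma lap_pressure_sub (h : BoussinesqOn (Icc c d) v θ p 0 0)
    (hr : BoussinesqOn (Icc c d) u ϑ q R T) (hcd : c < d) {t : ℝ} (ht : t ∈ Icc c d) :
    SmPer.lap (STPer.sl t (p - q)) = ∑ k, SmPer.D k ((if k = 2 then STPer.sl t (θ - ϑ) else 0) -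
      ∑ j, SmPer.D j (STPer.sl t (R k j)) -
      ∑ a, STPer.sl t (v a - u a) * SmPer.D a (STPer.sl t (v k + u k))) := by
  have hd : ∑ k, SmPer.D k (STPer.sl t (v k + u k)) = 0 := by
    simp only [map_add, Finset.sum_add_distrib, h.divfree t ht, hr.divfree t ht, add_zero]
  have h0 : SmPer.lap (STPer.sl t (p - q)) =
      SmPer.lap (STPer.sl t p) - SmPer.lap (STPer.sl t q) := by
    simp only [SmPer.lap, map_sub, Finset.sum_sub_distrib]
  have h1 := SmPer.div_convection (fun a => STPer.sl t (v a - u a))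
    (fun k => STPer.sl t (v k + u k)) hd
  have h2 : ∑ k, ∑ a, SmPer.D k (STPer.sl t (v a - u a)) * SmPer.D a (STPer.sl t (v k + u k)) =
      ∑ k, ∑ a, SmPer.D k (STPer.sl t (v a)) * SmPer.D a (STPer.sl t (v k)) -
      ∑ k, ∑ a, SmPer.D k (STPer.sl t (u a)) * SmPer.D a (STPer.sl t (u k)) := by
    simp only [map_sub, map_add, Fin.sum_univ_three]
    ring
  simp only [map_sub (SmPer.D _), Finset.sum_sub_distrib, h1, h2]
  rw [h0, h.lap_pressure hcd ht, hr.lap_pressure hcd ht]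
  simp only [Pi.zero_apply, map_zero, Finset.sum_const_zero, add_zero, map_add,
    Finset.sum_add_distrib, apply_ite, map_sub]
  have h3 : ∑ k, (if k = 2 then SmPer.D k (STPer.sl t θ) - SmPer.D k (STPer.sl t ϑ) else 0) =
      ∑ k, (if k = 2 then SmPer.D k (STPer.sl t θ) else 0) -
      ∑ k, (if k = 2 then SmPer.D k (STPer.sl t ϑ) else 0) := by
    rw [← Finset.sum_sub_distrib]
    exact Finset.sum_congr rfl fun k _ => by split_ifs <;> simp
  rw [h3]
  ring

end BoussinesqOn

/-- Stability of the exact system: bounds for the difference of an exact and a relaxed solution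
with the same data at time `s`. -/
theorem exists_difference_bound {α C : ℝ} (hα0 : 0 ≤ α) (hα1 : α ≤ 1) (hC0 : 0 ≤ C)
    (hC : SchauderConst α C) (m : ℕ) : ∃ M : ℝ, 0 < M ∧ ∀ {l c d s A E τ : ℝ}
      {v u : Fin 3 → STPer} {θ ϑ p q : STPer} {R : Fin 3 → Fin 3 → STPer} {T : Fin 3 → STPer},
      0 < l → c < d → BoussinesqOn (Icc c d) v θ p 0 0 → BoussinesqOn (Icc c d) u ϑ q R T →
      1 ≤ A → 0 < E → 0 < τ → s ∈ Icc c d → (∀ t ∈ Icc c d, |t - s| ≤ τ) → τ * A * M ≤ 1 →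
      (∀ t ∈ Icc c d, ∀ i j, HB l α m A (SmPer.D i (STPer.sl t (v j)))) →
      (∀ t ∈ Icc c d, ∀ i j, HB l α m A (SmPer.D i (STPer.sl t (u j)))) →
      (∀ t ∈ Icc c d, ∀ i, HB l α m A (SmPer.D i (STPer.sl t θ))) →
      (∀ t ∈ Icc c d, ∀ i j, HB l α (m + 1) E (STPer.sl t (R i j))) →
      (∀ t ∈ Icc c d, ∀ i, HB l α (m + 1) E (STPer.sl t (T i))) →
      (∀ i, STPer.sl s (v i) = STPer.sl s (u i)) → STPer.sl s θ = STPer.sl s ϑ →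
      ∀ t ∈ Icc c d,
        ((∀ i, HB l α m (M * (τ * (E / l))) (STPer.sl t (v i - u i))) ∧
          HB l α m (M * (τ * (E / l))) (STPer.sl t (θ - ϑ))) ∧
        (∀ i, HB l α m (M * (E / l)) (SmPer.D i (STPer.sl t (p - q)))) ∧
        ((∀ i, HB l α m (M * (E / l)) (STPer.sl t (STPer.MD u (v i - u i)))) ∧
          HB l α m (M * (E / l)) (STPer.sl t (STPer.MD u (θ - ϑ)))) := by
  have hP : (1 : ℝ) ≤ 2 ^ (m + 1) := one_le_pow₀ (by norm_num)
  set P : ℝ := 2 ^ (m + 1) with hPdef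
  set M₀ : ℝ := 4 + 6 * P with hM₀
  set M₁ : ℝ := (C + 1) * M₀ + m * (3 * P) with hM₁
  have hM₀1 : 1 ≤ M₀ := by linarith
  have hmP : 0 ≤ m * (3 * P) := by positivity
  have hM₁0 : (C + 1) * M₀ ≤ M₁ := by linarith
  have hM₁1 : 1 ≤ M₁ := by nlinarith
  refine ⟨14 * M₁, by positivity, ?_⟩
  intro l c d s A E τ v u θ ϑ p q R T hl hcd h hr hA hE hτ hs hdist hsmall hv hu hθ hR hT
    hs0 hs1 t ht
  set Q := E / l with hQ
  have hQ0 : 0 < Q := by positivity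
  have fder : ∀ r ∈ Icc c d, ∀ K, (∀ i, HB l α m K (STPer.sl r (v i - u i))) →
      HB l α m K (STPer.sl r (θ - ϑ)) →
      (∀ i, HB l α m ((C + 1) * M₀ * (K * A + Q)) (SmPer.D i (STPer.sl r (p - q)))) ∧
      (∀ i, HB l α m ((C + 1) * M₀ * (K * A + Q)) (STPer.sl r (STPer.MD u (v i - u i)))) ∧
      HB l α m ((C + 1) * M₀ * (K * A + Q)) (STPer.sl r (STPer.MD u (θ - ϑ))) := by
    intro r hr' K hw hη
    have hK0 : 0 ≤ K := hη.nonneg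
    have hKA : K ≤ K * A := le_mul_of_one_le_right hK0 hA
    have hPKA : K * A ≤ P * (K * A) := le_mul_of_one_le_left (by positivity) hP
    have hPQ : Q ≤ P * Q := le_mul_of_one_le_left hQ0.le hP
    have hCM : 0 ≤ C * (M₀ * (K * A + Q)) := by positivity
    have hDR : ∀ i j, HB l α m Q (SmPer.D j (STPer.sl r (R i j))) := fun i j =>
      (hR r hr' i j).deriv hl j
    have hDT : ∀ j, HB l α m Q (SmPer.D j (STPer.sl r (T j))) := fun j =>
      (hT r hr' j).deriv hl j
    have hπ : ∀ i, HB l α m (C * (M₀ * (K * A + Q))) (SmPer.D i (STPer.sl r (p - q))) := by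
      intro i
      obtain ⟨x, hx⟩ := (STPer.sl r (p - q)).exists_D_eq_zero
      refine hC.hb hC0 hα0 ⟨x, hx i⟩ ((SmPer.lap_D _ i).trans ((congrArg _
        (h.lap_pressure_sub hr hcd hr')).trans (SmPer.ddiv_row i _).symm)) fun a b =>
          HB.ite_zero _ ?_
      refine (((HB.ite_zero _ hη).sub (HB.sum3 fun j => hDR b j)).sub
        (HB.sum3 fun a => (hw a).mul (B' := A + A) ?_)).mono ?_
      · simp only [map_add]
        exact (hv r hr' a b).add (hu r hr' a b)
      · rw [← hPdef, hM₀]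
        nlinarith
    refine ⟨fun i => (hπ i).mono (by nlinarith), fun i => ?_, ?_⟩
    · rw [h.momentum_sub hr hr']
      refine ((((HB.ite_zero _ hη).sub (hπ i)).sub (HB.sum3 fun j => hDR i j)).sub
        (HB.sum3 fun a => (hw a).mul (hv r hr' a i))).mono ?_
      rw [← hPdef, hM₀] at *
      nlinarith
    · rw [h.transport_sub hr hr']
      refine ((HB.sum3 fun j => hDT j).neg.sub
        (HB.sum3 fun a => (hw a).mul (hθ r hr' a))).mono ?_
      rw [← hPdef, hM₀] at *
      nlinarith
  set K := 12 * M₁ * τ * Q with hK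
  have hK0 : 0 < K := by positivity
  let X : Option (Fin 3) → STPer := fun ι => ι.elim (θ - ϑ) fun i => v i - u i
  have hKA : ∀ r ∈ Icc c d, (∀ ι, HB l α m K (STPer.sl r (X ι))) := by
    intro t ht
    refine bootstrap (l := l) hα0 hα1 m X (s := s) (T := t) hK0
      (fun t' ht' hX => ?_) (fun ι => ?_) t right_mem_uIcc
    · have hsub : uIcc s t' ⊆ Icc c d := (uIcc_subset_uIcc_left ht').trans
        (uIcc_subset_Icc hs ht)
      have hst : |s - t'| ≤ τ := by
        rw [abs_sub_comm]; exact hdist t' (hsub right_mem_uIcc)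
      have fin : ∀ ι, STPer.sl s (X ι) = 0 → (∀ r ∈ uIcc s t',
          HB l α m ((C + 1) * M₀ * (K * A + Q)) (STPer.sl r (STPer.MD u (X ι)))) →
          HB l α m (K / 2) (STPer.sl t' (X ι)) := by
        intro ι h0 hM
        refine (transport_hb hα0 hα1 (A := A) ?_ (fun r hr => hu r (hsub hr)) (B := 0)
          (by rw [h0]; exact HB.zero le_rfl) hM fun r hr => hX r hr ι).mono ?_
        · have : |s - t'| * A ≤ τ * A := by gcongr
          nlinarith [mul_le_mul_of_nonneg_left hM₁1 (by positivity : 0 ≤ τ * A)]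
        · calc 3 * (0 + |s - t'| * ((C + 1) * M₀ * (K * A + Q) + m * (3 * P * (A * K))))
              ≤ 3 * (0 + τ * ((C + 1) * M₀ * (K * A + Q) + m * (3 * P * (A * K)))) := by
                gcongr
            _ ≤ 3 * (0 + τ * ((C + 1) * M₀ * (K * A + Q) + m * (3 * P) * (K * A + Q))) := by
                have e : m * (3 * P * (A * K)) ≤ m * (3 * P) * (K * A + Q) := by
                  linarith [mul_nonneg hmP hQ0.le]
                have := mul_le_mul_of_nonneg_left e hτ.le
                linarith
            _ = (τ * A * (14 * M₁)) * K * (3 / 14) + K / 4 := by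
                rw [hM₁, hK]; ring
            _ ≤ 1 * K * (3 / 14) + K / 4 := by gcongr
            _ ≤ K / 2 := by linarith
      have hD := fun r (hr : r ∈ uIcc s t') => fder r (hsub hr) K
        (fun i => hX r hr (some i)) (hX r hr none)
      rintro (_ | i)
      · refine fin none ?_ fun r hr => (hD r hr).2.2
        simp only [X, Option.elim, map_sub, hs1, sub_self]
      · refine fin (some i) ?_ fun r hr => (hD r hr).2.1 i
        simp only [X, Option.elim, map_sub, hs0, sub_self]
    · have : STPer.sl s (X ι) = 0 := by
        rcases ι with _ | i <;> simp only [X, Option.elim, map_sub, hs0, hs1, sub_self]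
      rw [this]
      exact HB.zero (by positivity)
  have hK2 : K ≤ 14 * M₁ * (τ * Q) := by
    rw [hK]
    have : 0 ≤ M₁ * (τ * Q) := by positivity
    linarith
  have hKQ : (C + 1) * M₀ * (K * A + Q) ≤ 14 * M₁ * Q := by
    calc (C + 1) * M₀ * (K * A + Q) ≤ M₁ * (K * A + Q) := by gcongr
      _ = M₁ * ((τ * A * (14 * M₁)) * (12 / 14) + 1) * Q := by rw [hK]; ring
      _ ≤ M₁ * (1 * (12 / 14) + 1) * Q := by gcongr
      _ ≤ 14 * M₁ * Q := by
        have : 0 ≤ M₁ * Q := by positivity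
        linarith
  have hw := fun i => hKA t ht (some i)
  have hη := hKA t ht none
  obtain ⟨h1, h2, h3⟩ := fder t ht K hw hη
  exact ⟨⟨fun i => (hw i).mono hK2, hη.mono hK2⟩, fun i => (h1 i).mono hKQ,
    fun i => (h2 i).mono hKQ, h3.mono hKQ⟩

namespace SmPer

/-- The mean over the torus. -/
def mean : SmPer →ₗ[ℝ] ℝ where
  toFun f := ∫ y in cube3, f y
  map_add' f g := integral_add (integrableOn_cube3 f.cont) (integrableOn_cube3 g.cont)
  map_smul' c _ := integral_const_mul c _

lemma mean_apply (f : SmPer) : mean f = ∫ y in cube3, f y := rfl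

lemma mean_D (i : Fin 3) (f : SmPer) : mean (D i f) = 0 := by
  have h := fc_zero (D i f)
  rw [fc_D] at h
  simpa [mean_apply] using h.symm

lemma mean_convection {u : Fin 3 → SmPer} (hu : ∑ k, D k (u k) = 0) (g : SmPer) :
    mean (∑ k, u k * D k g) = 0 := by
  have h : ∑ k, u k * D k g = ∑ k, D k (u k * g) := by
    simp only [Derivation.leibniz, smul_eq_mul, Finset.sum_add_distrib, ← Finset.mul_sum, hu,
      mul_zero, add_zero]
  rw [h, map_sum]
  exact Finset.sum_eq_zero fun k _ => mean_D k _

lemma mean_const {f : SmPer} (h : ∀ x y, f x = f y) (x : V3) : mean f = f x := by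
  have hv : (volume cube3).toReal = 1 := by
    rw [measure_congr cube3_ae_eq, Real.volume_Icc_pi_toReal (by intro i; simp)]
    simp
  rw [mean_apply, integral_congr_ae (Eventually.of_forall fun y => h y x), setIntegral_const]
  simp [Measure.real, hv]

lemma lap_add (f g : SmPer) : lap (f + g) = lap f + lap g := by
  simp only [lap, map_add, Finset.sum_add_distrib]

/-- Liouville's theorem for harmonic functions on the torus. -/
lemma D_eq_zero_of_lap {α C : ℝ} (hα : 0 ≤ α) (hC0 : 0 ≤ C) (hC : SchauderConst α C) {f : SmPer}
    (h : lap f = 0) (i : Fin 3) : D i f = 0 := by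
  obtain ⟨x, hx⟩ := f.exists_D_eq_zero
  have := hC.hb (l := 1) (m := 0) (B := 0) (u := D i f) (F := fun _ _ => 0) hC0 hα ⟨x, hx i⟩
    (by rw [lap_D, h]; simp [ddiv]) fun _ _ => HB.zero le_rfl
  refine ext' fun y => ?_
  have h1 := this.sup y
  rw [mul_zero] at h1
  exact abs_nonpos_iff.1 h1

lemma sum_D_vorticity (a : Fin 3 → SmPer) (h : ∀ j, D j (∑ i, D i (a i)) = 0) (j : Fin 3) :
    ∑ k, D k (D k (a j) - D j (a k)) = lap (a j) := by
  have := h j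
  simp only [map_sum] at this
  simp only [map_sub, Finset.sum_sub_distrib, lap, D_comm _ j, this, sub_zero]

/-- Transport by `∑ₖ ∂ₖ Bⱼₖ` with `B` antisymmetric is a divergence. -/
lemma convection_antisymm (B : Fin 3 → Fin 3 → SmPer) (hB : ∀ j k, B j k = -B k j) (g : SmPer) :
    ∑ j, (∑ k, D k (B j k)) * D j g = ∑ k, D k (∑ j, B j k * D j g) := by
  have h0 : ∀ j, B j j = 0 := fun j => by
    have h2 : (2 : ℝ) • B j j = 0 := by
      rw [two_smul]
      nth_rewrite 1 [hB j j]
      rw [neg_add_cancel]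
    exact (smul_eq_zero.1 h2).resolve_left two_ne_zero
  simp only [Fin.sum_univ_three, map_add, Derivation.leibniz, smul_eq_mul, h0, map_zero, hB 1 0,
    hB 2 0, hB 2 1, map_neg, D_comm 1 0 g, D_comm 2 0 g, D_comm 2 1 g]
  ring

lemma sum_D_D_mul {v : Fin 3 → SmPer} (hv : ∑ k, D k (v k) = 0) (k : Fin 3) (z : SmPer) :
    ∑ j, D j (D k (v j) * z) = ∑ j, D k (v j) * D j z := by
  have h : ∑ j, D j (D k (v j)) = 0 := by
    simp only [D_comm _ k, ← map_sum, hv, map_zero]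
  simp only [Derivation.leibniz, smul_eq_mul, Finset.sum_add_distrib, ← Finset.mul_sum, h,
    mul_zero, add_zero]

/-- The stress appearing in the equation for the transported gradient of a potential. -/
def potStress (v : Fin 3 → SmPer) (φ : SmPer) (F : Fin 3 → SmPer) (l j k : Fin 3) : SmPer :=
  (if j = l then F k + ∑ i, D i (v k) * D i φ else 0) +
    (D k (v j) * D l φ - D l (v j) * D k φ)

lemma lap_transport_potential {v : Fin 3 → SmPer} (hv : ∑ k, D k (v k) = 0) {φ φ' : SmPer}
    {F : Fin 3 → SmPer} (h : lap φ' + ∑ k, v k * D k (lap φ) = ∑ k, D k (F k)) (l : Fin 3) :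
    lap (D l φ' + ∑ k, v k * D k (D l φ)) = ddiv (potStress v φ F l) := by
  have e1 : ddiv (potStress v φ F l) = D l (∑ k, D k (F k)) +
      D l (∑ i, ∑ k, D i (v k) * D k (D i φ)) + ∑ k, D k (∑ j, D k (v j) * D j (D l φ)) -
      ∑ k, D k (∑ j, D l (v j) * D j (D k φ)) := by
    have s1 : ddiv (fun j k => if j = l then F k + ∑ i, D i (v k) * D i φ else 0) =
        D l (∑ k, D k (F k)) + D l (∑ i, ∑ k, D i (v k) * D k (D i φ)) := by
      rw [ddiv_row, ← map_add]
      congr 1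
      simp only [map_add, Finset.sum_add_distrib, map_sum]
      rw [Finset.sum_comm]
      simp only [sum_D_D_mul hv]
    have s2 : ddiv (fun j k => D k (v j) * D l φ) = ∑ k, D k (∑ j, D k (v j) * D j (D l φ)) := by
      simp only [← sum_D_D_mul hv, ddiv, map_sum]
      rw [Finset.sum_comm]
      exact Finset.sum_congr rfl fun k _ => Finset.sum_congr rfl fun j _ => D_comm _ _ _
    have s3 : ddiv (fun j k => D l (v j) * D k φ) = ∑ k, D k (∑ j, D l (v j) * D j (D k φ)) := by
      simp only [← sum_D_D_mul hv, ddiv, map_sum]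
      rw [Finset.sum_comm]
      exact Finset.sum_congr rfl fun k _ => Finset.sum_congr rfl fun j _ => D_comm _ _ _
    rw [← s1, ← s2, ← s3]
    simp only [ddiv, potStress, map_add, map_sub, Finset.sum_add_distrib, Finset.sum_sub_distrib]
    ring
  rw [e1, ← h, lap_add, lap_D, map_add]
  have h10 := D_comm 1 0
  have h20 := D_comm 2 0
  have h21 := D_comm 2 1
  fin_cases l <;>
  · simp only [lap, Fin.sum_univ_three, map_add, Derivation.leibniz, smul_eq_mul, Fin.zero_eta,
      Fin.mk_one, Fin.reduceFinMk, h10, h20, h21]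
    ring

end SmPer

lemma mean_eq_zero_of_mean_dt {c d s : ℝ} (hs : s ∈ Icc c d) {f : STPer}
    (h0 : STPer.sl s f = 0) (h : ∀ t ∈ Icc c d, SmPer.mean (STPer.sl t (STPer.dt f)) = 0)
    {t : ℝ} (ht : t ∈ Icc c d) : SmPer.mean (STPer.sl t f) = 0 := by
  obtain ⟨a, ha⟩ := f.exists_potential
  set P : STPer := f - ∑ i, STPer.dx i (STPer.dx i a) with hP
  have hPm : ∀ t x, P (t, x) = SmPer.mean (STPer.sl t f) := by
    intro t x
    have h1 : STPer.sl t P = STPer.sl t f - SmPer.lap (STPer.sl t a) := by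
      simp only [hP, map_sub, map_sum, STPer.sl_dx, SmPer.lap]
    rw [← STPer.sl_apply, h1, SmPer.sub_apply, ha, STPer.sl_apply, sub_sub_cancel]
    rfl
  have hdt : ∀ t ∈ Icc c d, ∀ x, STPer.dt P (t, x) = 0 := by
    intro t ht x
    have hm : SmPer.mean (STPer.sl t (STPer.dt P)) = 0 := by
      simp only [hP, STPer.dt_sub, STPer.dt_sum3, map_sub, map_sum, STPer.sl_dt_dx, SmPer.mean_D,
        h t ht, Finset.sum_const_zero, sub_zero]
    rw [← hm, SmPer.mean_const (fun y z => ?_) x]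
    · rfl
    · change deriv (fun s => P (s, y)) t = deriv (fun s => P (s, z)) t
      simp only [hPm]
  have hc := (convex_Icc c d).norm_image_sub_le_of_norm_hasDerivWithin_le (C := 0)
    (fun r _ => (STPer.hasDerivAt_dt P r 0).hasDerivWithinAt)
    (fun r hr => by rw [hdt r hr 0, norm_zero]) hs ht
  rw [zero_mul, hPm, hPm, h0, map_zero, sub_zero] at hc
  exact norm_le_zero_iff.1 hc

namespace BoussinesqOn

variable {c d s : ℝ} {v u : Fin 3 → STPer} {θ ϑ p q : STPer} {R : Fin 3 → Fin 3 → STPer}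
  {T : Fin 3 → STPer}

lemma divfree_sub (h : BoussinesqOn (Icc c d) v θ p 0 0) (hr : BoussinesqOn (Icc c d) u ϑ q R T)
    {t : ℝ} (ht : t ∈ Icc c d) : ∑ i, SmPer.D i (STPer.sl t (v i - u i)) = 0 := by
  simp only [map_sub, Finset.sum_sub_distrib, h.divfree t ht, hr.divfree t ht, sub_zero]

lemma mean_dt_eq_mean_MD {u : Fin 3 → STPer} {t : ℝ}
    (hu : ∑ i, SmPer.D i (STPer.sl t (u i)) = 0) (X : STPer) :
    SmPer.mean (STPer.sl t (STPer.dt X)) = SmPer.mean (STPer.sl t (STPer.MD u X)) := by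
  rw [STPer.sl_MD, map_add, SmPer.mean_convection hu, add_zero]

lemma mean_temperature_sub (h : BoussinesqOn (Icc c d) v θ p 0 0)
    (hr : BoussinesqOn (Icc c d) u ϑ q R T) (hs : s ∈ Icc c d)
    (h1 : STPer.sl s θ = STPer.sl s ϑ) {t : ℝ} (ht : t ∈ Icc c d) :
    SmPer.mean (STPer.sl t (θ - ϑ)) = 0 := by
  refine mean_eq_zero_of_mean_dt hs (by rw [map_sub, h1, sub_self]) (fun r hr' => ?_) ht
  rw [mean_dt_eq_mean_MD (hr.divfree r hr'), h.transport_sub hr hr', map_sub,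
    SmPer.mean_convection (h.divfree_sub hr hr'), map_neg, map_sum]
  simp only [SmPer.mean_D, Finset.sum_const_zero, neg_zero, sub_zero]

lemma mean_velocity_sub (h : BoussinesqOn (Icc c d) v θ p 0 0)
    (hr : BoussinesqOn (Icc c d) u ϑ q R T) (hs : s ∈ Icc c d)
    (h0 : ∀ i, STPer.sl s (v i) = STPer.sl s (u i))
    (h1 : STPer.sl s θ = STPer.sl s ϑ) {t : ℝ} (ht : t ∈ Icc c d) (i : Fin 3) :
    SmPer.mean (STPer.sl t (v i - u i)) = 0 := by
  refine mean_eq_zero_of_mean_dt hs (by rw [map_sub, h0, sub_self]) (fun r hr' => ?_) ht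
  rw [mean_dt_eq_mean_MD (hr.divfree r hr'), h.momentum_sub hr hr', map_sub,
    SmPer.mean_convection (h.divfree_sub hr hr'), map_sub, map_sub, map_sum, apply_ite SmPer.mean,
    h.mean_temperature_sub hr hs h1 hr']
  simp only [SmPer.mean_D, Finset.sum_const_zero, sub_zero, map_zero, ite_self]

end BoussinesqOn

/-- The velocity and temperature differences have potentials whose gradients are controlled by
the stresses. -/
theorem exists_potential_bound {α C : ℝ} (hα0 : 0 ≤ α) (hα1 : α ≤ 1) (hC0 : 0 ≤ C)
    (hC : SchauderConst α C) : ∃ M : ℝ, 0 < M ∧ ∀ {l c d s A E τ : ℝ}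
      {v u : Fin 3 → STPer} {θ ϑ p q : STPer} {R : Fin 3 → Fin 3 → STPer} {T : Fin 3 → STPer},
      c < d → BoussinesqOn (Icc c d) v θ p 0 0 → BoussinesqOn (Icc c d) u ϑ q R T →
      1 ≤ A → 0 < E → 0 < τ → s ∈ Icc c d → (∀ t ∈ Icc c d, |t - s| ≤ τ) → τ * A * M ≤ 1 →
      (∀ t ∈ Icc c d, ∀ i j, HB l α 0 A (SmPer.D i (STPer.sl t (v j)))) →
      (∀ t ∈ Icc c d, ∀ i j, HB l α 0 A (SmPer.D i (STPer.sl t (u j)))) →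
      (∀ t ∈ Icc c d, ∀ i, HB l α 0 A (SmPer.D i (STPer.sl t θ))) →
      (∀ t ∈ Icc c d, ∀ i j, HB l α 0 E (STPer.sl t (R i j))) →
      (∀ t ∈ Icc c d, ∀ i, HB l α 0 E (STPer.sl t (T i))) →
      (∀ i, STPer.sl s (v i) = STPer.sl s (u i)) → STPer.sl s θ = STPer.sl s ϑ →
      ∀ t ∈ Icc c d, ∃ (a : Fin 3 → SmPer) (ψ : SmPer),
        (∀ i, SmPer.lap (a i) = STPer.sl t (v i - u i)) ∧ SmPer.lap ψ = STPer.sl t (θ - ϑ) ∧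
        (∀ i j, HB l α 0 (M * (τ * E)) (SmPer.D j (a i))) ∧
        ∀ j, HB l α 0 (M * (τ * E)) (SmPer.D j ψ) := by
  set M₁ : ℝ := 35 * (C + 1) ^ 2 with hM₁
  have hM₁1 : 1 ≤ M₁ := by nlinarith
  refine ⟨12 * M₁, by positivity, ?_⟩
  intro l c d s A E τ v u θ ϑ p q R T hcd h hr hA hE hτ hs hdist hsmall hv hu hθ hR hT
    hs0 hs1
  choose a ha using fun i => (v i - u i).exists_potential
  obtain ⟨ψ, hψ⟩ := (θ - ϑ).exists_potential
  have hla : ∀ t ∈ Icc c d, ∀ i, SmPer.lap (STPer.sl t (a i)) = STPer.sl t (v i - u i) := by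
    intro t ht i
    refine SmPer.ext' fun x => ?_
    have := h.mean_velocity_sub hr hs hs0 hs1 ht i
    rw [SmPer.mean_apply] at this
    simp only [STPer.sl_apply] at this
    rw [ha, this, sub_zero, STPer.sl_apply]
  have hlψ : ∀ t ∈ Icc c d, SmPer.lap (STPer.sl t ψ) = STPer.sl t (θ - ϑ) := by
    intro t ht
    refine SmPer.ext' fun x => ?_
    have := h.mean_temperature_sub hr hs hs1 ht
    rw [SmPer.mean_apply] at this
    simp only [STPer.sl_apply] at this
    rw [hψ, this, sub_zero, STPer.sl_apply]
  let B : ℝ → Fin 3 → Fin 3 → SmPer := fun t j k =>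
    SmPer.D k (STPer.sl t (a j)) - SmPer.D j (STPer.sl t (a k))
  have hBanti : ∀ t j k, B t j k = -B t k j := fun t j k => (neg_sub _ _).symm
  have hwB : ∀ t ∈ Icc c d, ∀ j, STPer.sl t (v j - u j) = ∑ k, SmPer.D k (B t j k) := by
    intro t ht j
    rw [SmPer.sum_D_vorticity (fun j => STPer.sl t (a j)) (fun j => ?_) j, hla t ht]
    refine SmPer.D_eq_zero_of_lap hα0 hC0 hC ?_ j
    have hl3 : SmPer.lap (∑ i, SmPer.D i (STPer.sl t (a i))) =
        ∑ i, SmPer.lap (SmPer.D i (STPer.sl t (a i))) := by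
      simp only [Fin.sum_univ_three, SmPer.lap_add]
    rw [hl3]
    simp only [SmPer.lap_D, hla t ht, h.divfree_sub hr ht]
  have hconv : ∀ t ∈ Icc c d, ∀ g : SmPer, ∑ j, STPer.sl t (v j - u j) * SmPer.D j g =
      ∑ k, SmPer.D k (∑ j, B t j k * SmPer.D j g) := by
    intro t ht g
    rw [← SmPer.convection_antisymm (B t) (hBanti t)]
    exact Finset.sum_congr rfl fun j _ => by rw [hwB t ht]
  have hpres : ∀ r ∈ Icc c d, ∀ K, (∀ i j, HB l α 0 K (SmPer.D j (STPer.sl r (a i)))) →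
      (∀ j, HB l α 0 K (SmPer.D j (STPer.sl r ψ))) →
      ∃ ϖ : SmPer, (∀ i, SmPer.D i ϖ = SmPer.D i (STPer.sl r (p - q))) ∧
        HB l α 0 (C * (25 * (K * A + E))) ϖ := by
    intro r hr' K hKa hKψ
    have hK0 : 0 ≤ K := (hKψ 0).nonneg
    let F : Fin 3 → Fin 3 → SmPer := fun b k => (if k = 2 then SmPer.D b (STPer.sl r ψ) else 0) -
      STPer.sl r (R k b) - ∑ j, B r j b * SmPer.D j (STPer.sl r (v k + u k))
    have hF : SmPer.lap (STPer.sl r (p - q)) = SmPer.ddiv F := by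
      rw [h.lap_pressure_sub hr hcd hr', SmPer.ddiv, Finset.sum_comm]
      refine Finset.sum_congr rfl fun k _ => ?_
      rw [hconv r hr', ← hlψ r hr']
      simp only [SmPer.D_comm _ k, ← map_sum (SmPer.D k)]
      congr 1
      simp only [F, map_sub, Finset.sum_sub_distrib, SmPer.lap]
      congr 2
      split_ifs <;> simp
    refine ⟨STPer.sl r (p - q) - algebraMap ℝ SmPer (STPer.sl r (p - q) 0), fun i => ?_, ?_⟩
    · rw [map_sub, Derivation.map_algebraMap, sub_zero]
    · refine hC.hb hC0 hα0 ⟨0, sub_self _⟩ (F := F) ?_ fun b k => ?_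
      · rw [← hF, SmPer.lap, SmPer.lap]
        simp only [map_sub, Derivation.map_algebraMap, sub_zero]
      · refine (((HB.ite_zero _ (hKψ b)).sub (hR r hr' k b)).sub (HB.sum3 fun j =>
          ((hKa j b).sub (hKa b j)).mul (B' := A + A) ?_)).mono ?_
        · simp only [map_add]
          exact (hv r hr' j k).add (hu r hr' j k)
        · have hKA : K ≤ K * A := le_mul_of_one_le_right hK0 hA
          norm_num
          linarith
  have hforce : ∀ r ∈ Icc c d, ∀ K, (∀ i j, HB l α 0 K (SmPer.D j (STPer.sl r (a i)))) →
      (∀ j, HB l α 0 K (SmPer.D j (STPer.sl r ψ))) → ∀ i, ∃ F : Fin 3 → SmPer,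
        STPer.sl r (STPer.MD u (v i - u i)) = ∑ k, SmPer.D k (F k) ∧
        ∀ k, HB l α 0 (25 * (C + 1) * (K * A + E)) (F k) := by
    intro r hr' K hKa hKψ i
    have hK0 : 0 ≤ K := (hKψ 0).nonneg
    obtain ⟨ϖ, hϖ, hϖB⟩ := hpres r hr' K hKa hKψ
    refine ⟨fun k => (if i = 2 then SmPer.D k (STPer.sl r ψ) else 0) - (if k = i then ϖ else 0) -
      STPer.sl r (R i k) - ∑ j, B r j k * SmPer.D j (STPer.sl r (v i)), ?_, fun k => ?_⟩
    · rw [h.momentum_sub hr hr', hconv r hr', ← hϖ, ← hlψ r hr']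
      simp only [map_sub, Finset.sum_sub_distrib, SmPer.lap]
      congr 3
      · split_ifs <;> simp
      · simp [apply_ite]
    · refine ((((HB.ite_zero _ (hKψ k)).sub (HB.ite_zero _ hϖB)).sub (hR r hr' i k)).sub
        (HB.sum3 fun j => ((hKa j k).sub (hKa k j)).mul (hv r hr' j i))).mono ?_
      have hKA : K ≤ K * A := le_mul_of_one_le_right hK0 hA
      norm_num
      linarith
  have hforceT : ∀ r ∈ Icc c d, ∀ K, (∀ i j, HB l α 0 K (SmPer.D j (STPer.sl r (a i)))) →
      (∀ j, HB l α 0 K (SmPer.D j (STPer.sl r ψ))) → ∃ F : Fin 3 → SmPer,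
        STPer.sl r (STPer.MD u (θ - ϑ)) = ∑ k, SmPer.D k (F k) ∧
        ∀ k, HB l α 0 (25 * (C + 1) * (K * A + E)) (F k) := by
    intro r hr' K hKa hKψ
    have hK0 : 0 ≤ K := (hKψ 0).nonneg
    refine ⟨fun k => -STPer.sl r (T k) - ∑ j, B r j k * SmPer.D j (STPer.sl r θ), ?_,
      fun k => ?_⟩
    · rw [h.transport_sub hr hr', hconv r hr']
      simp only [map_sub, Finset.sum_sub_distrib, map_neg, Finset.sum_neg_distrib]
    · refine ((hT r hr' k).neg.sub
        (HB.sum3 fun j => ((hKa j k).sub (hKa k j)).mul (hθ r hr' j))).mono ?_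
      have : 0 ≤ K * A := by positivity
      have : 0 ≤ C * (K * A + E) := by positivity
      norm_num
      linarith
  set K := 12 * M₁ * τ * E with hK
  have hK0 : 0 < K := by positivity
  have step : ∀ (φ f : STPer), (∀ r ∈ Icc c d, SmPer.lap (STPer.sl r φ) = STPer.sl r f) →
      STPer.sl s f = 0 → ∀ t ∈ Icc c d,
      (∀ r ∈ uIcc s t, ∀ j, HB l α 0 K (SmPer.D j (STPer.sl r φ))) →
      (∀ r ∈ uIcc s t, ∃ F : Fin 3 → SmPer, STPer.sl r (STPer.MD u f) = ∑ k, SmPer.D k (F k) ∧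
        ∀ k, HB l α 0 (25 * (C + 1) * (K * A + E)) (F k)) →
      ∀ j, HB l α 0 (K / 2) (SmPer.D j (STPer.sl t φ)) := by
    intro φ f hφ hf t ht hKφ hF j
    have hsub : uIcc s t ⊆ Icc c d := uIcc_subset_Icc hs ht
    have hst : |s - t| ≤ τ := by
      rw [abs_sub_comm]; exact hdist t ht
    have hKA : 0 ≤ K * A := by positivity
    have hφs : SmPer.D j (STPer.sl s φ) = 0 :=
      SmPer.D_eq_zero_of_lap hα0 hC0 hC (by rw [hφ s hs, hf]) j
    refine (HB.of_hol_D hα0 (B := 3 * (0 + |s - t| * (C * (35 * (C + 1) * (K * A + E)))))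
      (by positivity) (transport_hol (v := u) (X := STPer.dx j φ) (s := s) (t := t) (b := A)
      (by linarith) (fun r hr i j x => (hu r (hsub hr) i j).sup x) ?_ hα0 hα1 le_rfl
      (by positivity) ?_ fun r hr' => ?_)).mono ?_
    · have : |s - t| * A ≤ τ * A := by gcongr
      nlinarith [mul_le_mul_of_nonneg_left hM₁1 (by positivity : 0 ≤ τ * A)]
    · rw [STPer.sl_dx, hφs]
      exact (HB.zero (l := l) (m := 0) le_rfl).hol
    · obtain ⟨F, hF1, hF2⟩ := hF r hr'
      have hdt : SmPer.lap (STPer.sl r (STPer.dt φ)) = STPer.sl r (STPer.dt f) := by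
        have := STPer.sl_dt_eq_zero hcd (X := ∑ i, STPer.dx i (STPer.dx i φ) - f) (fun t ht => by
          rw [map_sub, ← hφ t ht, sub_eq_zero]
          simp only [map_sum, STPer.sl_dx, SmPer.lap]) (hsub hr')
        simp only [STPer.dt_sub, STPer.dt_sum3, map_sub, map_sum, STPer.sl_dt_dx] at this
        exact sub_eq_zero.1 this
      have key := SmPer.lap_transport_potential (hr.divfree r (hsub hr'))
        (φ := STPer.sl r φ) (φ' := STPer.sl r (STPer.dt φ)) (F := F) (by
          rw [hdt, hφ r (hsub hr'), ← hF1, STPer.sl_MD]) j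
      rw [STPer.sl_MD, STPer.sl_dt_dx]
      refine hC _ _ _ key fun i k => HB.hol (l := l) (m := 0) ?_
      refine ((HB.ite_zero _ ((hF2 k).add (HB.sum3 fun i => (hu r (hsub hr') i k).mul
        (hKφ r hr' i)))).add (((hu r (hsub hr') k i).mul (hKφ r hr' j)).sub
        ((hu r (hsub hr') j i).mul (hKφ r hr' k)))).mono ?_
      have : 0 ≤ C * (K * A + E) := by positivity
      norm_num
      linarith
    · calc 3 * (0 + |s - t| * (C * (35 * (C + 1) * (K * A + E))))
          ≤ 3 * (0 + τ * ((C + 1) * (35 * (C + 1) * (K * A + E)))) := by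
            gcongr
            linarith
        _ = (τ * A * (12 * M₁)) * K * (1 / 4) + K / 4 := by rw [hM₁, hK]; ring
        _ ≤ 1 * K * (1 / 4) + K / 4 := by gcongr
        _ = K / 2 := by ring
  let X : Fin 3 × Option (Fin 3) → STPer := fun ι => STPer.dx ι.1 (ι.2.elim ψ a)
  have hφ0 : ∀ (φ f : STPer), (∀ r ∈ Icc c d, SmPer.lap (STPer.sl r φ) = STPer.sl r f) →
      STPer.sl s f = 0 → ∀ j, HB l α 0 (K / 2) (STPer.sl s (STPer.dx j φ)) := by
    intro φ f hφ hf j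
    rw [STPer.sl_dx, SmPer.D_eq_zero_of_lap hα0 hC0 hC (by rw [hφ s hs, hf]) j]
    exact HB.zero (by positivity)
  have hw0 : ∀ i, STPer.sl s (v i - u i) = 0 := fun i => by rw [map_sub, hs0, sub_self]
  have hη0 : STPer.sl s (θ - ϑ) = 0 := by rw [map_sub, hs1, sub_self]
  intro t ht
  have key := bootstrap (l := l) hα0 hα1 0 X (s := s) (T := t) hK0 (fun t' ht' hX => ?_)
    (fun ι => ?_) t right_mem_uIcc
  · have hKM : K ≤ 12 * M₁ * (τ * E) := by rw [hK]; linarith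
    exact ⟨fun i => STPer.sl t (a i), STPer.sl t ψ, hla t ht, hlψ t ht,
      fun i j => (key (j, some i)).mono hKM, fun j => (key (j, none)).mono hKM⟩
  · have hsub : uIcc s t' ⊆ Icc c d := (uIcc_subset_uIcc_left ht').trans
      (uIcc_subset_Icc hs ht)
    have hKa : ∀ r ∈ uIcc s t', ∀ i j, HB l α 0 K (SmPer.D j (STPer.sl r (a i))) :=
      fun r hr i j => hX r hr (j, some i)
    have hKψ : ∀ r ∈ uIcc s t', ∀ j, HB l α 0 K (SmPer.D j (STPer.sl r ψ)) :=
      fun r hr j => hX r hr (j, none)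
    rintro ⟨j, _ | i⟩
    · exact step ψ (θ - ϑ) hlψ hη0 t' (hsub right_mem_uIcc) hKψ
        (fun r hr => hforceT r (hsub hr) K (hKa r hr) (hKψ r hr)) j
    · exact step (a i) (v i - u i) (fun r hr => hla r hr i) (hw0 i) t' (hsub right_mem_uIcc)
        (fun r hr j => hKa r hr i j)
        (fun r hr => hforce r (hsub hr) K (hKa r hr) (hKψ r hr) i) j
  · rcases ι with ⟨j, _ | i⟩
    · exact hφ0 ψ (θ - ϑ) hlψ hη0 j
    · exact hφ0 (a i) (v i - u i) (fun r hr => hla r hr i) (hw0 i) j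

namespace SmPer

lemma invLap_eq {g f : SmPer} (h : lap f = g) (hf : mean f = 0) : invLap g = f := by
  funext x
  rw [← h, invLap_lap, ← mean_apply, hf, sub_zero]

lemma mean_lap (f : SmPer) : mean (lap f) = 0 := by
  simp only [lap, map_sum, mean_D, Finset.sum_const_zero]

lemma Rvex_eq {f ψ : SmPer} (h : lap ψ = f) (x : V3) (i : Fin 3) : Rvex f x i = D i ψ x := by
  have h1 : (fun z => f z - ∫ w in cube3, f w) = (lap ψ : SmPer) := by
    funext z
    rw [← mean_apply, ← h, mean_lap, sub_zero]
  have h2 : invLap (fun z => f z - ∫ w in cube3, f w) =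
      (ψ - algebraMap ℝ SmPer (mean ψ) : SmPer) := by
    funext z
    rw [h1, invLap_lap]
    rfl
  rw [Rvex, h2, ← D_apply, map_sub, Derivation.map_algebraMap, sub_zero]

lemma RopR_eq {w a : Fin 3 → SmPer} (hw : ∑ i, D i (w i) = 0) (h : ∀ i, lap (a i) = w i)
    (x : V3) (i j : Fin 3) :
    RopR (fun y k => w k y) x i j = D j (a i) x + D i (a j) x := by
  have h0 : nInv (fun _ : V3 => (0 : ℝ)) = fun _ => 0 := by
    funext y
    have := congrFun (invLap_eq (g := 0) (f := 0) (by simp [lap]) (map_zero mean)) y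
    simp only [nInv]
    rw [neg_eq_zero]
    exact this
  have hd : (fun y => divg (fun y k => w k y) y) = fun _ => 0 := by
    funext y
    have := congrArg (fun f : SmPer => f y) hw
    simp only [sum_apply] at this
    exact this
  have hp : ∀ k, pd (fun _ : V3 => (0 : ℝ)) k = fun _ => 0 := by
    intro k
    funext y
    simp [pd]
  have h1 : nInv (fun y => pd (fun z => w i z) j y + pd (fun z => w j z) i y) x =
      -(D j (a i) x + D i (a j) x) := by
    refine congrArg Neg.neg (congrFun (invLap_eq (g := D j (w i) + D i (w j))
      (f := D j (a i) + D i (a j)) ?_ ?_) x)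
    · rw [lap_add, lap_D, lap_D, h, h]
    · rw [map_add, mean_D, mean_D, add_zero]
  have hp' : ∀ k y, pd (fun _ : V3 => (0 : ℝ)) k y = 0 := fun k y => congrFun (hp k) y
  simp only [RopR, h1, hd, hp', h0, ite_self]
  ring

end SmPer

section IteratedDerivatives

variable {F G : Type*} [NormedAddCommGroup F] [NormedSpace ℝ F] [NormedAddCommGroup G]
  [NormedSpace ℝ G]

lemma norm_iteratedFDeriv_comp_left_le (L : F →L[ℝ] G) (hL : ‖L‖ ≤ 1) {g : V3 → F}
    (hg : ContDiff ℝ (⊤ : ℕ∞) g) (k : ℕ) (ε : ℝ) (x y : V3) :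
    ‖iteratedFDeriv ℝ k (fun z => L (g z)) x - ε • iteratedFDeriv ℝ k (fun z => L (g z)) y‖ ≤
      ‖iteratedFDeriv ℝ k g x - ε • iteratedFDeriv ℝ k g y‖ := by
  have h : ∀ z, iteratedFDeriv ℝ k (fun z => L (g z)) z =
      L.compContinuousMultilinearMap (iteratedFDeriv ℝ k g z) := fun z =>
    L.iteratedFDeriv_comp_left hg.contDiffAt (i := k) (by exact_mod_cast le_top)
  have h2 : iteratedFDeriv ℝ k (fun z => L (g z)) x - ε • iteratedFDeriv ℝ k (fun z => L (g z)) y =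
      L.compContinuousMultilinearMap (iteratedFDeriv ℝ k g x - ε • iteratedFDeriv ℝ k g y) := by
    rw [h, h]
    ext m
    simp
  rw [h2]
  refine (L.norm_compContinuousMultilinearMap_le _).trans ?_
  exact mul_le_of_le_one_left (norm_nonneg _) hL

lemma norm_iteratedFDeriv_sum_le (L : Fin 3 → ℝ →L[ℝ] F) (hL : ∀ i, ‖L i‖ ≤ 1)
    {h : Fin 3 → V3 → ℝ} (hh : ∀ i, ContDiff ℝ (⊤ : ℕ∞) (h i)) (k : ℕ) (ε : ℝ) (x y : V3) :
    ‖iteratedFDeriv ℝ k (fun z => ∑ i, L i (h i z)) x -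
      ε • iteratedFDeriv ℝ k (fun z => ∑ i, L i (h i z)) y‖ ≤
      ∑ i, ‖iteratedFDeriv ℝ k (h i) x - ε • iteratedFDeriv ℝ k (h i) y‖ := by
  have hs : iteratedFDeriv ℝ k (fun z => ∑ i, L i (h i z)) =
      ∑ i, iteratedFDeriv ℝ k (fun z => L i (h i z)) :=
    iteratedFDeriv_sum fun i _ => ((L i).contDiff.comp (hh i)).of_le (by exact_mod_cast le_top)
  rw [hs, Finset.sum_apply, Finset.sum_apply, Finset.smul_sum, ← Finset.sum_sub_distrib]
  exact (norm_sum_le _ _).trans (Finset.sum_le_sum fun i _ =>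
    norm_iteratedFDeriv_comp_left_le (L i) (hL i) (hh i) k ε x y)

lemma norm_iteratedFDeriv_succ (g : V3 → F) (k : ℕ) (ε : ℝ) (x y : V3) :
    ‖iteratedFDeriv ℝ (k + 1) g x - ε • iteratedFDeriv ℝ (k + 1) g y‖ =
      ‖iteratedFDeriv ℝ k (fderiv ℝ g) x - ε • iteratedFDeriv ℝ k (fderiv ℝ g) y‖ := by
  obtain ⟨e, h⟩ : ∃ e : (V3 [×k]→L[ℝ] V3 →L[ℝ] F) ≃ₗᵢ[ℝ] (V3 [×k + 1]→L[ℝ] F),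
      ∀ z, iteratedFDeriv ℝ (k + 1) g z = e (iteratedFDeriv ℝ k (fderiv ℝ g) z) :=
    ⟨(continuousMultilinearCurryRightEquiv' ℝ k V3 F).symm, fun z => by
      rw [iteratedFDeriv_succ_eq_comp_right]
      rfl⟩
  rw [h, h, ← e.map_smul, ← e.map_sub, e.norm_map]

lemma norm_iteratedFDeriv_zero_sub (g : V3 → F) (ε : ℝ) (x y : V3) :
    ‖iteratedFDeriv ℝ 0 g x - ε • iteratedFDeriv ℝ 0 g y‖ = ‖g x - ε • g y‖ := by
  rw [iteratedFDeriv_zero_eq_comp]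
  simp only [Function.comp_apply]
  rw [← map_smul, ← map_sub, LinearIsometryEquiv.norm_map]

lemma norm_proj_le (i : Fin 3) :
    ‖(ContinuousLinearMap.proj i : (Fin 3 → F) →L[ℝ] F)‖ ≤ 1 :=
  ContinuousLinearMap.opNorm_le_bound _ zero_le_one fun w => by
    simpa using norm_le_pi_norm w i

lemma SmPer.norm_iteratedFDeriv_succ_le (f : SmPer) (k : ℕ) (ε : ℝ) (x y : V3) :
    ‖iteratedFDeriv ℝ (k + 1) (f : V3 → ℝ) x - ε • iteratedFDeriv ℝ (k + 1) (f : V3 → ℝ) y‖ ≤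
      ∑ i, ‖iteratedFDeriv ℝ k (SmPer.D i f : V3 → ℝ) x -
        ε • iteratedFDeriv ℝ k (SmPer.D i f : V3 → ℝ) y‖ := by
  have h : fderiv ℝ (f : V3 → ℝ) = fun z => ∑ i, ContinuousLinearMap.toSpanSingleton ℝ
      (ContinuousLinearMap.proj (R := ℝ) (φ := fun _ : Fin 3 => ℝ) i) (SmPer.D i f z) := by
    funext z
    ext w
    rw [SmPer.fderiv_apply]
    simp [mul_comm]
  rw [norm_iteratedFDeriv_succ, h]
  refine norm_iteratedFDeriv_sum_le _ (fun i => ?_) (fun i => (SmPer.D i f).smooth) k ε x y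
  rw [ContinuousLinearMap.norm_toSpanSingleton]
  exact norm_proj_le i

lemma SmPer.norm_iteratedFDeriv_D_le (f : SmPer) (i : Fin 3) (k : ℕ) (ε : ℝ) (x y : V3) :
    ‖iteratedFDeriv ℝ k (SmPer.D i f : V3 → ℝ) x -
      ε • iteratedFDeriv ℝ k (SmPer.D i f : V3 → ℝ) y‖ ≤
    ‖iteratedFDeriv ℝ (k + 1) (f : V3 → ℝ) x - ε • iteratedFDeriv ℝ (k + 1) (f : V3 → ℝ) y‖ := by
  rw [norm_iteratedFDeriv_succ]
  refine norm_iteratedFDeriv_comp_left_le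
    (ContinuousLinearMap.apply ℝ ℝ (Pi.single i (1 : ℝ) : V3)) ?_
    (f.smooth.fderiv_right (m := (⊤ : ℕ∞)) (by simp)) k ε x y
  refine ContinuousLinearMap.opNorm_le_bound _ zero_le_one fun w => ?_
  rw [one_mul]
  refine (w.le_opNorm _).trans ?_
  rw [Pi.norm_single, norm_one, mul_one]

end IteratedDerivatives

namespace HB

variable {l α : ℝ} {m : ℕ} {B : ℝ} {f : SmPer}

lemma norm_iteratedFDeriv_le (hl : 0 < l) (h : HB l α m B f) {k : ℕ} (hk : k ≤ m) (x : V3) :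
    ‖iteratedFDeriv ℝ k (f : V3 → ℝ) x‖ ≤ 3 ^ k * (B / l ^ k) := by
  induction k generalizing f m B with
  | zero => simpa using h.sup x
  | succ k ih =>
    obtain ⟨m, rfl⟩ : ∃ m', m = m' + 1 := ⟨m - 1, by omega⟩
    have := f.norm_iteratedFDeriv_succ_le k 0 x x
    simp only [zero_smul, sub_zero] at this
    refine (this.trans (Finset.sum_le_sum fun i _ => ih (h.deriv hl i) (by omega))).trans_eq ?_
    rw [Finset.sum_const, Finset.card_fin, nsmul_eq_mul]
    field_simp
    push_cast
    ring

lemma norm_iteratedFDeriv_sub_le (hl : 0 < l) (h : HB l α m B f) {k : ℕ} (hk : k ≤ m) (x y : V3) :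
    ‖iteratedFDeriv ℝ k (f : V3 → ℝ) x - iteratedFDeriv ℝ k (f : V3 → ℝ) y‖ ≤
      3 ^ k * (B / l ^ k) * ‖x - y‖ ^ α := by
  induction k generalizing f m B with
  | zero =>
    have := norm_iteratedFDeriv_zero_sub (f : V3 → ℝ) 1 x y
    rw [one_smul, one_smul] at this
    rw [this]
    simpa using h.hol x y
  | succ k ih =>
    obtain ⟨m, rfl⟩ : ∃ m', m = m' + 1 := ⟨m - 1, by omega⟩
    have := f.norm_iteratedFDeriv_succ_le k 1 x y
    simp only [one_smul] at this
    refine (this.trans (Finset.sum_le_sum fun i _ => ih (h.deriv hl i) (by omega))).trans_eq ?_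
    rw [Finset.sum_const, Finset.card_fin, nsmul_eq_mul]
    field_simp
    push_cast
    ring

lemma of_iteratedFDeriv (hl : 0 < l)
    (h : ∀ k ≤ m, (∀ x, ‖iteratedFDeriv ℝ k (f : V3 → ℝ) x‖ ≤ B / l ^ k) ∧
      ∀ x y, ‖iteratedFDeriv ℝ k (f : V3 → ℝ) x - iteratedFDeriv ℝ k (f : V3 → ℝ) y‖ ≤
        B / l ^ k * ‖x - y‖ ^ α) : HB l α m B f := by
  induction m generalizing f B with
  | zero =>
    refine ⟨fun x => by simpa using (h 0 le_rfl).1 x, fun x y => ?_⟩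
    have := norm_iteratedFDeriv_zero_sub (f : V3 → ℝ) 1 x y
    rw [one_smul, one_smul] at this
    simpa [this] using (h 0 le_rfl).2 x y
  | succ m ih =>
    refine ⟨⟨fun x => by simpa using (h 0 (by omega)).1 x, fun x y => ?_⟩, fun i => ?_⟩
    · have := norm_iteratedFDeriv_zero_sub (f : V3 → ℝ) 1 x y
      rw [one_smul, one_smul] at this
      simpa [this] using (h 0 (by omega)).2 x y
    · refine ((ih (f := SmPer.D i f) (B := B / l) fun k hk => ?_).smul l).mono
        (by rw [abs_of_pos hl, mul_div_cancel₀ _ hl.ne'])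
      have e : B / l / l ^ k = B / l ^ (k + 1) := by rw [div_div, pow_succ']
      rw [e]
      constructor
      · intro x
        have := f.norm_iteratedFDeriv_D_le i k 0 x x
        simp only [zero_smul, sub_zero] at this
        exact this.trans ((h (k + 1) (by omega)).1 x)
      · intro x y
        have := f.norm_iteratedFDeriv_D_le i k 1 x y
        simp only [one_smul] at this
        exact this.trans ((h (k + 1) (by omega)).2 x y)

lemma of_norm_iteratedFDeriv_le (hl : 0 < l) (hl1 : l ≤ 1) (hα0 : 0 ≤ α) (hα1 : α ≤ 1)
    (h : ∀ k ≤ m + 1, ∀ x, ‖iteratedFDeriv ℝ k (f : V3 → ℝ) x‖ ≤ B / l ^ k) :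
    HB l α m (3 * B * l ^ (-α)) f := by
  have base : ∀ {f : SmPer} {B : ℝ}, (∀ k ≤ 1, ∀ x,
      ‖iteratedFDeriv ℝ k (f : V3 → ℝ) x‖ ≤ B / l ^ k) →
      (∀ x, |f x| ≤ 3 * B * l ^ (-α)) ∧ Hol α (3 * B * l ^ (-α)) f := by
    intro f B h
    have h0 : ∀ x, |f x| ≤ B := fun x => by simpa using h 0 zero_le_one x
    refine ⟨fun x => (h0 x).trans ?_, SmPer.hol_of_bounds hl hα0 hα1 h0 fun i x => ?_⟩
    · have h1 : 1 ≤ l ^ (-α) := Real.one_le_rpow_of_pos_of_le_one_of_nonpos hl hl1 (by linarith)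
      have h2 : 0 ≤ B := (abs_nonneg _).trans (h0 0)
      nlinarith [mul_le_mul_of_nonneg_left h1 h2]
    · have := f.norm_iteratedFDeriv_D_le i 0 0 x x
      simp only [zero_smul, sub_zero, norm_iteratedFDeriv_zero] at this
      simpa using this.trans (h 1 le_rfl x)
  induction m generalizing f B with
  | zero => exact base h
  | succ m ih =>
    refine ⟨base fun k hk => h k (by omega), fun i => ?_⟩
    refine ((ih (f := SmPer.D i f) (B := B / l) fun k hk x => ?_).smul l).mono ?_
    · have := f.norm_iteratedFDeriv_D_le i k 0 x x
      simp only [zero_smul, sub_zero] at this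
      rw [div_div, ← pow_succ']
      exact this.trans (h (k + 1) (by omega) x)
    · rw [abs_of_pos hl]
      field_simp
      exact le_rfl

end HB

lemma CNaB.of_HB {l α B K : ℝ} {m N : ℕ} {f : SmPer} (hl : 0 < l) (hl1 : l ≤ 1)
    (h : HB l α m B f) (hN : N ≤ m) (hK : 3 ^ N * (B / l ^ N) ≤ K) : CNaB N α K f := by
  have hB := h.nonneg
  refine ⟨fun k hk x => (h.norm_iteratedFDeriv_le hl (hk.trans hN) x).trans (le_trans ?_ hK),
    fun x y => (h.norm_iteratedFDeriv_sub_le hl hN x y).trans (by gcongr)⟩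
  have h1 : (3 : ℝ) ^ k ≤ 3 ^ N := pow_le_pow_right₀ (by norm_num) hk
  have h2 : l ^ N ≤ l ^ k := pow_le_pow_of_le_one hl.le hl1 hk
  gcongr

lemma CNaB.of_components {α K : ℝ} {N : ℕ} {f : Fin 3 → SmPer} (h : ∀ i, CNaB N α K (f i)) :
    CNaB N α (3 * K) (fun x => (fun i => f i x : V3)) := by
  have hf : (fun x => (fun i => f i x : V3)) = fun z => ∑ i,
      ContinuousLinearMap.toSpanSingleton ℝ (Pi.single i (1 : ℝ) : V3) (f i z) := by
    funext z
    ext j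
    simp [Finset.sum_apply, Pi.single_apply]
  have key := norm_iteratedFDeriv_sum_le
    (fun i => ContinuousLinearMap.toSpanSingleton ℝ (Pi.single i (1 : ℝ) : V3))
    (fun i => by rw [ContinuousLinearMap.norm_toSpanSingleton, Pi.norm_single, norm_one])
    (fun i => (f i).smooth)
  rw [hf]
  constructor
  · intro k hk x
    have := key k 0 x x
    simp only [zero_smul, sub_zero] at this
    refine (this.trans (Finset.sum_le_sum fun i _ => (h i).1 k hk x)).trans_eq ?_
    simp
  · intro x y
    have := key N 1 x y
    simp only [one_smul] at this
    refine (this.trans (Finset.sum_le_sum fun i _ => (h i).2 x y)).trans_eq ?_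
    simp [mul_assoc]

lemma CNaB.comp_left {F G : Type*} [NormedAddCommGroup F] [NormedSpace ℝ F]
    [NormedAddCommGroup G] [NormedSpace ℝ G] {α K : ℝ} {N : ℕ} {g : V3 → F}
    (hg : ContDiff ℝ (⊤ : ℕ∞) g) (h : CNaB N α K g) (L : F →L[ℝ] G) (hL : ‖L‖ ≤ 1) :
    CNaB N α K (fun x => L (g x)) := by
  constructor
  · intro k hk x
    have := norm_iteratedFDeriv_comp_left_le L hL hg k 0 x x
    simp only [zero_smul, sub_zero] at this
    exact this.trans (h.1 k hk x)
  · intro x y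
    have := norm_iteratedFDeriv_comp_left_le L hL hg N 1 x y
    simp only [one_smul] at this
    exact this.trans (h.2 x y)

lemma CNaB.zero_iff {F : Type*} [NormedAddCommGroup F] [NormedSpace ℝ F] {α K : ℝ} {g : V3 → F} :
    CNaB 0 α K g ↔ (∀ x, ‖g x‖ ≤ K) ∧ ∀ x y, ‖g x - g y‖ ≤ K * ‖x - y‖ ^ α := by
  have h : ∀ x y, ‖iteratedFDeriv ℝ 0 g x - iteratedFDeriv ℝ 0 g y‖ = ‖g x - g y‖ := by
    intro x y
    have := norm_iteratedFDeriv_zero_sub g 1 x y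
    simpa only [one_smul] using this
  simp only [CNaB, h, Nat.le_zero, forall_eq, norm_iteratedFDeriv_zero]

lemma CNaB.zero_pi {F : Type*} [NormedAddCommGroup F] [NormedSpace ℝ F] {α K : ℝ}
    {g : V3 → Fin 3 → F} (h : ∀ i, CNaB 0 α K (fun x => g x i)) : CNaB 0 α K g := by
  simp only [CNaB.zero_iff] at h ⊢
  have hK : 0 ≤ K := (norm_nonneg _).trans ((h 0).1 0)
  exact ⟨fun x => (pi_norm_le_iff_of_nonneg hK).2 fun i => (h i).1 x,
    fun x y => (pi_norm_le_iff_of_nonneg (by positivity)).2 fun i => (h i).2 x y⟩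

lemma HB.cNaB_zero {l α B : ℝ} {f : SmPer} (h : HB l α 0 B f) : CNaB 0 α B f :=
  CNaB.zero_iff.2 h

/-- The stability estimates for the smooth periodic fields, with abstract parameters. -/
theorem exists_stability_bound {α : ℝ} (hα0 : 0 < α) (hα1 : α < 1) (m : ℕ) {C₁ : ℝ} (hC₁ : 0 < C₁) :
    ∃ ε > 0, ∃ K > 0, ∀ {l D τ δ s : ℝ} {v u : Fin 3 → STPer} {θ ϑ p q : STPer}
      {R : Fin 3 → Fin 3 → STPer} {T : Fin 3 → STPer},
      0 < l → l ≤ 1 → 1 ≤ D → 0 < τ → 0 < δ → l ^ α ≤ ε → τ * D = l ^ (2 * α) →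
      BoussinesqOn (Icc (s - τ) (s + τ)) v θ p 0 0 →
      BoussinesqOn (Icc (s - τ) (s + τ)) u ϑ q R T →
      (∀ t ∈ Icc (s - τ) (s + τ), ∀ i j,
        HB l α m (3 * (C₁ * D) * l ^ (-α)) (SmPer.D i (STPer.sl t (u j)))) →
      (∀ t ∈ Icc (s - τ) (s + τ), ∀ i,
        HB l α m (3 * (C₁ * D) * l ^ (-α)) (SmPer.D i (STPer.sl t ϑ))) →
      (∀ t ∈ Icc (s - τ) (s + τ), ∀ i j, HB l α (m + 1) (C₁ * δ) (STPer.sl t (R i j))) →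
      (∀ t ∈ Icc (s - τ) (s + τ), ∀ i, HB l α (m + 1) (C₁ * δ) (STPer.sl t (T i))) →
      (∀ i, STPer.sl s (v i) = STPer.sl s (u i)) → STPer.sl s θ = STPer.sl s ϑ →
      ∀ t ∈ Icc (s - τ) (s + τ),
        ((∀ i, HB l α m (K * (τ * (δ / l))) (STPer.sl t (v i - u i))) ∧
          HB l α m (K * (τ * (δ / l))) (STPer.sl t (θ - ϑ))) ∧
        (∀ i, HB l α m (K * (δ / l)) (SmPer.D i (STPer.sl t (p - q)))) ∧
        ((∀ i, HB l α m (K * (δ / l)) (STPer.sl t (STPer.MD u (v i - u i)))) ∧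
          HB l α m (K * (δ / l)) (STPer.sl t (STPer.MD u (θ - ϑ)))) ∧
        ∃ (a : Fin 3 → SmPer) (ψ : SmPer),
          (∀ i, SmPer.lap (a i) = STPer.sl t (v i - u i)) ∧ SmPer.lap ψ = STPer.sl t (θ - ϑ) ∧
          (∀ i j, HB l α 0 (K * (τ * δ)) (SmPer.D j (a i))) ∧
          ∀ j, HB l α 0 (K * (τ * δ)) (SmPer.D j ψ) := by
  obtain ⟨C, hC0, hC⟩ := exists_schauderConst hα0 hα1
  obtain ⟨M₀, hM₀, hgrad⟩ := exists_gradient_bound hα0.le hα1.le hC0 hC m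
  obtain ⟨M₁, hM₁, hdiff⟩ := exists_difference_bound hα0.le hα1.le hC0 hC m
  obtain ⟨M₂, hM₂, hpot⟩ := exists_potential_bound hα0.le hα1.le hC0 hC
  refine ⟨1 / (3 * (C₁ + 1) * (M₀ + 12 * M₁ + 12 * M₂)), by positivity, (M₁ + M₂) * C₁,
    by positivity, ?_⟩
  intro l D τ δ s v u θ ϑ p q R T hl hl1 hD hτ hδ hε hτD h hr hu hϑ hR hT hs0 hs1 t ht
  set A : ℝ := 3 * (C₁ + 1) * D * l ^ (-α) with hA
  have hlα : 1 ≤ l ^ (-α) := Real.one_le_rpow_of_pos_of_le_one_of_nonpos hl hl1 (by linarith)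
  have hDl : 1 ≤ D * l ^ (-α) := one_le_mul_of_one_le_of_one_le hD hlα
  have hA1 : 1 ≤ A := by
    rw [hA, mul_assoc]
    exact one_le_mul_of_one_le_of_one_le (by linarith) hDl
  have hτA : τ * A * (M₀ + 12 * M₁ + 12 * M₂) ≤ 1 := by
    have e : τ * A = 3 * (C₁ + 1) * l ^ α := by
      have : l ^ α = l ^ (2 * α) * l ^ (-α) := by
        rw [← Real.rpow_add hl]
        ring_nf
      rw [this, ← hτD, hA]
      ring
    rw [e]
    calc 3 * (C₁ + 1) * l ^ α * (M₀ + 12 * M₁ + 12 * M₂)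
        ≤ 3 * (C₁ + 1) * (1 / (3 * (C₁ + 1) * (M₀ + 12 * M₁ + 12 * M₂))) *
          (M₀ + 12 * M₁ + 12 * M₂) := by gcongr
      _ = 1 := by field_simp
  have hτA0 : 0 < τ * A := by positivity
  have hAle : 3 * (C₁ * D) * l ^ (-α) ≤ A := by
    rw [hA]
    nlinarith
  have hcd : s - τ < s + τ := by linarith
  have hs : s ∈ Icc (s - τ) (s + τ) := ⟨by linarith, by linarith⟩
  have hdist : ∀ t ∈ Icc (s - τ) (s + τ), |t - s| ≤ τ := fun t ht =>
    abs_le.2 ⟨by linarith [ht.1], by linarith [ht.2]⟩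
  have hv := hgrad hcd h hA1 hs (fun t ht => by
      have : |t - s| * A * M₀ ≤ τ * A * M₀ := by
        have := hdist t ht
        gcongr
      nlinarith [mul_pos hτA0 hM₁, mul_pos hτA0 hM₂])
    (fun i j => by rw [hs0]; exact (hu s hs i j).mono hAle)
    (fun i => by rw [hs1]; exact (hϑ s hs i).mono hAle)
  have hu' : ∀ t ∈ Icc (s - τ) (s + τ), ∀ i j, HB l α m (12 * A) (SmPer.D i (STPer.sl t (u j))) :=
    fun t ht i j => (hu t ht i j).mono (by linarith)
  have hE : 0 < C₁ * δ := by positivity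
  obtain ⟨⟨h1, h2⟩, h3, h4, h5⟩ := hdiff hl hcd h hr (by linarith : 1 ≤ 12 * A) hE hτ hs hdist
    (by nlinarith [mul_pos hτA0 hM₀, mul_pos hτA0 hM₂]) (fun t ht => (hv t ht).1) hu'
    (fun t ht => (hv t ht).2) hR hT hs0 hs1 t ht
  obtain ⟨a, ψ, ha, hψ, h6, h7⟩ := hpot (l := l) hcd h hr (by linarith : 1 ≤ 12 * A) hE hτ hs hdist
    (by nlinarith [mul_pos hτA0 hM₀, mul_pos hτA0 hM₁]) (fun t ht i j => ((hv t ht).1 i j).base)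
    (fun t ht i j => (hu' t ht i j).base) (fun t ht i => ((hv t ht).2 i).base)
    (fun t ht i j => (hR t ht i j).base) (fun t ht i => (hT t ht i).base) hs0 hs1 t ht
  have e1 : M₁ * (τ * (C₁ * δ / l)) ≤ (M₁ + M₂) * C₁ * (τ * (δ / l)) := by
    have : 0 ≤ M₂ * C₁ * (τ * (δ / l)) := by positivity
    calc M₁ * (τ * (C₁ * δ / l)) = M₁ * C₁ * (τ * (δ / l)) := by ring
      _ ≤ _ := by linarith
  have e2 : M₁ * (C₁ * δ / l) ≤ (M₁ + M₂) * C₁ * (δ / l) := by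
    have : 0 ≤ M₂ * C₁ * (δ / l) := by positivity
    calc M₁ * (C₁ * δ / l) = M₁ * C₁ * (δ / l) := by ring
      _ ≤ _ := by linarith
  have e3 : M₂ * (τ * (C₁ * δ)) ≤ (M₁ + M₂) * C₁ * (τ * δ) := by
    have : 0 ≤ M₁ * C₁ * (τ * δ) := by positivity
    linarith
  exact ⟨⟨fun i => (h1 i).mono e1, h2.mono e1⟩, fun i => (h3 i).mono e2,
    ⟨fun i => (h4 i).mono e2, h5.mono e2⟩, a, ψ, ha, hψ, fun i j => (h6 i j).mono e3,
    fun j => (h7 j).mono e3⟩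

namespace ClassicalOn

variable {I : Set ℝ} {v : ℝ → V3 → V3} {θ p : ℝ → V3 → ℝ}

/-- The velocity components of a classical solution. -/
def vel (h : ClassicalOn I v θ p) (i : Fin 3) : STPer :=
  ⟨fun q => v q.1 q.2 i, contDiff_pi.1 h.smooth.fst i, fun t x k => congrFun (h.perv t x k) i⟩

/-- The temperature of a classical solution. -/
def temp (h : ClassicalOn I v θ p) : STPer :=
  ⟨fun q => θ q.1 q.2, h.smooth.snd.fst, h.perθ⟩

/-- The pressure of a classical solution. -/
def press (h : ClassicalOn I v θ p) : STPer :=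
  ⟨fun q => p q.1 q.2, h.smooth.snd.snd, h.perp⟩

lemma boussinesqOn (h : ClassicalOn I v θ p) : BoussinesqOn I h.vel h.temp h.press 0 0 where
  momentum t ht i := SmPer.ext' fun x => by
    have := h.momentum t ht x i
    rw [STPer.sl_MD]
    simp only [Pi.zero_apply, map_zero, Finset.sum_const_zero, add_zero, SmPer.add_apply,
      SmPer.sum_apply, SmPer.sub_apply, SmPer.mul_apply]
    have e : (if i = 2 then STPer.sl t h.temp else 0 : SmPer) x = if i = 2 then θ t x else 0 := by
      split_ifs <;> rfl
    rw [e]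
    exact eq_sub_of_add_eq this
  transport t ht := SmPer.ext' fun x => by
    rw [STPer.sl_MD]
    simp only [Pi.zero_apply, map_zero, Finset.sum_const_zero, SmPer.add_apply,
      SmPer.sum_apply, SmPer.mul_apply]
    exact h.transport t ht x
  divfree t ht := SmPer.ext' fun x => by
    rw [SmPer.sum_apply]
    exact h.divfree t ht x

end ClassicalOn

namespace RelaxedOn

variable {I : Set ℝ} {v : ℝ → V3 → V3} {θ p : ℝ → V3 → ℝ} {R : ℝ → V3 → Fin 3 → Fin 3 → ℝ}
  {T : ℝ → V3 → V3}

/-- The velocity components of a relaxed solution. -/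
def vel (h : RelaxedOn I v θ p R T) (i : Fin 3) : STPer :=
  ⟨fun q => v q.1 q.2 i, contDiff_pi.1 h.smooth.fst i, fun t x k => congrFun (h.perv t x k) i⟩

/-- The temperature of a relaxed solution. -/
def temp (h : RelaxedOn I v θ p R T) : STPer :=
  ⟨fun q => θ q.1 q.2, h.smooth.snd.fst, h.perθ⟩

/-- The pressure of a relaxed solution. -/
def press (h : RelaxedOn I v θ p R T) : STPer :=
  ⟨fun q => p q.1 q.2, h.smooth.snd.snd.fst, h.perp⟩

/-- The components of the Reynolds stress. -/
def stress (h : RelaxedOn I v θ p R T) (i j : Fin 3) : STPer :=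
  ⟨fun q => R q.1 q.2 i j, contDiff_pi.1 (contDiff_pi.1 h.smooth.snd.snd.snd.fst i) j,
    fun t x k => congrFun (congrFun (h.perR t x k) i) j⟩

/-- The components of the temperature stress. -/
def flux (h : RelaxedOn I v θ p R T) (i : Fin 3) : STPer :=
  ⟨fun q => T q.1 q.2 i, contDiff_pi.1 h.smooth.snd.snd.snd.snd i,
    fun t x k => congrFun (h.perT t x k) i⟩

lemma boussinesqOn (h : RelaxedOn I v θ p R T) :
    BoussinesqOn I h.vel h.temp h.press h.stress h.flux where
  momentum t ht i := SmPer.ext' fun x => by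
    have hm := h.momentum t ht x i
    have hd : ∑ j, SmPer.D j (STPer.sl t (h.vel j)) = 0 := SmPer.ext' fun x => by
      rw [SmPer.sum_apply]
      exact h.divfree t ht x
    have hc : ∑ j, STPer.sl t (h.vel j) * SmPer.D j (STPer.sl t (h.vel i)) =
        ∑ j, SmPer.D j (STPer.sl t (h.vel j) * STPer.sl t (h.vel i)) := by
      simp only [Derivation.leibniz, smul_eq_mul, Finset.sum_add_distrib]
      rw [← Finset.mul_sum, hd, mul_zero, add_zero]
    rw [STPer.sl_MD, hc]
    simp only [SmPer.add_apply, SmPer.sum_apply, SmPer.sub_apply]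
    have e : (if i = 2 then STPer.sl t h.temp else 0 : SmPer) x = if i = 2 then θ t x else 0 := by
      split_ifs <;> rfl
    rw [e]
    refine (eq_sub_of_add_eq hm).trans ?_
    rw [add_sub_right_comm]
    rfl
  transport t ht := SmPer.ext' fun x => by
    rw [STPer.sl_MD]
    simp only [SmPer.add_apply, SmPer.sum_apply, SmPer.mul_apply]
    exact h.transport t ht x
  divfree t ht := SmPer.ext' fun x => by
    rw [SmPer.sum_apply]
    exact h.divfree t ht x

lemma contDiff_stress (h : RelaxedOn I v θ p R T) (t : ℝ) : ContDiff ℝ (⊤ : ℕ∞) (R t) :=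
  h.smooth.snd.snd.snd.fst.comp (contDiff_const.prodMk contDiff_id)

lemma contDiff_flux (h : RelaxedOn I v θ p R T) (t : ℝ) : ContDiff ℝ (⊤ : ℕ∞) (T t) :=
  h.smooth.snd.snd.snd.snd.comp (contDiff_const.prodMk contDiff_id)

lemma contDiff_velocity (h : RelaxedOn I v θ p R T) (t : ℝ) : ContDiff ℝ (⊤ : ℕ∞) (v t) :=
  h.smooth.fst.comp (contDiff_const.prodMk contDiff_id)

end RelaxedOn

lemma BoussinesqOn.mono {I J : Set ℝ} {v : Fin 3 → STPer} {θ p : STPer} {R : Fin 3 → Fin 3 → STPer}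
    {T : Fin 3 → STPer} (h : BoussinesqOn J v θ p R T) (hIJ : I ⊆ J) : BoussinesqOn I v θ p R T :=
  ⟨fun t ht => h.momentum t (hIJ ht), fun t ht => h.transport t (hIJ ht),
    fun t ht => h.divfree t (hIJ ht)⟩

section Parameters

variable {a b β α : ℝ}

lemma le_lamP (ha : 1 ≤ a) (hb : 1 ≤ b) (q : ℕ) : a ≤ lamP a b q := by
  refine le_trans ?_ (Int.le_ceil _)
  exact Real.self_le_rpow_of_one_le ha (one_le_pow₀ hb)

lemma lamP_le_succ (ha : 1 ≤ a) (hb : 1 ≤ b) (q : ℕ) : lamP a b q ≤ lamP a b (q + 1) := by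
  refine Int.cast_le.2 (Int.ceil_mono (Real.rpow_le_rpow_of_exponent_le ha ?_))
  exact pow_le_pow_right₀ hb (Nat.le_succ q)

lemma delP_pos (ha : 1 ≤ a) (hb : 1 ≤ b) (q : ℕ) : 0 < delP a b β q := by
  have h : ∀ q, 0 < lamP a b q := fun q => by linarith [le_lamP ha hb q]
  exact mul_pos (Real.rpow_pos_of_pos (h 2) _) (Real.rpow_pos_of_pos (h q) _)

lemma delP_succ_le (ha : 1 ≤ a) (hb : 1 ≤ b) (hβ : 0 ≤ β) (q : ℕ) :
    delP a b β (q + 1) ≤ delP a b β q := by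
  have h : ∀ q, 0 < lamP a b q := fun q => by linarith [le_lamP ha hb q]
  exact mul_le_mul_of_nonneg_left (Real.rpow_le_rpow_of_nonpos (h q) (lamP_le_succ ha hb q)
    (by linarith)) (Real.rpow_nonneg (h 2).le _)

lemma one_le_delP_mul_lamP (ha : 1 ≤ a) (hb : 1 ≤ b) (hβ0 : 0 ≤ β) (hβ1 : β ≤ 1) (q : ℕ) :
    1 ≤ delP a b β q ^ ((1 : ℝ) / 2) * lamP a b q := by
  have h : ∀ q, 1 ≤ lamP a b q := fun q => ha.trans (le_lamP ha hb q)
  have h0 : 0 < lamP a b q := by linarith [h q]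
  have h1 : lamP a b q ^ (-(2 * β)) ≤ delP a b β q :=
    le_mul_of_one_le_left (Real.rpow_nonneg h0.le _)
      (Real.one_le_rpow (h 2) (by positivity))
  calc (1 : ℝ) ≤ lamP a b q ^ (1 - β) := Real.one_le_rpow (h q) (by linarith)
    _ = (lamP a b q ^ (-(2 * β))) ^ ((1 : ℝ) / 2) * lamP a b q := by
        rw [← Real.rpow_mul h0.le, ← Real.rpow_add_one h0.ne']
        congr 1
        ring
    _ ≤ _ := by gcongr

lemma ellP_pos (ha : 1 ≤ a) (hb : 1 ≤ b) (q : ℕ) : 0 < ellP a b β α q := by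
  have h : 0 < lamP a b q := by linarith [le_lamP ha hb q]
  exact div_pos (div_pos (Real.rpow_pos_of_pos (delP_pos ha hb _) _)
    (Real.rpow_pos_of_pos (delP_pos ha hb _) _)) (Real.rpow_pos_of_pos h _)

lemma ellP_le (ha : 1 ≤ a) (hb : 1 ≤ b) (hβ : 0 ≤ β) (hα : 0 ≤ α) (q : ℕ) :
    ellP a b β α q ≤ a⁻¹ := by
  have h1 : delP a b β (q + 1) ^ ((1 : ℝ) / 2) / delP a b β q ^ ((1 : ℝ) / 2) ≤ 1 :=
    div_le_one_of_le₀ (Real.rpow_le_rpow (delP_pos ha hb _).le (delP_succ_le ha hb hβ q)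
      (by norm_num)) (Real.rpow_nonneg (delP_pos ha hb _).le _)
  have h2 : a ≤ lamP a b q ^ (1 + 3 * α / 2) := (le_lamP ha hb q).trans
    (Real.self_le_rpow_of_one_le (ha.trans (le_lamP ha hb q)) (by linarith))
  rw [ellP, ← one_div]
  gcongr

lemma tauP_mul (ha : 1 ≤ a) (hb : 1 ≤ b) (hβ0 : 0 ≤ β) (hβ1 : β ≤ 1) (q : ℕ) :
    tauP a b β α q * (delP a b β q ^ ((1 : ℝ) / 2) * lamP a b q) = ellP a b β α q ^ (2 * α) :=
  div_mul_cancel₀ _ (by linarith [one_le_delP_mul_lamP ha hb hβ0 hβ1 q])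

lemma tauP_pos (ha : 1 ≤ a) (hb : 1 ≤ b) (hβ0 : 0 ≤ β) (hβ1 : β ≤ 1) (q : ℕ) :
    0 < tauP a b β α q :=
  div_pos (Real.rpow_pos_of_pos (ellP_pos ha hb q) _)
    (by linarith [one_le_delP_mul_lamP ha hb hβ0 hβ1 q])

lemma ellP_rpow_le (ha : 1 ≤ a) (hb : 1 ≤ b) (hβ : 0 ≤ β) (hα : 0 < α) {ε : ℝ} (hε : 0 < ε)
    (haε : ε⁻¹ ^ α⁻¹ ≤ a) (q : ℕ) : ellP a b β α q ^ α ≤ ε := by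
  calc ellP a b β α q ^ α ≤ a⁻¹ ^ α :=
        Real.rpow_le_rpow (ellP_pos ha hb q).le (ellP_le ha hb hβ hα.le q) hα.le
    _ ≤ ((ε⁻¹ ^ α⁻¹)⁻¹) ^ α := by gcongr
    _ = ε := by
        rw [Real.inv_rpow (by positivity), Real.rpow_inv_rpow (by positivity) hα.ne', inv_inv]

end Parameters

namespace RelaxedOn

variable {I : Set ℝ} {v : ℝ → V3 → V3} {θ p : ℝ → V3 → ℝ} {R : ℝ → V3 → Fin 3 → Fin 3 → ℝ}
  {T : ℝ → V3 → V3} {l α B : ℝ} {m : ℕ} {t : ℝ}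

lemma HB_D_temp (h : RelaxedOn I v θ p R T) (hl : 0 < l) (hl1 : l ≤ 1) (hα0 : 0 ≤ α) (hα1 : α ≤ 1)
    (hB : ∀ k ≤ m + 1, ∀ x, ‖iteratedFDeriv ℝ (k + 1) (θ t) x‖ ≤ B / l ^ k) (i : Fin 3) :
    HB l α m (3 * B * l ^ (-α)) (SmPer.D i (STPer.sl t h.temp)) := by
  refine HB.of_norm_iteratedFDeriv_le hl hl1 hα0 hα1 fun k hk x => ?_
  have := (STPer.sl t h.temp).norm_iteratedFDeriv_D_le i k 0 x x
  simp only [zero_smul, sub_zero] at this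
  exact this.trans (hB k hk x)

lemma HB_D_vel (h : RelaxedOn I v θ p R T) (hl : 0 < l) (hl1 : l ≤ 1) (hα0 : 0 ≤ α) (hα1 : α ≤ 1)
    (hB : ∀ k ≤ m + 1, ∀ x, ‖iteratedFDeriv ℝ (k + 1) (v t) x‖ ≤ B / l ^ k) (i j : Fin 3) :
    HB l α m (3 * B * l ^ (-α)) (SmPer.D i (STPer.sl t (h.vel j))) := by
  refine HB.of_norm_iteratedFDeriv_le hl hl1 hα0 hα1 fun k hk x => ?_
  have h1 := (STPer.sl t (h.vel j)).norm_iteratedFDeriv_D_le i k 0 x x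
  have h2 := norm_iteratedFDeriv_comp_left_le
    (ContinuousLinearMap.proj (R := ℝ) (φ := fun _ : Fin 3 => ℝ) j) (norm_proj_le j)
    (h.contDiff_velocity t) (k + 1) 0 x x
  simp only [zero_smul, sub_zero] at h1 h2
  exact (h1.trans h2).trans (hB k hk x)

lemma HB_stress (h : RelaxedOn I v θ p R T) (hl : 0 < l)
    (hB : ∀ k ≤ m, CNaB k α (B / l ^ k) (R t)) (i j : Fin 3) :
    HB l α m B (STPer.sl t (h.stress i j)) := by
  refine HB.of_iteratedFDeriv hl fun k hk => ?_
  have := ((hB k hk).comp_left (h.contDiff_stress t) (ContinuousLinearMap.proj (R := ℝ)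
    (φ := fun _ : Fin 3 => Fin 3 → ℝ) i) (norm_proj_le i)).comp_left
    (contDiff_pi.1 (h.contDiff_stress t) i)
    (ContinuousLinearMap.proj (R := ℝ) (φ := fun _ : Fin 3 => ℝ) j) (norm_proj_le j)
  exact ⟨this.1 k le_rfl, this.2⟩

lemma HB_flux (h : RelaxedOn I v θ p R T) (hl : 0 < l)
    (hB : ∀ k ≤ m, CNaB k α (B / l ^ k) (T t)) (i : Fin 3) :
    HB l α m B (STPer.sl t (h.flux i)) := by
  refine HB.of_iteratedFDeriv hl fun k hk => ?_
  have := (hB k hk).comp_left (h.contDiff_flux t) (ContinuousLinearMap.proj (R := ℝ)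
    (φ := fun _ : Fin 3 => ℝ) i) (norm_proj_le i)
  exact ⟨this.1 k le_rfl, this.2⟩

end RelaxedOn

lemma rpow_neg_natCast_add {l : ℝ} (hl : 0 < l) (k : ℕ) (c : ℝ) :
    l ^ (-(k : ℝ) + c) = l ^ c / l ^ k := by
  rw [add_comm, Real.rpow_add hl, Real.rpow_neg hl.le, Real.rpow_natCast, div_eq_mul_inv]

lemma mul_rpow_neg_natCast_sub_one_add {l : ℝ} (hl : 0 < l) (K d c : ℝ) (N : ℕ) :
    3 * (3 ^ N * K) * d * l ^ (-(N : ℝ) - 1 + c) =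
      3 * (3 ^ N * (K * (d * l ^ c / l) / l ^ N)) := by
  rw [sub_eq_add_neg, add_assoc, rpow_neg_natCast_add hl, neg_add_eq_sub,
    Real.rpow_sub_one hl.ne']
  ring

lemma CNaB.mono {F : Type*} [NormedAddCommGroup F] [NormedSpace ℝ F] {N : ℕ} {α B B' : ℝ}
    {g : V3 → F} (h : CNaB N α B g) (hB : B ≤ B') : CNaB N α B' g :=
  ⟨fun k hk x => (h.1 k hk x).trans hB, fun x y => (h.2 x y).trans (by gcongr)⟩

theorem exists_holder_stability_bound {α : ℝ} (hα0 : 0 < α) (hα1 : α < 1) (m : ℕ) {C₁ : ℝ}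
    (hC₁ : 0 < C₁) :
    ∃ ε > 0, ∃ K > 0, ∀ {l D τ d s : ℝ} {I : Set ℝ}
      {vl : ℝ → V3 → V3} {θl pl : ℝ → V3 → ℝ} {Rl : ℝ → V3 → Fin 3 → Fin 3 → ℝ}
      {Tl : ℝ → V3 → V3} {vi : ℝ → V3 → V3} {θi pi : ℝ → V3 → ℝ},
      0 < l → l ≤ 1 → 1 ≤ D → 0 < τ → 0 < d → l ^ α ≤ ε → τ * D = l ^ (2 * α) →
      RelaxedOn I vl θl pl Rl Tl →
      (∀ k ≤ m + 1, ∀ t ∈ I, ∀ x : V3,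
        ‖iteratedFDeriv ℝ (k + 1) (vl t) x‖ ≤ C₁ * D * l ^ (-(k : ℝ)) ∧
        ‖iteratedFDeriv ℝ (k + 1) (θl t) x‖ ≤ C₁ * D * l ^ (-(k : ℝ))) →
      (∀ k ≤ m + 1, ∀ t ∈ I,
        CNaB k α (C₁ * d * l ^ (-(k : ℝ) + 5 * α / 4)) (Rl t) ∧
        CNaB k α (C₁ * d * l ^ (-(k : ℝ) + 5 * α / 4)) (Tl t)) →
      Icc (s - τ) (s + τ) ⊆ I →
      ClassicalOn (Icc (s - τ) (s + τ)) vi θi pi →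
      (∀ x : V3, vi s x = vl s x ∧ θi s x = θl s x) →
      ∀ t ∈ Icc (s - τ) (s + τ),
        (∀ N ≤ m,
          (CNaB N α (3 * (3 ^ N * (K * (τ * (d * l ^ (5 * α / 4) / l)) / l ^ N)))
              (fun x => vi t x - vl t x) ∧
            CNaB N α (3 * (3 ^ N * (K * (τ * (d * l ^ (5 * α / 4) / l)) / l ^ N)))
              (fun x => θi t x - θl t x)) ∧
          CNaB N α (3 * (3 ^ N * (K * (d * l ^ (5 * α / 4) / l) / l ^ N)))
              (fun x => (fun i => pd (pi t) i x - pd (pl t) i x : V3)) ∧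
          CNaB N α (3 * (3 ^ N * (K * (d * l ^ (5 * α / 4) / l) / l ^ N)))
              (fun x => (fun i => matD vl (fun s y => vi s y i - vl s y i) t x : V3)) ∧
          CNaB N α (3 * (3 ^ N * (K * (d * l ^ (5 * α / 4) / l) / l ^ N)))
              (fun x => matD vl (fun s y => θi s y - θl s y) t x)) ∧
        CNaB 0 α (2 * (K * (τ * (d * l ^ (5 * α / 4)))))
          (fun x => RopR (fun y => vi t y - vl t y) x) ∧
        CNaB 0 α (2 * (K * (τ * (d * l ^ (5 * α / 4)))))
          (fun x => Rvex (fun y => θi t y - θl t y) x) := by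
  obtain ⟨ε, hε, K, hK, key⟩ := exists_stability_bound hα0 hα1 m hC₁
  refine ⟨ε, hε, K, hK, ?_⟩
  intro l D τ d s I vl θl pl Rl Tl vi θi pi hl hl1 hD hτ hd hlε hτD hrel hbd hst hI hcl hdata t ht
  have hδ : 0 < d * l ^ (5 * α / 4) := by positivity
  have hgrad : ∀ t ∈ Icc (s - τ) (s + τ), ∀ k ≤ m + 1, ∀ x,
      ‖iteratedFDeriv ℝ (k + 1) (vl t) x‖ ≤ C₁ * D / l ^ k ∧
      ‖iteratedFDeriv ℝ (k + 1) (θl t) x‖ ≤ C₁ * D / l ^ k := by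
    intro t ht k hk x
    have := hbd k hk t (hI ht) x
    rwa [Real.rpow_neg hl.le, Real.rpow_natCast, ← div_eq_mul_inv] at this
  have hstress : ∀ t ∈ Icc (s - τ) (s + τ), ∀ k ≤ m + 1,
      CNaB k α (C₁ * (d * l ^ (5 * α / 4)) / l ^ k) (Rl t) ∧
      CNaB k α (C₁ * (d * l ^ (5 * α / 4)) / l ^ k) (Tl t) := by
    intro t ht k hk
    have := hst k hk t (hI ht)
    rwa [rpow_neg_natCast_add hl, mul_div_assoc', mul_assoc C₁] at this
  have hB := hrel.boussinesqOn.mono hI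
  obtain ⟨⟨h1, h2⟩, h3, ⟨h4, h5⟩, A, ψ, hA, hψ, h6, h7⟩ := key hl hl1 hD hτ hδ hlε hτD
    hcl.boussinesqOn hB
    (fun t ht i j => hrel.HB_D_vel hl hl1 hα0.le hα1.le (fun k hk x => (hgrad t ht k hk x).1) i j)
    (fun t ht i => hrel.HB_D_temp hl hl1 hα0.le hα1.le (fun k hk x => (hgrad t ht k hk x).2) i)
    (fun t ht i j => hrel.HB_stress hl (fun k hk => (hstress t ht k hk).1) i j)
    (fun t ht i => hrel.HB_flux hl (fun k hk => (hstress t ht k hk).2) i)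
    (fun i => SmPer.ext' fun x => congrFun (hdata x).1 i)
    (SmPer.ext' fun x => (hdata x).2) t ht
  have hmd : ∀ f : STPer, (STPer.sl t (STPer.MD hrel.vel f) : V3 → ℝ) =
      fun x => matD vl (fun s y => f (s, y)) t x := by
    intro f
    funext x
    rw [STPer.sl_MD, SmPer.add_apply, SmPer.sum_apply]
    rfl
  have hv : (fun x => vi t x - vl t x) =
      fun x i => (STPer.sl t (hcl.vel i - hrel.vel i) : V3 → ℝ) x := by
    funext x i
    rw [map_sub, SmPer.sub_apply]
    rfl
  have hθ : (fun x => θi t x - θl t x) = (STPer.sl t (hcl.temp - hrel.temp) : V3 → ℝ) := by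
    funext x
    rw [map_sub, SmPer.sub_apply]
    rfl
  have hp : (fun x => (fun i => pd (pi t) i x - pd (pl t) i x : V3)) =
      fun x i => (SmPer.D i (STPer.sl t (hcl.press - hrel.press)) : V3 → ℝ) x := by
    funext x i
    rw [map_sub, map_sub, SmPer.sub_apply]
    rfl
  have hDv : (fun x => (fun i => matD vl (fun s y => vi s y i - vl s y i) t x : V3)) =
      fun x i => (STPer.sl t (STPer.MD hrel.vel (hcl.vel i - hrel.vel i)) : V3 → ℝ) x := by
    funext x i
    rw [hmd]
    rfl
  have hDθ : (fun x => matD vl (fun s y => θi s y - θl s y) t x) =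
      (STPer.sl t (STPer.MD hrel.vel (hcl.temp - hrel.temp)) : V3 → ℝ) := by
    rw [hmd]
    rfl
  refine ⟨fun N hN => ⟨⟨?_, ?_⟩, ?_, ?_, ?_⟩, ?_, ?_⟩
  · rw [hv]
    exact CNaB.of_components fun i => CNaB.of_HB hl hl1 (h1 i) hN le_rfl
  · rw [hθ]
    exact CNaB.of_HB hl hl1 h2 hN (le_mul_of_one_le_left (by positivity) (by norm_num))
  · rw [hp]
    exact CNaB.of_components fun i => CNaB.of_HB hl hl1 (h3 i) hN le_rfl
  · rw [hDv]
    exact CNaB.of_components fun i => CNaB.of_HB hl hl1 (h4 i) hN le_rfl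
  · rw [hDθ]
    exact CNaB.of_HB hl hl1 h5 hN (le_mul_of_one_le_left (by positivity) (by norm_num))
  · refine CNaB.zero_pi fun i => CNaB.zero_pi fun j => ?_
    have := (((h6 i j).add (h6 j i)).mono (two_mul _).symm.le).cNaB_zero
    convert this using 2 with x
    exact SmPer.RopR_eq (hcl.boussinesqOn.divfree_sub hB ht) hA x i j
  · refine CNaB.zero_pi fun i => ?_
    have := ((h7 i).mono (le_mul_of_one_le_left (h7 i).nonneg one_le_two)).cNaB_zero
    convert this using 2 with x
    exact SmPer.Rvex_eq hψ x i

/-- stability estimates comparing the exact Boussinesq flow started from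
mollified data at time `tᵢ` with the mollified relaxed solution, on `[tᵢ-τ_q, tᵢ+τ_q]`. -/
theorem stmt16 (β b α : ℝ) (hβ0 : 0 < β) (hβ : β < 1/3)
    (hb1 : 1 < b) (hb2 : b < min (1 + (1 - 3*β)/(2*β)) 2)
    (hα0 : 0 < α) (hα1 : α < β * (b - 1) / 3)
    (N0 : ℕ) (hN0 : 1 ≤ N0) (C₁ : ℝ) (hC₁ : 0 < C₁) :
    ∃ a₀ : ℝ, 1 < a₀ ∧ ∀ N : ℕ, N ≤ N0 + 1 → ∃ C : ℝ, 0 < C ∧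
      ∀ a : ℝ, a₀ ≤ a →
        (∀ q' : ℕ, 1 ≤ q' →
          lamP a b (q'+1) ^ (-((N0:ℝ) - α)) * ellP a b β α q' ^ (-((N0:ℝ) + α))
            ≤ lamP a b (q'+1) ^ (-(1 - α))) →
        ∀ q : ℕ, 1 ≤ q → ∀ T : ℝ, 0 < T →
          ∀ (vl : ℝ → V3 → V3) (θl pl : ℝ → V3 → ℝ)
            (Rl : ℝ → V3 → Fin 3 → Fin 3 → ℝ) (Tl : ℝ → V3 → V3),
            RelaxedOn (Icc 0 T) vl θl pl Rl Tl →
            (∀ M : ℕ, M ≤ N0 + 2 → ∀ t ∈ Icc (0:ℝ) T, ∀ k : ℕ, k ≤ M + 1 → ∀ x : V3,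
              ‖iteratedFDeriv ℝ k (vl t) x‖
                  ≤ C₁ * delP a b β q ^ ((1:ℝ)/2) * lamP a b q * ellP a b β α q ^ (-(M:ℝ)) ∧
              ‖iteratedFDeriv ℝ k (θl t) x‖
                  ≤ C₁ * delP a b β q ^ ((1:ℝ)/2) * lamP a b q * ellP a b β α q ^ (-(M:ℝ))) →
            (∀ M : ℕ, M ≤ N0 + 2 → ∀ t ∈ Icc (0:ℝ) T,
              CNaB M α (C₁ * delP a b β (q+1) * ellP a b β α q ^ (-(M:ℝ) + 5*α/4)) (Rl t) ∧
              CNaB M α (C₁ * delP a b β (q+1) * ellP a b β α q ^ (-(M:ℝ) + 5*α/4)) (Tl t)) →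
            ∀ ti : ℝ,
              Icc (ti - tauP a b β α q) (ti + tauP a b β α q) ⊆ Icc 0 T →
              ∀ (vi : ℝ → V3 → V3) (θi pi : ℝ → V3 → ℝ),
                ClassicalOn (Icc (ti - tauP a b β α q) (ti + tauP a b β α q)) vi θi pi →
                (∀ x : V3, vi ti x = vl ti x ∧ θi ti x = θl ti x) →
                ∀ t ∈ Icc (ti - tauP a b β α q) (ti + tauP a b β α q),
                  (CNaB N α
                      (C * tauP a b β α q * delP a b β (q+1)
                        * ellP a b β α q ^ (-(N:ℝ) - 1 + 5*α/4))
                      (fun x => vi t x - vl t x) ∧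
                    CNaB N α
                      (C * tauP a b β α q * delP a b β (q+1)
                        * ellP a b β α q ^ (-(N:ℝ) - 1 + 5*α/4))
                      (fun x => θi t x - θl t x)) ∧
                  CNaB N α
                      (C * delP a b β (q+1) * ellP a b β α q ^ (-(N:ℝ) - 1 + 5*α/4))
                      (fun x => (fun i => pd (pi t) i x - pd (pl t) i x : V3)) ∧
                  (CNaB N α
                      (C * delP a b β (q+1) * ellP a b β α q ^ (-(N:ℝ) - 1 + 5*α/4))
                      (fun x => (fun i =>
                        matD vl (fun s y => vi s y i - vl s y i) t x : V3)) ∧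
                    CNaB N α
                      (C * delP a b β (q+1) * ellP a b β α q ^ (-(N:ℝ) - 1 + 5*α/4))
                      (fun x => matD vl (fun s y => θi s y - θl s y) t x)) ∧
                  (CNaB 0 α
                      (C * tauP a b β α q * delP a b β (q+1) * ellP a b β α q ^ (5*α/4))
                      (fun x => RopR (fun y => vi t y - vl t y) x) ∧
                    CNaB 0 α
                      (C * tauP a b β α q * delP a b β (q+1) * ellP a b β α q ^ (5*α/4))
                      (fun x => Rvex (fun y => θi t y - θl t y) x)) := by
  have hαlt : α < 1 := by nlinarith [hb2.trans_le (min_le_right _ _)]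
  obtain ⟨ε, hε, K, hK, key⟩ := exists_holder_stability_bound hα0 hαlt (N0 + 1) hC₁
  refine ⟨max 2 (ε⁻¹ ^ α⁻¹), lt_max_of_lt_left one_lt_two, fun N hN =>
    ⟨3 * (3 ^ N * K), by positivity, ?_⟩⟩
  intro a ha _ q _ T _ vl θl pl Rl Tl hrel hbd hst ti hI vi θi pi hcl hdata t ht
  have ha1 : 1 ≤ a := by linarith [le_max_left (2 : ℝ) (ε⁻¹ ^ α⁻¹)]
  have hβ1 : β ≤ 1 := by linarith
  have hl : 0 < ellP a b β α q := ellP_pos ha1 hb1.le q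
  have hτ : 0 < tauP a b β α q := tauP_pos ha1 hb1.le hβ0.le hβ1 q
  have hd : 0 < delP a b β (q + 1) := delP_pos ha1 hb1.le (q + 1)
  obtain ⟨h, h6, h7⟩ := key hl
    ((ellP_le ha1 hb1.le hβ0.le hα0.le q).trans (inv_le_one_of_one_le₀ ha1))
    (one_le_delP_mul_lamP ha1 hb1.le hβ0.le hβ1 q) hτ hd
    (ellP_rpow_le ha1 hb1.le hβ0.le hα0 hε ((le_max_right _ _).trans ha) q)
    (tauP_mul ha1 hb1.le hβ0.le hβ1 q) hrel
    (fun k hk t ht x => by simpa only [mul_assoc] using hbd k hk t ht (k + 1) le_rfl x)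
    hst hI hcl hdata t ht
  obtain ⟨⟨h1, h2⟩, h3, h4, h5⟩ := h N hN
  have e1 : 3 * (3 ^ N * K) * tauP a b β α q * delP a b β (q + 1) *
        ellP a b β α q ^ (-(N : ℝ) - 1 + 5 * α / 4) =
      3 * (3 ^ N * (K * (tauP a b β α q * (delP a b β (q + 1) * ellP a b β α q ^ (5 * α / 4) /
        ellP a b β α q)) / ellP a b β α q ^ N)) := by
    rw [mul_assoc _ (tauP a b β α q), mul_rpow_neg_natCast_sub_one_add hl]
    ring
  have e : 2 * (K * (tauP a b β α q * (delP a b β (q + 1) * ellP a b β α q ^ (5 * α / 4)))) ≤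
      3 * (3 ^ N * K) * tauP a b β α q * delP a b β (q + 1) * ellP a b β α q ^ (5 * α / 4) := by
    have h3N : (1 : ℝ) ≤ 3 ^ N := one_le_pow₀ (by norm_num)
    calc _ ≤ 3 * 3 ^ N *
        (K * (tauP a b β α q * (delP a b β (q + 1) * ellP a b β α q ^ (5 * α / 4)))) := by
          gcongr
          linarith
      _ = _ := by ring
  rw [e1, mul_rpow_neg_natCast_sub_one_add hl]
  exact ⟨⟨h1, h2⟩, h3, ⟨h4, h5⟩, h6.mono e, h7.mono e⟩
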